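/- Suppose ℋ is a hereditary 3-graph property and for some integer L≥1, L = max{K∈ℕ : B_ℋ ∩ Irr(K) ≠ ∅}. Then for all sufficiently small ε₁>0 and all ε₂:ℕ→(0,1] tending to 0 sufficiently fast, L_ℋ(ε₁,ε₂) ≤ L. -/

import Mathlib

open scoped Classical
open Finset

set_option maxHeartbeats 1000000

/-- A 3-uniform hypergraph on a finite vertex set of naturals. -/
structure ThreeGraph where
  verts : Finset ℕ
  edges : Finset (Finset ℕ)
  edges_sub : ∀ e ∈ edges, e ⊆ verts ∧ e.card = 3

/-- The set `Ē` of ordered triples corresponding to edges. -/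
def ThreeGraph.obar (H : ThreeGraph) : Finset (ℕ × ℕ × ℕ) :=
  (H.verts ×ˢ H.verts ×ˢ H.verts).filter fun p => ({p.1, p.2.1, p.2.2} : Finset ℕ) ∈ H.edges

/-- A bigraph `(U,V;E)`. -/
structure Bigraph where
  left : Finset ℕ
  right : Finset ℕ
  edges : Finset (ℕ × ℕ)
  edges_sub : edges ⊆ left ×ˢ right

noncomputable def Bigraph.density (B : Bigraph) : ℝ :=
  (B.edges.card : ℝ) / ((B.left.card : ℝ) * (B.right.card : ℝ))

noncomputable def Bigraph.gfun (B : Bigraph) (u w : ℕ) : ℝ :=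
  if (u, w) ∈ B.edges then 1 - B.density else -B.density

noncomputable def Bigraph.devSum (B : Bigraph) : ℝ :=
  ∑ u₀ ∈ B.left, ∑ u₁ ∈ B.left, ∑ w₀ ∈ B.right, ∑ w₁ ∈ B.right,
    B.gfun u₀ w₀ * B.gfun u₀ w₁ * B.gfun u₁ w₀ * B.gfun u₁ w₁

/-- `B` has `dev₂(ε,d)`. -/
def Bigraph.dev2 (B : Bigraph) (ε d : ℝ) : Prop :=
  |B.density - d| ≤ ε ∧ B.devSum ≤ ε * (B.left.card : ℝ) ^ 2 * (B.right.card : ℝ) ^ 2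

/-- `B` has `dev₂(ε)`, i.e. `dev₂(ε, d_B)`. -/
def Bigraph.dev2self (B : Bigraph) (ε : ℝ) : Prop := B.dev2 ε B.density

noncomputable def Bigraph.dBetween (B : Bigraph) (X Y : Finset ℕ) : ℝ :=
  ((B.edges ∩ X ×ˢ Y).card : ℝ) / ((X.card : ℝ) * (Y.card : ℝ))

/-- `ε`-regularity for a bigraph. -/
def Bigraph.EpsRegular (B : Bigraph) (ε : ℝ) : Prop :=
  ∀ X ⊆ B.left, ∀ Y ⊆ B.right,
    ε * (B.left.card : ℝ) ≤ (X.card : ℝ) → ε * (B.right.card : ℝ) ≤ (Y.card : ℝ) →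
      |B.density - B.dBetween X Y| ≤ ε

/-- Irreducibility: distinct vertices have distinct neighborhoods, on both sides. -/
def Bigraph.Irreducible (B : Bigraph) : Prop :=
  (∀ u ∈ B.left, ∀ u' ∈ B.left, (∀ v : ℕ, (u, v) ∈ B.edges ↔ (u', v) ∈ B.edges) → u = u') ∧
  (∀ v ∈ B.right, ∀ v' ∈ B.right, (∀ u : ℕ, (u, v) ∈ B.edges ↔ (u, v') ∈ B.edges) → v = v')

def Bigraph.leftNbhd (B : Bigraph) (v : ℕ) : Finset ℕ :=
  B.left.filter fun u => (u, v) ∈ B.edges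

/-- `B` contains an induced copy of the abstract bigraph on `Fin k × Fin k` given by `F`. -/
def Bigraph.HasInducedPattern (B : Bigraph) (k : ℕ) (F : Fin k → Fin k → Prop) : Prop :=
  ∃ u v : Fin k → ℕ, (∀ a, u a ∈ B.left) ∧ (∀ b, v b ∈ B.right) ∧
    ∀ a b, ((u a, v b) ∈ B.edges ↔ F a b)

/-- A triad `(X,Y,Z; E_XY, E_YZ, E_XZ)`. -/
structure Triad where
  X : Finset ℕ
  Y : Finset ℕ
  Z : Finset ℕ
  EXY : Finset (ℕ × ℕ)
  EYZ : Finset (ℕ × ℕ)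
  EXZ : Finset (ℕ × ℕ)
  hXY : EXY ⊆ X ×ˢ Y
  hYZ : EYZ ⊆ Y ×ˢ Z
  hXZ : EXZ ⊆ X ×ˢ Z

def Triad.K3 (G : Triad) : Finset (ℕ × ℕ × ℕ) :=
  (G.X ×ˢ G.Y ×ˢ G.Z).filter fun p =>
    (p.1, p.2.1) ∈ G.EXY ∧ (p.2.1, p.2.2) ∈ G.EYZ ∧ (p.1, p.2.2) ∈ G.EXZ

def Triad.bXY (G : Triad) : Bigraph := ⟨G.X, G.Y, G.EXY, G.hXY⟩
def Triad.bYZ (G : Triad) : Bigraph := ⟨G.Y, G.Z, G.EYZ, G.hYZ⟩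
def Triad.bXZ (G : Triad) : Bigraph := ⟨G.X, G.Z, G.EXZ, G.hXZ⟩

/-- `d_H(G)` where the (tri)graph is given by its set `R` of ordered triples. -/
noncomputable def relDensity (R : Finset (ℕ × ℕ × ℕ)) (G : Triad) : ℝ :=
  ((R ∩ G.K3).card : ℝ) / (G.K3.card : ℝ)

noncomputable def hFun (R : Finset (ℕ × ℕ × ℕ)) (G : Triad) (x y z : ℕ) : ℝ :=
  if (x, y, z) ∈ G.K3 then
    (if (x, y, z) ∈ R then 1 - relDensity R G else -(relDensity R G))
  else 0

noncomputable def devSum3 (R : Finset (ℕ × ℕ × ℕ)) (G : Triad) : ℝ :=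
  ∑ u₀ ∈ G.X, ∑ u₁ ∈ G.X, ∑ w₀ ∈ G.Y, ∑ w₁ ∈ G.Y, ∑ z₀ ∈ G.Z, ∑ z₁ ∈ G.Z,
    hFun R G u₀ w₀ z₀ * hFun R G u₀ w₀ z₁ * hFun R G u₀ w₁ z₀ * hFun R G u₀ w₁ z₁ *
      hFun R G u₁ w₀ z₀ * hFun R G u₁ w₀ z₁ * hFun R G u₁ w₁ z₀ * hFun R G u₁ w₁ z₁

/-- `(H,G)` has `dev_{2,3}(ε₁,ε₂)`, where the trigraph/3-graph is given by triples `R`. -/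
def dev23 (R : Finset (ℕ × ℕ × ℕ)) (G : Triad) (ε₁ ε₂ : ℝ) : Prop :=
  ∃ dXY dYZ dXZ : ℝ, 0 < dXY ∧ 0 < dYZ ∧ 0 < dXZ ∧
    G.bXY.dev2 ε₂ dXY ∧ G.bXZ.dev2 ε₂ dXZ ∧ G.bYZ.dev2 ε₂ dYZ ∧
    devSum3 R G ≤ ε₁ * dXY ^ 4 * dYZ ^ 4 * dXZ ^ 4 *
      (G.X.card : ℝ) ^ 2 * (G.Y.card : ℝ) ^ 2 * (G.Z.card : ℝ) ^ 2

/-- `G` is `μ`-homogeneous with respect to the triples `R`: `d_H(G) ∈ [0,μ) ∪ (1-μ,1]`. -/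
def homTriad (R : Finset (ℕ × ℕ × ℕ)) (G : Triad) (μ : ℝ) : Prop :=
  relDensity R G < μ ∨ 1 - μ < relDensity R G

/-- A `(t,ℓ)`-decomposition of `V`, with part-indices `ι` and pair-indices `κ`. -/
structure Decomp (V : Finset ℕ) (ι κ : Type) where
  part : ι → Finset ℕ
  part_sub : ∀ i, part i ⊆ V
  part_disj : ∀ i j, i ≠ j → Disjoint (part i) (part j)
  part_cover : ∀ x ∈ V, ∃ i, x ∈ part i
  pairs : ι → ι → κ → Finset (ℕ × ℕ)
  pairs_sub : ∀ i j α, pairs i j α ⊆ part i ×ˢ part j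
  pairs_disj : ∀ i j α β, α ≠ β → Disjoint (pairs i j α) (pairs i j β)
  pairs_cover : ∀ i j, ∀ p ∈ part i ×ˢ part j, ∃ α, p ∈ pairs i j α

def Decomp.pairBG {V : Finset ℕ} {ι κ : Type} (P : Decomp V ι κ) (i j : ι) (α : κ) : Bigraph :=
  ⟨P.part i, P.part j, P.pairs i j α, P.pairs_sub i j α⟩

/-- The triad `G^{ijk}_{α,β,γ} = (V_i,V_j,V_k; P^α_{ij}, P^β_{ik}, P^γ_{jk})`. -/
def Decomp.triadOf {V : Finset ℕ} {ι κ : Type} (P : Decomp V ι κ) (i j k : ι) (α β γ : κ) :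
    Triad :=
  ⟨P.part i, P.part j, P.part k, P.pairs i j α, P.pairs j k γ, P.pairs i k β,
    P.pairs_sub i j α, P.pairs_sub j k γ, P.pairs_sub i k β⟩

/-- `P` is a `(t,ℓ,ε₁,ε₂)`-decomposition. -/
def Decomp.isReg {V : Finset ℕ} {ι κ : Type} (P : Decomp V ι κ) (ε₁ ε₂ : ℝ) : Prop :=
  (1 - ε₁) * (V.card : ℝ) ^ 2 ≤
    (((V ×ˢ V).filter fun p =>
      ∃ i j α, p ∈ P.pairs i j α ∧ (P.pairBG i j α).dev2self ε₂).card : ℝ)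

/-- `P` is equitable. -/
def Decomp.isEquitable {V : Finset ℕ} {ι κ : Type} [Fintype κ]
    (P : Decomp V ι κ) (ε₁ ε₂ : ℝ) : Prop :=
  (∀ i j, (P.part i).card ≤ (P.part j).card + 1) ∧
  (1 - ε₁) * (V.card : ℝ) ^ 2 ≤
    (((V ×ˢ V).filter fun p =>
      ∃ i j α, p ∈ P.pairs i j α ∧
        (P.pairBG i j α).dev2 ε₂ (1 / (Fintype.card κ : ℝ))).card : ℝ)

/-- `P` is `dev_{2,3}(ε₁,ε₂)`-regular with respect to the triples `R`. -/
def Decomp.regWrt {V : Finset ℕ} {ι κ : Type} (P : Decomp V ι κ)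
    (R : Finset (ℕ × ℕ × ℕ)) (ε₁ ε₂ : ℝ) : Prop :=
  (1 - ε₁) * (V.card : ℝ) ^ 3 ≤
    (((V ×ˢ V ×ˢ V).filter fun p =>
      ∃ i j k α β γ, p ∈ (P.triadOf i j k α β γ).K3 ∧
        dev23 R (P.triadOf i j k α β γ) ε₁ ε₂).card : ℝ)

/-- The triad `G^{ijk}_{α,β,γ}` of `P` is `μ`-non-trivial. -/
def Decomp.nonTrivTriad {V : Finset ℕ} {t ℓ : ℕ} (P : Decomp V (Fin t) (Fin ℓ)) (μ : ℝ)
    (i j k : Fin t) (α β γ : Fin ℓ) : Prop :=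
  μ * (V.card : ℝ) / (t : ℝ) ≤ ((P.part i).card : ℝ) ∧
  μ * (V.card : ℝ) / (t : ℝ) ≤ ((P.part j).card : ℝ) ∧
  μ * (V.card : ℝ) / (t : ℝ) ≤ ((P.part k).card : ℝ) ∧
  μ * ((P.part i).card : ℝ) * ((P.part j).card : ℝ) / (ℓ : ℝ) ≤ ((P.pairs i j α).card : ℝ) ∧
  μ * ((P.part i).card : ℝ) * ((P.part k).card : ℝ) / (ℓ : ℝ) ≤ ((P.pairs i k β).card : ℝ) ∧
  μ * ((P.part j).card : ℝ) * ((P.part k).card : ℝ) / (ℓ : ℝ) ≤ ((P.pairs j k γ).card : ℝ)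

/-- `H` has a `dev_{2,3}(ε₁,ε₂)`-regular `(t,ℓ,ε₁,ε₂)`-decomposition. -/
def GoodDecomp (H : ThreeGraph) (t ℓ : ℕ) (ε₁ ε₂ : ℝ) : Prop :=
  ∃ P : Decomp H.verts (Fin t) (Fin ℓ), P.isReg ε₁ ε₂ ∧ P.regWrt H.obar ε₁ ε₂

def ThreeGraph.Iso (H₁ H₂ : ThreeGraph) : Prop :=
  ∃ f : ℕ → ℕ, Set.BijOn f ↑H₁.verts ↑H₂.verts ∧
    ∀ x ∈ H₁.verts, ∀ y ∈ H₁.verts, ∀ z ∈ H₁.verts,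
      (({x, y, z} : Finset ℕ) ∈ H₁.edges ↔ ({f x, f y, f z} : Finset ℕ) ∈ H₂.edges)

def ThreeGraph.induce (H : ThreeGraph) (W : Finset ℕ) : ThreeGraph where
  verts := H.verts ∩ W
  edges := H.edges.filter fun e => e ⊆ W
  edges_sub := by
    intro e he
    rw [Finset.mem_filter] at he
    obtain ⟨hsub, hcard⟩ := H.edges_sub e he.1
    exact ⟨fun x hx => Finset.mem_inter.mpr ⟨hsub hx, he.2 hx⟩, hcard⟩

/-- A hereditary property of 3-graphs. -/
def Hereditary (ℋ : Set ThreeGraph) : Prop :=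
  (∀ H₁ H₂ : ThreeGraph, ThreeGraph.Iso H₁ H₂ → H₁ ∈ ℋ → H₂ ∈ ℋ) ∧
  (∀ H ∈ ℋ, ∀ W : Finset ℕ, H.induce W ∈ ℋ)

/-- The statement `ψ(ε₁,ε₂,T,L,ℋ)`. -/
def psi (ε₁ : ℝ) (ε₂ : ℕ → ℝ) (T L : ℕ) (ℋ : Set ThreeGraph) : Prop :=
  ∃ n₀ : ℕ, ∀ H ∈ ℋ, n₀ ≤ H.verts.card →
    ∃ t ℓ : ℕ, 1 ≤ t ∧ t ≤ T ∧ 1 ≤ ℓ ∧ ℓ ≤ L ∧ GoodDecomp H t ℓ ε₁ (ε₂ ℓ)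

/-- `L_ℋ(ε₁,ε₂)`: minimal `L` such that `ψ(ε₁,ε₂,T,L,ℋ)` holds for some `T ≥ 1`. -/
noncomputable def Lfun (ℋ : Set ThreeGraph) (ε₁ : ℝ) (ε₂ : ℕ → ℝ) : ℕ :=
  sInf {L : ℕ | ∃ T : ℕ, 1 ≤ T ∧ psi ε₁ ε₂ T L ℋ}

def InZeroOne (f : ℕ → ℝ) : Prop := ∀ x, 0 < f x ∧ f x ≤ 1

/-- "For all sufficiently small `ε₁ > 0` and all `ε₂` tending to `0` sufficiently fast, `Φ`". -/
def SmallEps (Φ : ℝ → (ℕ → ℝ) → Prop) : Prop :=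
  ∃ e₁ : ℝ, 0 < e₁ ∧ ∀ ε₁ : ℝ, 0 < ε₁ → ε₁ < e₁ →
    ∃ δ : ℕ → ℝ, InZeroOne δ ∧
      ∀ ε₂ : ℕ → ℝ, InZeroOne ε₂ → (∀ x, ε₂ x ≤ δ x) → Φ ε₁ ε₂

/-- The `VC₂`-dimension of `H` is at least `k`. -/
def ThreeGraph.VC2AtLeast (H : ThreeGraph) (k : ℕ) : Prop :=
  ∃ a b : Fin k → ℕ, ∃ c : Finset (Fin k × Fin k) → ℕ,
    (∀ i, a i ∈ H.verts) ∧ (∀ i, b i ∈ H.verts) ∧ (∀ S, c S ∈ H.verts) ∧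
    ∀ (i j : Fin k) (S : Finset (Fin k × Fin k)),
      (({a i, b j, c S} : Finset ℕ) ∈ H.edges ↔ (i, j) ∈ S)

/-- `K₃[A,B,C]`: the triples meeting each of `A`, `B`, `C`. -/
def K3Parts (A B C : Finset ℕ) : Finset (Finset ℕ) :=
  (A ×ˢ B ×ˢ C).image fun p => ({p.1, p.2.1, p.2.2} : Finset ℕ)

/-- Neighborhood of `u` in the pair-set `W`, inside ambient set `V`. -/
def Nbhd (V : Finset ℕ) (W : Finset (ℕ × ℕ)) (u : ℕ) : Finset ℕ :=
  V.filter fun v => (u, v) ∈ W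

/-- An edge-colored bigraph `(U,V;E₀,E₁,E₂)`. -/
structure ECBigraph where
  left : Finset ℕ
  right : Finset ℕ
  E0 : Finset (ℕ × ℕ)
  E1 : Finset (ℕ × ℕ)
  E2 : Finset (ℕ × ℕ)
  disj01 : Disjoint E0 E1
  disj02 : Disjoint E0 E2
  disj12 : Disjoint E1 E2
  cover : E0 ∪ E1 ∪ E2 = left ×ˢ right

/-- `G` contains an `E₀/E₁`-copy of `U_bg(k)`. -/
def ECBigraph.CopyUbg (G : ECBigraph) (k : ℕ) : Prop :=
  ∃ u : Finset (Fin k) → ℕ, ∃ v : Fin k → ℕ,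
    (∀ S, u S ∈ G.left) ∧ (∀ i, v i ∈ G.right) ∧
    ∀ (S : Finset (Fin k)) (i : Fin k),
      (i ∈ S → (u S, v i) ∈ G.E1) ∧ (i ∉ S → (u S, v i) ∈ G.E0)

/-- `G` contains an `E₀/E₁`-copy of the bigraph `R`. -/
def ECBigraph.Copy01 (G : ECBigraph) (R : Bigraph) : Prop :=
  ∃ u v : ℕ → ℕ,
    (∀ a ∈ R.left, u a ∈ G.left) ∧ (∀ b ∈ R.right, v b ∈ G.right) ∧
    ∀ a ∈ R.left, ∀ b ∈ R.right,
      ((a, b) ∈ R.edges → (u a, v b) ∈ G.E1) ∧ ((a, b) ∉ R.edges → (u a, v b) ∈ G.E0)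

/-- `K₂[A,B]`: the crossing (unordered) pairs. -/
def pairsAB (A B : Finset ℕ) : Finset (Finset ℕ) :=
  (A ×ˢ B).image fun p => ({p.1, p.2} : Finset ℕ)

/-- A bipartite `U`-colored graph `Γ = (A ∪ B, (P_u)_{u ∈ U})`. -/
structure BipColored (U : Finset ℕ) where
  A : Finset ℕ
  B : Finset ℕ
  disjAB : Disjoint A B
  P : ℕ → Finset (Finset ℕ)
  P_disj : ∀ u ∈ U, ∀ u' ∈ U, u ≠ u' → Disjoint (P u) (P u')
  P_cover : U.biUnion P = pairsAB A B

/-- The bipartite graph `(A ∪ B, P_u)` of a color, as a bigraph (ordered pairs `P̄_u`). -/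
def BipColored.colorBG {U : Finset ℕ} (Γ : BipColored U) (u : ℕ) : Bigraph where
  left := Γ.A
  right := Γ.B
  edges := (Γ.A ×ˢ Γ.B).filter fun p => ({p.1, p.2} : Finset ℕ) ∈ Γ.P u
  edges_sub := Finset.filter_subset _ _

/-- `H` is an `(n,Γ)`-blowup of `G` with the explicit family `Cfam` of new vertex classes. -/
def IsBlowupWith (G : Bigraph) (n : ℕ) (Γ : BipColored G.left) (Cfam : ℕ → Finset ℕ)
    (H : ThreeGraph) : Prop :=
  (∀ v ∈ G.right, (Cfam v).card = n) ∧
  (∀ v ∈ G.right, ∀ v' ∈ G.right, v ≠ v' → Disjoint (Cfam v) (Cfam v')) ∧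
  (∀ v ∈ G.right, Disjoint (Cfam v) (Γ.A ∪ Γ.B)) ∧
  H.verts = Γ.A ∪ Γ.B ∪ G.right.biUnion Cfam ∧
  ∀ u ∈ G.left, ∀ v ∈ G.right, ∀ e ∈ Γ.P u, ∀ z ∈ Cfam v,
    (((u, v) ∈ G.edges → insert z e ∈ H.edges) ∧ ((u, v) ∉ G.edges → insert z e ∉ H.edges))

def IsBlowup (G : Bigraph) (n : ℕ) (Γ : BipColored G.left) (H : ThreeGraph) : Prop :=
  ∃ Cfam : ℕ → Finset ℕ, IsBlowupWith G n Γ Cfam H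

def ThreeGraph.ContainsInduced (H H' : ThreeGraph) : Prop :=
  ∃ W : Finset ℕ, ThreeGraph.Iso (H.induce W) H'

/-- The `G`-dimension of `H` is at least `n`. -/
def GDimAtLeast (G : Bigraph) (H : ThreeGraph) (n : ℕ) : Prop :=
  ∀ Γ : BipColored G.left, Γ.A.card = n → Γ.B.card = n →
    ∃ H' : ThreeGraph, IsBlowup G n Γ H' ∧ H.ContainsInduced H'

/-- `G ∈ B_ℋ`: `G` is irreducible and `ℋ` has infinite `G`-dimension. -/
def InBH (ℋ : Set ThreeGraph) (G : Bigraph) : Prop :=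
  G.Irreducible ∧ ∀ m : ℕ, ∃ H ∈ ℋ, GDimAtLeast G H m

/-- An encoding of the bigraph `R` in `(H,P)`, where `Rtrip = Ē(H)`. -/
def Encoding {V : Finset ℕ} {t ℓ : ℕ} (R : Bigraph) (Rtrip : Finset (ℕ × ℕ × ℕ))
    (P : Decomp V (Fin t) (Fin ℓ)) (ε₂ : ℝ) : Prop :=
  ∃ j₀ k₀ : Fin t, j₀ ≠ k₀ ∧
    ∃ f : ℕ → Fin ℓ, ∃ g : ℕ → Fin t × Fin ℓ × Fin ℓ,
      (∀ u ∈ R.left, (P.pairBG j₀ k₀ (f u)).dev2 ε₂ (1 / (ℓ : ℝ))) ∧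
      (∀ v ∈ R.right,
        (P.pairBG (g v).1 j₀ (g v).2.1).dev2 ε₂ (1 / (ℓ : ℝ)) ∧
        (P.pairBG (g v).1 k₀ (g v).2.2).dev2 ε₂ (1 / (ℓ : ℝ))) ∧
      ∀ u ∈ R.left, ∀ v ∈ R.right,
        (((u, v) ∈ R.edges →
          ((P.triadOf (g v).1 j₀ k₀ (g v).2.1 (g v).2.2 (f u)).K3.card : ℝ) / 2 ≤
            ((Rtrip ∩ (P.triadOf (g v).1 j₀ k₀ (g v).2.1 (g v).2.2 (f u)).K3).card : ℝ)) ∧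
         ((u, v) ∉ R.edges →
          ((Rtrip ∩ (P.triadOf (g v).1 j₀ k₀ (g v).2.1 (g v).2.2 (f u)).K3).card : ℝ) <
            ((P.triadOf (g v).1 j₀ k₀ (g v).2.1 (g v).2.2 (f u)).K3.card : ℝ) / 2))

def encodeSet (S : Finset ℕ) : ℕ := ∑ i ∈ S, 2 ^ i

/-- The bigraph `U_bg(k)` realized on `ℕ`, with subsets of `[k]` encoded in binary. -/
def Ubg (k : ℕ) : Bigraph where
  left := ((Finset.range k).powerset).image encodeSet
  right := Finset.range k
  edges := ((Finset.range k).powerset).biUnion fun S => S.image fun i => (encodeSet S, i)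
  edges_sub := by
    intro p hp
    simp only [Finset.mem_biUnion, Finset.mem_image, Finset.mem_powerset] at hp
    obtain ⟨S, hS, i, hi, rfl⟩ := hp
    refine Finset.mem_product.mpr ⟨?_, ?_⟩
    · exact Finset.mem_image.mpr ⟨S, Finset.mem_powerset.mpr hS, rfl⟩
    · exact hS hi

set_option linter.unusedSectionVars false

namespace HypReg

open scoped BigOperators

/-- The indicator of a proposition. -/
noncomputable def ind (p : Prop) : ℝ := if p then 1 else 0

lemma ind_nonneg (p : Prop) : 0 ≤ ind p := by unfold ind; split_ifs <;> norm_num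
lemma ind_le_one (p : Prop) : ind p ≤ 1 := by unfold ind; split_ifs <;> norm_num
lemma abs_ind_le_one (p : Prop) : |ind p| ≤ 1 := by unfold ind; split_ifs <;> norm_num
@[simp] lemma ind_true {p : Prop} (h : p) : ind p = 1 := by simp [ind, h]
@[simp] lemma ind_false {p : Prop} (h : ¬ p) : ind p = 0 := by simp [ind, h]
lemma ind_and (p q : Prop) : ind (p ∧ q) = ind p * ind q := by
  unfold ind; by_cases hp : p <;> by_cases hq : q <;> simp [hp, hq]
lemma ind_or_le (p q : Prop) : ind (p ∨ q) ≤ ind p + ind q := by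
  unfold ind; by_cases hp : p <;> by_cases hq : q <;> simp [hp, hq]
lemma ind_mono {p q : Prop} (h : p → q) : ind p ≤ ind q := by
  by_cases hp : p
  · simp [hp, h hp]
  · simp [hp, ind_nonneg]
lemma ind_congr {p q : Prop} (h : p ↔ q) : ind p = ind q := by simp only [h]
lemma ind_not (p : Prop) : ind (¬ p) = 1 - ind p := by
  by_cases hp : p <;> simp [hp]

lemma sum_ind_eq {κ : Type*} [Fintype κ] (a : κ) (g : κ → ℝ) : ∑ k, ind (a = k) * g k = g a := by
  simp [ind]

lemma sum_ind_eq_one {κ : Type*} [Fintype κ] (a : κ) : ∑ k, ind (a = k) = 1 := by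
  simp [ind]

section Expect
variable {X Y : Type*} [Fintype X] [Fintype Y]

lemma expect_mono {f g : X → ℝ} (h : ∀ x, f x ≤ g x) : 𝔼 x, f x ≤ 𝔼 x, g x :=
  expect_le_expect fun x _ => h x

lemma expect_nn {f : X → ℝ} (h : ∀ x, 0 ≤ f x) : 0 ≤ 𝔼 x, f x :=
  expect_nonneg fun x _ => h x

lemma expect_le_const [Nonempty X] {f : X → ℝ} {c : ℝ} (h : ∀ x, f x ≤ c) : 𝔼 x, f x ≤ c :=
  expect_le univ_nonempty fun x _ => h x

lemma expect_prod (f : X × Y → ℝ) : 𝔼 p, f p = 𝔼 x, 𝔼 y, f (x, y) := by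
  rw [← univ_product_univ, expect_product]

lemma expect_sq_le [Nonempty X] (f : X → ℝ) : (𝔼 x, f x) ^ 2 ≤ 𝔼 x, f x ^ 2 := by
  have := expect_mul_sq_le_sq_mul_sq univ f (fun _ : X => (1 : ℝ))
  simpa using this

lemma expect_abs_le_sqrt [Nonempty X] (f : X → ℝ) {s : ℝ} (hs : 0 ≤ s)
    (h : 𝔼 x, f x ^ 2 ≤ s ^ 2) : 𝔼 x, |f x| ≤ s := by
  have h1 := expect_sq_le fun x => |f x|
  simp only [sq_abs] at h1
  exact abs_le_of_sq_le_sq' (h1.trans h) hs |>.2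

lemma expect_sum {κ : Type*} (s : Finset κ) (f : X → κ → ℝ) :
    𝔼 x, ∑ k ∈ s, f x k = ∑ k ∈ s, 𝔼 x, f x k := expect_sum_comm _ _ _

end Expect

section CondExp
variable {Ω κ κ' : Type*} [Fintype Ω]

/-- The conditional expectation of `f` with respect to the partition into fibres of `π`. -/
noncomputable def CE (π : Ω → κ) (f : Ω → ℝ) (ω : Ω) : ℝ :=
  (∑ ω', ind (π ω' = π ω) * f ω') / ∑ ω', ind (π ω' = π ω)

lemma CE_den_pos (π : Ω → κ) (ω : Ω) : 0 < ∑ ω', ind (π ω' = π ω) :=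
  sum_pos' (fun _ _ => ind_nonneg _) ⟨ω, mem_univ _, by simp⟩

lemma CE_const (π : Ω → κ) (f : Ω → ℝ) {ω ω' : Ω} (h : π ω = π ω') : CE π f ω = CE π f ω' := by
  simp only [CE, h]

lemma CE_nonneg (π : Ω → κ) {f : Ω → ℝ} (hf : ∀ ω, 0 ≤ f ω) (ω : Ω) : 0 ≤ CE π f ω :=
  div_nonneg (sum_nonneg fun _ _ => mul_nonneg (ind_nonneg _) (hf _)) (CE_den_pos π ω).le

lemma CE_le_one (π : Ω → κ) {f : Ω → ℝ} (hf : ∀ ω, f ω ≤ 1) (ω : Ω) : CE π f ω ≤ 1 := by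
  rw [CE, div_le_one (CE_den_pos π ω)]
  exact sum_le_sum fun _ _ => mul_le_of_le_one_right (ind_nonneg _) (hf _)

lemma expect_CE_mul (π : Ω → κ) (f h : Ω → ℝ) (hh : ∀ ω ω', π ω = π ω' → h ω = h ω') :
    𝔼 ω, CE π f ω * h ω = 𝔼 ω, f ω * h ω := by
  rw [Fintype.expect_eq_sum_div_card, Fintype.expect_eq_sum_div_card]
  congr 1
  calc ∑ ω, CE π f ω * h ω
      = ∑ ω, ∑ ω', ind (π ω' = π ω) * (f ω' * h ω' / ∑ ω'', ind (π ω'' = π ω')) := by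
        refine sum_congr rfl fun ω _ => ?_
        rw [CE, div_mul_eq_mul_div, sum_mul, sum_div]
        refine sum_congr rfl fun ω' _ => ?_
        by_cases e : π ω' = π ω
        · rw [hh _ _ e.symm]; simp only [e]; ring
        · simp [e]
    _ = ∑ ω', f ω' * h ω' := by
        rw [sum_comm]
        refine sum_congr rfl fun ω' _ => ?_
        rw [← sum_mul]
        have : ∑ i, ind (π ω' = π i) = ∑ i, ind (π i = π ω') :=
          sum_congr rfl fun i _ => ind_congr eq_comm
        rw [this, mul_div_cancel₀ _ (CE_den_pos π ω').ne']

/-- The energy of `f` with respect to the partition `π`. -/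
noncomputable def energy (π : Ω → κ) (f : Ω → ℝ) : ℝ := 𝔼 ω, CE π f ω ^ 2

/-- `π'` refines `π`. -/
def Refines (π' : Ω → κ') (π : Ω → κ) : Prop := ∀ ω ω', π' ω = π' ω' → π ω = π ω'

lemma energy_nonneg (π : Ω → κ) (f : Ω → ℝ) : 0 ≤ energy π f := expect_nn fun _ => sq_nonneg _

lemma energy_le_one [Nonempty Ω] (π : Ω → κ) {f : Ω → ℝ} (h0 : ∀ ω, 0 ≤ f ω) (h1 : ∀ ω, f ω ≤ 1) :
    energy π f ≤ 1 :=
  expect_le_const fun ω => pow_le_one₀ (CE_nonneg π h0 ω) (CE_le_one π h1 ω)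

lemma energy_pythag {π' : Ω → κ'} {π : Ω → κ} (h : Refines π' π) (f : Ω → ℝ) :
    𝔼 ω, (CE π' f ω - CE π f ω) ^ 2 = energy π' f - energy π f := by
  have e1 := expect_CE_mul π' f (CE π f) fun ω ω' hω => CE_const _ _ (h _ _ hω)
  have e2 := expect_CE_mul π f (CE π f) fun ω ω' hω => CE_const _ _ hω
  have : ∀ ω, (CE π' f ω - CE π f ω) ^ 2
      = CE π' f ω ^ 2 - 2 * (CE π' f ω * CE π f ω) + CE π f ω * CE π f ω := fun ω => by ring
  simp only [this, expect_add_distrib, expect_sub_distrib, ← mul_expect, energy]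
  rw [e1, ← e2]
  simp only [sq]
  ring

lemma energy_mono {π' : Ω → κ'} {π : Ω → κ} (h : Refines π' π) (f : Ω → ℝ) :
    energy π f ≤ energy π' f := by
  have := energy_pythag h f
  have h2 : 0 ≤ 𝔼 ω, (CE π' f ω - CE π f ω) ^ 2 := expect_nn fun _ => sq_nonneg _
  linarith

lemma energy_increment [Nonempty Ω] {π' : Ω → κ'} {π : Ω → κ} (h : Refines π' π) (f φ : Ω → ℝ)
    (hφ : ∀ ω ω', π' ω = π' ω' → φ ω = φ ω') (hφ1 : ∀ ω, |φ ω| ≤ 1) {θ : ℝ} (hθ : 0 ≤ θ)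
    (hc : θ ≤ |𝔼 ω, (f ω - CE π f ω) * φ ω|) : energy π f + θ ^ 2 ≤ energy π' f := by
  have e1 := expect_CE_mul π' f φ hφ
  have e2 : 𝔼 ω, (f ω - CE π f ω) * φ ω = 𝔼 ω, (CE π' f ω - CE π f ω) * φ ω := by
    simp only [sub_mul, expect_sub_distrib, e1]
  rw [e2] at hc
  have cs := expect_mul_sq_le_sq_mul_sq univ (fun ω => CE π' f ω - CE π f ω) φ
  have h1 : 𝔼 ω, φ ω ^ 2 ≤ 1 := expect_le_const fun ω => (sq_le_one_iff_abs_le_one _).2 (hφ1 ω)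
  have h2 : θ ^ 2 ≤ (𝔼 ω, (CE π' f ω - CE π f ω) * φ ω) ^ 2 := by
    rw [← sq_abs (𝔼 ω, _)]; exact pow_le_pow_left₀ hθ hc 2
  have h3 : 0 ≤ 𝔼 ω, (CE π' f ω - CE π f ω) ^ 2 := expect_nn fun _ => sq_nonneg _
  have := energy_pythag h f
  nlinarith

end CondExp

section Sign

/-- The sign of `s`, with value `1` at zero. -/
noncomputable def sgn (s : ℝ) : ℝ := if 0 ≤ s then 1 else -1

lemma abs_sgn (s : ℝ) : |sgn s| = 1 := by unfold sgn; split_ifs <;> norm_num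

lemma sgn_mul_self (s : ℝ) : sgn s * s = |s| := by
  unfold sgn; split_ifs with h
  · rw [abs_of_nonneg h, one_mul]
  · rw [abs_of_neg (not_le.1 h)]; ring

end Sign

section Increment

lemma exists_of_increment {S : Type*} (R : S → S → Prop) (hrefl : ∀ s, R s s)
    (htrans : ∀ a b c, R a b → R b c → R a c) (en : S → ℝ) (cx : S → ℕ) (good : S → Prop)
    {δ B : ℝ} (henB : ∀ s, en s ≤ B) (g : ℕ → ℕ) (hg : Monotone g) (hgid : ∀ n, n ≤ g n)
    (step : ∀ s, ¬ good s → ∃ s', R s s' ∧ en s + δ ≤ en s' ∧ cx s' ≤ g (cx s)) :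
    ∀ (k : ℕ) (s : S), B < en s + k * δ → ∃ s', R s s' ∧ good s' ∧ cx s' ≤ g^[k] (cx s) := by
  intro k
  induction k with
  | zero => intro s hs; have := henB s; simp at hs; linarith
  | succ k ih =>
    intro s hs
    by_cases hgood : good s
    · exact ⟨s, hrefl s, hgood, Function.id_le_iterate_of_id_le hgid _ _⟩
    · obtain ⟨s', hR, he, hc⟩ := step s hgood
      obtain ⟨s'', hR', hg', hc'⟩ := ih s' (by push_cast at hs; linarith)
      refine ⟨s'', htrans _ _ _ hR hR', hg', hc'.trans ?_⟩
      rw [Function.iterate_succ_apply]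
      exact hg.iterate k hc

lemma exists_small_increment (a b : ℕ → ℝ) {δ B : ℝ} (hab : ∀ s, b s ≤ a (s + 1)) (h0 : 0 ≤ a 0)
    (hB : ∀ s, a s ≤ B) (k : ℕ) (hk : B < k * δ) : ∃ s < k, b s - a s ≤ δ := by
  by_contra! hcon
  have key : ∀ j ≤ k, (j : ℝ) * δ ≤ a j := by
    intro j
    induction j with
    | zero => intro _; simpa using h0
    | succ j ih =>
      intro hj
      have h1 := ih (by omega)
      have h2 := hcon j (by omega)
      have h3 := hab j
      push_cast
      linarith
  have h1 := key k le_rfl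
  have h2 := hB k
  linarith

/-- A monotone function above `G` and the identity. -/
def hull (G : ℕ → ℕ) (n : ℕ) : ℕ := n + ∑ i ∈ range (n + 1), G i

lemma hull_mono (G : ℕ → ℕ) : Monotone (hull G) := fun a b h =>
  Nat.add_le_add h (sum_le_sum_of_subset (range_subset_range.2 (by omega)))

lemma le_hull_self (G : ℕ → ℕ) (n : ℕ) : n ≤ hull G n := Nat.le_add_right _ _

lemma le_hull (G : ℕ → ℕ) (n : ℕ) : G n ≤ hull G n :=
  (single_le_sum (f := G) (fun _ _ => Nat.zero_le _) (mem_range.2 (Nat.lt_succ_self n))).trans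
    (Nat.le_add_left _ _)

end Increment

lemma exists_sgn {Ω X : Type*} [Fintype Ω] [Fintype X] (π : Ω → X) (G : Ω → ℝ) (a : X → ℝ)
    (ha : ∀ x, |a x| ≤ 1) :
    ∃ S : X → ℝ, |𝔼 ω, G ω * a (π ω)| ≤ |𝔼 ω, G ω * sgn (S (π ω))| := by
  have key : ∀ b : X → ℝ, ∑ ω, G ω * b (π ω) = ∑ x, b x * ∑ ω, ind (π ω = x) * G ω := by
    intro b
    simp only [mul_sum]
    rw [sum_comm]
    refine sum_congr rfl fun ω _ => ?_
    rw [← sum_ind_eq (π ω) b, mul_sum]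
    exact sum_congr rfl fun x _ => by ring
  refine ⟨fun x => ∑ ω, ind (π ω = x) * G ω, ?_⟩
  rw [Fintype.expect_eq_sum_div_card, Fintype.expect_eq_sum_div_card, abs_div, abs_div]
  refine div_le_div_of_nonneg_right ?_ (abs_nonneg _)
  rw [key a, key fun x => sgn (∑ ω, ind (π ω = x) * G ω)]
  refine (abs_sum_le_sum_abs _ _).trans (le_trans (sum_le_sum fun x _ => ?_) (le_abs_self _))
  rw [abs_mul, sgn_mul_self]
  exact mul_le_of_le_one_left (abs_nonneg _) (ha x)

/-- A vertex partition, given as a colouring by a finite type. -/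
structure VCol (V : Type) where
  κ : Type
  [fin : Fintype κ]
  q : V → κ

attribute [instance] VCol.fin

/-- The partition of pairs induced by a vertex partition. -/
def pr {V ι : Type} (q : V → ι) (p : V × V) : ι × ι := (q p.1, q p.2)

lemma weak_graph_regularity {θ : ℝ} (hθ : 0 < θ) (m k : ℕ) (hk : m < k * θ ^ 2) (V : Type)
    [Fintype V] [Nonempty V] (A : Type) [Fintype A] (hA : Fintype.card A ≤ m) (F : A → V × V → ℝ)
    (h0 : ∀ α p, 0 ≤ F α p) (h1 : ∀ α p, F α p ≤ 1) (s : VCol V) :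
    ∃ s' : VCol V, Refines s'.q s.q ∧
      (∀ α, ∀ a b : V → ℝ, (∀ x, |a x| ≤ 1) → (∀ x, |b x| ≤ 1) →
        |𝔼 p : V × V, (F α p - CE (pr s'.q) (F α) p) * (a p.1 * b p.2)| ≤ θ) ∧
      Fintype.card s'.κ ≤ (fun n => 4 * n)^[k] (Fintype.card s.κ) := by
  have hen0 : ∀ s : VCol V, 0 ≤ ∑ α, energy (pr s.q) (F α) :=
    fun s => sum_nonneg fun α _ => energy_nonneg _ _
  refine exists_of_increment (fun s s' : VCol V => Refines s'.q s.q) (fun s _ _ h => h)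
    (fun a b c hab hbc x y h => hab _ _ (hbc _ _ h))
    (fun s => ∑ α, energy (pr s.q) (F α)) (fun s => Fintype.card s.κ) (fun s' =>
      ∀ α, ∀ a b : V → ℝ, (∀ x, |a x| ≤ 1) → (∀ x, |b x| ≤ 1) →
        |𝔼 p : V × V, (F α p - CE (pr s'.q) (F α) p) * (a p.1 * b p.2)| ≤ θ)
    (δ := θ ^ 2) (B := m) ?_ (fun n => 4 * n) ?_ ?_ ?_ k s ?_
  · intro s
    refine (sum_le_sum fun α _ => energy_le_one _ (h0 α) (h1 α)).trans ?_
    simpa using hA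
  · intro a b h; exact Nat.mul_le_mul_left 4 h
  · intro n; show n ≤ 4 * n; omega
  · intro s hs
    push Not at hs
    obtain ⟨α, a, b, ha, hb, hab⟩ := hs
    obtain ⟨S, hS⟩ := exists_sgn (fun p : V × V => p.1)
      (fun p => (F α p - CE (pr s.q) (F α) p) * b p.2) a ha
    obtain ⟨T, hT⟩ := exists_sgn (fun p : V × V => p.2)
      (fun p => (F α p - CE (pr s.q) (F α) p) * sgn (S p.1)) b hb
    have e1 : ∀ p : V × V, (F α p - CE (pr s.q) (F α) p) * (a p.1 * b p.2)
      = (F α p - CE (pr s.q) (F α) p) * b p.2 * a p.1 := fun p => by ring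
    have e2 : ∀ p : V × V, (F α p - CE (pr s.q) (F α) p) * b p.2 * sgn (S p.1)
      = (F α p - CE (pr s.q) (F α) p) * sgn (S p.1) * b p.2 := fun p => by ring
    simp only [e1] at hab
    simp only [e2] at hS
    have hθ' := (hab.le.trans hS).trans hT
    let s' : VCol V := ⟨s.κ × (Prop × Prop), fun x => (s.q x, 0 ≤ S x, 0 ≤ T x)⟩
    have hr : Refines s'.q s.q := fun x y h => (Prod.ext_iff.1 h).1
    have hr2 : Refines (pr s'.q) (pr s.q) := fun x y h => by
      have h1 := (Prod.ext_iff.1 h).1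
      have h2 := (Prod.ext_iff.1 h).2
      exact Prod.ext (hr _ _ h1) (hr _ _ h2)
    refine ⟨s', hr, ?_, ?_⟩
    · have hα := energy_increment hr2 (F α) (fun p => sgn (S p.1) * sgn (T p.2)) ?_ ?_ hθ.le
        (by simpa only [mul_assoc] using hθ')
      · have hle : ∀ β, energy (pr s.q) (F β) ≤ energy (pr s'.q) (F β) :=
          fun β => energy_mono hr2 _
        have h3 := sum_le_sum fun β (_ : β ∈ univ.erase α) => hle β
        show ∑ α, energy (pr s.q) (F α) + θ ^ 2 ≤ ∑ α, energy (pr s'.q) (F α)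
        rw [← add_sum_erase _ _ (mem_univ α), ← add_sum_erase _ _ (mem_univ α)]
        linarith
      · intro p p' h
        have h1 := (Prod.ext_iff.1 (Prod.ext_iff.1 h).1).2
        have h2 := (Prod.ext_iff.1 (Prod.ext_iff.1 h).2).2
        have h1' : (0 ≤ S p.1) = (0 ≤ S p'.1) := (Prod.ext_iff.1 h1).1
        have h2' : (0 ≤ T p.2) = (0 ≤ T p'.2) := (Prod.ext_iff.1 h2).2
        simp only [sgn, h1', h2']
      · intro p; simp only [abs_mul, abs_sgn, mul_one, le_refl]
    · show Fintype.card (s.κ × (Prop × Prop)) ≤ 4 * Fintype.card s.κ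
      simp only [Fintype.card_prod, Fintype.card_prop]; omega
  · have := hen0 s
    linarith

section Defs
variable {V ι κ : Type} [Fintype V]

/-- The normalised size of a part. -/
noncomputable def wt (q : V → ι) (i : ι) : ℝ := 𝔼 x, ind (q x = i)

/-- The density of the colour `α` between two parts. -/
noncomputable def dens (q : V → ι) (c : V → V → κ) (i j : ι) (α : κ) : ℝ :=
  (𝔼 x, 𝔼 y, ind (q x = i) * ind (q y = j) * ind (c x y = α)) / (wt q i * wt q j)

/-- All colours are uniform between the two parts. -/
def RegPair (q : V → ι) (c : V → V → κ) (η : ℝ) (i j : ι) : Prop :=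
  ∀ α, ∀ a b : V → ℝ, (∀ x, |a x| ≤ 1) → (∀ x, |b x| ≤ 1) →
    |𝔼 x, 𝔼 y, ind (q x = i) * ind (q y = j) * (ind (c x y = α) - dens q c i j α) * (a x * b y)|
      ≤ η * (wt q i * wt q j)

lemma wt_nonneg (q : V → ι) (i : ι) : 0 ≤ wt q i := expect_nn fun _ => ind_nonneg _

lemma sum_wt [Nonempty V] [Fintype ι] (q : V → ι) : ∑ i, wt q i = 1 := by
  simp only [wt, ← expect_sum, sum_ind_eq_one, Fintype.expect_const]

lemma wt_mul_wt (q : V → ι) (i j : ι) :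
    𝔼 x, 𝔼 y, ind (q x = i) * ind (q y = j) = wt q i * wt q j := by
  simp only [wt, ← mul_expect, ← expect_mul]

lemma dens_nonneg (q : V → ι) (c : V → V → κ) (i j : ι) (α : κ) : 0 ≤ dens q c i j α :=
  div_nonneg (expect_nn fun _ => expect_nn fun _ => mul_nonneg (mul_nonneg (ind_nonneg _)
    (ind_nonneg _)) (ind_nonneg _)) (mul_nonneg (wt_nonneg _ _) (wt_nonneg _ _))

lemma dens_le_one (q : V → ι) (c : V → V → κ) (i j : ι) (α : κ) : dens q c i j α ≤ 1 := by
  refine div_le_one_of_le₀ ?_ (mul_nonneg (wt_nonneg _ _) (wt_nonneg _ _))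
  rw [← wt_mul_wt]
  exact expect_mono fun x => expect_mono fun y => mul_le_of_le_one_right
    (mul_nonneg (ind_nonneg _) (ind_nonneg _)) (ind_le_one _)

lemma dens_mul (q : V → ι) (c : V → V → κ) (i j : ι) (α : κ) :
    wt q i * wt q j * dens q c i j α
      = 𝔼 x, 𝔼 y, ind (q x = i) * ind (q y = j) * ind (c x y = α) := by
  by_cases h : wt q i * wt q j = 0
  · rw [h, zero_mul]
    symm
    refine le_antisymm ?_ (expect_nn fun _ => expect_nn fun _ => mul_nonneg (mul_nonneg
      (ind_nonneg _) (ind_nonneg _)) (ind_nonneg _))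
    rw [← h, ← wt_mul_wt]
    exact expect_mono fun x => expect_mono fun y => mul_le_of_le_one_right
      (mul_nonneg (ind_nonneg _) (ind_nonneg _)) (ind_le_one _)
  · rw [dens, mul_div_cancel₀ _ h]

lemma sum_dens_mul [Fintype κ] (q : V → ι) (c : V → V → κ) (i j : ι) :
    wt q i * wt q j * ∑ α, dens q c i j α = wt q i * wt q j := by
  simp only [mul_sum, dens_mul, ← expect_sum]
  simp only [← mul_sum, sum_ind_eq_one, mul_one, wt_mul_wt]

lemma sum_dens_le [Fintype κ] (q : V → ι) (c : V → V → κ) (i j : ι) :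
    ∑ α, dens q c i j α ≤ 1 := by
  by_cases h : wt q i * wt q j = 0
  · simp [dens, h]
  · have := sum_dens_mul q c i j
    exact (mul_left_cancel₀ h (this.trans (mul_one _).symm)).le

lemma CE_pr_eq_dens [Nonempty V] (q : V → ι) (c : V → V → κ) (α : κ) (p : V × V) :
    CE (pr q) (fun p => ind (c p.1 p.2 = α)) p = dens q c (q p.1) (q p.2) α := by
  have hc : ∀ g : V × V → ℝ, ∑ p, g p = (Fintype.card (V × V) : ℝ) * 𝔼 p, g p := by
    intro g
    rw [Fintype.expect_eq_sum_div_card, mul_div_cancel₀]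
    exact Nat.cast_ne_zero.2 Fintype.card_ne_zero
  have hne : (Fintype.card (V × V) : ℝ) ≠ 0 := Nat.cast_ne_zero.2 Fintype.card_ne_zero
  have e : ∀ p' : V × V, ind (pr q p' = pr q p) = ind (q p'.1 = q p.1) * ind (q p'.2 = q p.2) := by
    intro p'
    rw [← ind_and]
    exact ind_congr (by simp [pr])
  rw [CE, hc, hc, mul_div_mul_left _ _ hne, expect_prod, expect_prod, dens, ← wt_mul_wt]
  simp only [e]

end Defs

lemma regPair_of_bounds {V ι κ : Type} [Fintype V] [Nonempty V] (q : V → ι)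
    (c : V → V → κ) {η θ : ℝ} (i j : ι) (C : κ → V × V → ℝ)
    (hC : ∀ α, ∀ a b : V → ℝ, (∀ x, |a x| ≤ 1) → (∀ x, |b x| ≤ 1) →
        |𝔼 p : V × V, (ind (c p.1 p.2 = α) - C α p) * (a p.1 * b p.2)| ≤ θ)
    (hθ : θ ≤ η / 2 * (wt q i * wt q j))
    (he : ∀ α, 𝔼 p : V × V, ind (q p.1 = i) * ind (q p.2 = j) *
      |C α p - dens q c (q p.1) (q p.2) α| ≤ η / 2 * (wt q i * wt q j)) :
    RegPair q c η i j := by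
  intro α a b ha hb
  have h1 := hC α (fun x => ind (q x = i) * a x) (fun x => ind (q x = j) * b x)
    (fun x => by rw [abs_mul]; exact mul_le_one₀ (abs_ind_le_one _) (abs_nonneg _) (ha x))
    (fun x => by rw [abs_mul]; exact mul_le_one₀ (abs_ind_le_one _) (abs_nonneg _) (hb x))
  have h2 : |𝔼 p : V × V, ind (q p.1 = i) * ind (q p.2 = j) *
      (C α p - dens q c (q p.1) (q p.2) α) * (a p.1 * b p.2)| ≤ η / 2 * (wt q i * wt q j) := by
    refine (abs_expect_le _ _).trans (le_trans (expect_mono fun p => ?_) (he α))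
    rw [abs_mul, abs_mul, abs_mul (ind _), abs_of_nonneg (ind_nonneg _),
      abs_of_nonneg (ind_nonneg _)]
    refine mul_le_of_le_one_right (mul_nonneg (mul_nonneg (ind_nonneg _) (ind_nonneg _))
      (abs_nonneg _)) ?_
    rw [abs_mul]
    exact mul_le_one₀ (ha _) (abs_nonneg _) (hb _)
  have h3 : 𝔼 x, 𝔼 y, ind (q x = i) * ind (q y = j) *
        (ind (c x y = α) - dens q c i j α) * (a x * b y)
      = 𝔼 p : V × V, (ind (c p.1 p.2 = α) - C α p) *
          (ind (q p.1 = i) * a p.1 * (ind (q p.2 = j) * b p.2))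
        + 𝔼 p : V × V, ind (q p.1 = i) * ind (q p.2 = j) *
          (C α p - dens q c (q p.1) (q p.2) α) * (a p.1 * b p.2) := by
    rw [← expect_add_distrib, expect_prod]
    refine expect_congr rfl fun x _ => expect_congr rfl fun y _ => ?_
    by_cases hx : q x = i
    · by_cases hy : q y = j
      · simp only [hx, hy]; ring
      · simp [hy]
    · simp [hx]
  rw [h3]
  refine (abs_add_le _ _).trans ?_
  linarith

lemma irregular_mass_le {V ι κ : Type} [Fintype V] [Nonempty V] [Fintype ι] [Fintype κ] (q : V → ι)
    (c : V → V → κ) {η θ ζ : ℝ} (hη : 0 < η) (hθ0 : 0 ≤ θ) (hζ : 0 ≤ ζ) (C : κ → V × V → ℝ)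
    (hC : ∀ α, ∀ a b : V → ℝ, (∀ x, |a x| ≤ 1) → (∀ x, |b x| ≤ 1) →
        |𝔼 p : V × V, (ind (c p.1 p.2 = α) - C α p) * (a p.1 * b p.2)| ≤ θ)
    (he : ∀ α, 𝔼 p : V × V, (C α p - dens q c (q p.1) (q p.2) α) ^ 2 ≤ ζ ^ 2) :
    ∑ i, ∑ j, wt q i * wt q j * ind (¬ RegPair q c η i j)
      ≤ 2 / η * (Fintype.card ι ^ 2 * θ + Fintype.card κ * ζ) := by
  have key : ∀ i j, wt q i * wt q j * ind (¬ RegPair q c η i j) ≤ 2 / η * (θ + ∑ α,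
      𝔼 p : V × V, ind (q p.1 = i) * ind (q p.2 = j) * |C α p - dens q c (q p.1) (q p.2) α|) := by
    intro i j
    have hnn : ∀ α, 0 ≤ 𝔼 p : V × V, ind (q p.1 = i) * ind (q p.2 = j) *
        |C α p - dens q c (q p.1) (q p.2) α| := fun α => expect_nn fun p =>
      mul_nonneg (mul_nonneg (ind_nonneg _) (ind_nonneg _)) (abs_nonneg _)
    by_cases hr : RegPair q c η i j
    · simp only [hr, not_true, not_false_eq_true, ind_false, mul_zero]
      exact mul_nonneg (by positivity) (add_nonneg hθ0 (sum_nonneg fun α _ => hnn α))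
    · have : ¬ (θ ≤ η / 2 * (wt q i * wt q j) ∧ ∀ α, 𝔼 p : V × V, ind (q p.1 = i) *
          ind (q p.2 = j) * |C α p - dens q c (q p.1) (q p.2) α| ≤ η / 2 * (wt q i * wt q j)) :=
        fun h => hr (regPair_of_bounds q c i j C hC h.1 h.2)
      rw [ind_true hr, mul_one]
      have h2 : η / 2 * (wt q i * wt q j) ≤ θ + ∑ α, 𝔼 p : V × V, ind (q p.1 = i) *
          ind (q p.2 = j) * |C α p - dens q c (q p.1) (q p.2) α| := by
        rw [not_and_or] at this
        rcases this with h | h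
        · have := sum_nonneg fun α (_ : α ∈ univ) => hnn α
          linarith
        · push Not at h
          obtain ⟨α, hα⟩ := h
          have := single_le_sum (fun α (_ : α ∈ univ) => hnn α) (mem_univ α)
          linarith
      calc wt q i * wt q j = 2 / η * (η / 2 * (wt q i * wt q j)) := by field_simp
        _ ≤ _ := mul_le_mul_of_nonneg_left h2 (by positivity)
  refine (sum_le_sum fun i _ => sum_le_sum fun j _ => key i j).trans ?_
  simp only [← mul_sum, sum_add_distrib]
  refine mul_le_mul_of_nonneg_left (add_le_add ?_ ?_) (by positivity)
  · simp only [sum_const, card_univ, nsmul_eq_mul]; apply le_of_eq; ring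
  · have : ∑ i, ∑ j, ∑ α, 𝔼 p : V × V, ind (q p.1 = i) * ind (q p.2 = j) *
          |C α p - dens q c (q p.1) (q p.2) α|
        = ∑ α, 𝔼 p : V × V, |C α p - dens q c (q p.1) (q p.2) α| := by
      have : ∀ i, ∑ j, ∑ α, 𝔼 p : V × V, ind (q p.1 = i) * ind (q p.2 = j) *
          |C α p - dens q c (q p.1) (q p.2) α| = ∑ α, 𝔼 p : V × V, ind (q p.1 = i) *
          |C α p - dens q c (q p.1) (q p.2) α| := by
        intro i
        rw [sum_comm]
        refine sum_congr rfl fun α _ => ?_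
        rw [← expect_sum]
        refine expect_congr rfl fun p _ => ?_
        rw [← sum_mul, ← mul_sum, sum_ind_eq_one, mul_one]
      simp only [this]
      rw [sum_comm]
      refine sum_congr rfl fun α _ => ?_
      rw [← expect_sum]
      refine expect_congr rfl fun p _ => ?_
      rw [← sum_mul, sum_ind_eq_one, one_mul]
    rw [this]
    refine (sum_le_sum fun α _ => expect_abs_le_sqrt _ hζ (he α)).trans ?_
    simp

theorem graph_regularity {η : ℝ} (hη : 0 < η) (m t₀ : ℕ) : ∃ T : ℕ, ∀ (V : Type) [Fintype V]
    [Nonempty V] (κ : Type) [Fintype κ] (_ : Fintype.card κ ≤ m) (c : V → V → κ) (s₀ : VCol V),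
    Fintype.card s₀.κ ≤ t₀ → ∃ s : VCol V, Refines s.q s₀.q ∧ Fintype.card s.κ ≤ T ∧
      ∑ i, ∑ j, wt s.q i * wt s.q j * ind (¬ RegPair s.q c η i j) ≤ η := by
  set θ : ℕ → ℝ := fun t => η ^ 2 / (4 * (t ^ 2 + 1)) with hθdef
  have hθ : ∀ t, 0 < θ t := fun t => by positivity
  set ζ : ℝ := η ^ 2 / (4 * (m + 1)) with hζdef
  have hζ : 0 < ζ := by positivity
  have hk : ∀ t, ∃ k : ℕ, (m : ℝ) < k * θ t ^ 2 := fun t => by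
    obtain ⟨k, hk⟩ := exists_nat_gt ((m : ℝ) / θ t ^ 2)
    exact ⟨k, (div_lt_iff₀ (pow_pos (hθ t) 2)).1 hk⟩
  choose k hk using hk
  set G : ℕ → ℕ := hull fun t => (fun n => 4 * n)^[k t] t
  obtain ⟨K, hK⟩ : ∃ K : ℕ, (m : ℝ) < K * ζ ^ 2 := by
    obtain ⟨K, hK⟩ := exists_nat_gt ((m : ℝ) / ζ ^ 2)
    exact ⟨K, (div_lt_iff₀ (pow_pos hζ 2)).1 hK⟩
  refine ⟨G^[K] t₀, ?_⟩
  intro V _ _ κ _ hκ c s₀ hs₀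
  set F : κ → V × V → ℝ := fun α p => ind (c p.1 p.2 = α)
  have hF0 : ∀ α p, 0 ≤ F α p := fun _ _ => ind_nonneg _
  have hF1 : ∀ α p, F α p ≤ 1 := fun _ _ => ind_le_one _
  choose nxt hR hU hC using fun s : VCol V => weak_graph_regularity (hθ (Fintype.card s.κ)) m _
    (hk (Fintype.card s.κ)) V κ hκ F hF0 hF1 s
  set sq : ℕ → VCol V := fun n => nxt^[n] s₀
  have hsq : ∀ n, sq (n + 1) = nxt (sq n) := fun n => Function.iterate_succ_apply' _ _ _
  have hcard : ∀ n, Fintype.card (sq n).κ ≤ G^[n] t₀ := by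
    intro n
    induction n with
    | zero => exact hs₀
    | succ n ih =>
      rw [hsq, Function.iterate_succ_apply']
      exact (hC _).trans ((le_hull (fun t => (fun n => 4 * n)^[k t] t) _).trans (hull_mono _ ih))
  have href : ∀ n, Refines (sq n).q s₀.q := by
    intro n
    induction n with
    | zero => exact fun _ _ h => h
    | succ n ih => rw [hsq]; exact fun x y h => ih _ _ (hR _ _ _ h)
  have hrp : ∀ s : VCol V, Refines (pr (nxt s).q) (pr s.q) := fun s x y h =>
    Prod.ext (hR _ _ _ (Prod.ext_iff.1 h).1) (hR _ _ _ (Prod.ext_iff.1 h).2)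
  obtain ⟨n, hn, hinc⟩ := exists_small_increment
    (fun n => ∑ α, energy (pr (sq n).q) (F α)) (fun n => ∑ α, energy (pr (sq (n + 1)).q) (F α))
    (δ := ζ ^ 2) (B := m) (fun _ => le_rfl) (sum_nonneg fun _ _ => energy_nonneg _ _) (fun n => by
      refine (sum_le_sum fun α _ => energy_le_one _ (hF0 α) (hF1 α)).trans ?_
      simpa using hκ) K hK
  refine ⟨sq n, href n, (hcard n).trans ?_, ?_⟩
  · exact Function.monotone_iterate_of_id_le (le_hull_self _) hn.le _
  have hlo : ∀ α, 𝔼 p : V × V, (CE (pr (nxt (sq n)).q) (F α) p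
      - dens (sq n).q c ((sq n).q p.1) ((sq n).q p.2) α) ^ 2 ≤ ζ ^ 2 := by
    intro α
    have h1 := energy_pythag (hrp (sq n)) (F α)
    simp only [F, CE_pr_eq_dens (sq n).q c α] at h1
    simp only [F]
    rw [h1]
    refine le_trans ?_ hinc
    rw [hsq, ← sum_sub_distrib]
    exact single_le_sum (f := fun α => energy (pr (nxt (sq n)).q) (F α) - energy (pr (sq n).q) (F α))
      (fun β _ => sub_nonneg.2 (energy_mono (hrp _) _)) (mem_univ α)
  refine (irregular_mass_le (sq n).q c hη (hθ _).le hζ.le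
    (fun α => CE (pr (nxt (sq n)).q) (F α)) (hU (sq n)) hlo).trans ?_
  set t : ℝ := (Fintype.card (sq n).κ : ℝ)
  have ht : t ^ 2 * θ (Fintype.card (sq n).κ) ≤ η ^ 2 / 4 := by
    simp only [hθdef]
    rw [mul_div_assoc', div_le_div_iff₀ (by positivity) (by norm_num)]
    nlinarith [sq_nonneg η]
  have hm : (Fintype.card κ : ℝ) * ζ ≤ η ^ 2 / 4 := by
    have : (Fintype.card κ : ℝ) ≤ m := by exact_mod_cast hκ
    rw [hζdef, mul_div_assoc', div_le_div_iff₀ (by positivity) (by norm_num)]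
    nlinarith [sq_nonneg η]
  calc 2 / η * (t ^ 2 * θ (Fintype.card (sq n).κ) + Fintype.card κ * ζ)
      ≤ 2 / η * (η ^ 2 / 4 + η ^ 2 / 4) := mul_le_mul_of_nonneg_left (by linarith) (by positivity)
    _ = η := by field_simp; norm_num

/-- A colouring of ordered pairs by a finite type. -/
structure PCol (V : Type) where
  κ : Type
  [fin : Fintype κ]
  c : V → V → κ

attribute [instance] PCol.fin

/-- The symmetrisation of a colouring of pairs. -/
def symm {V κ : Type} (c : V → V → κ) (x y : V) : κ × κ := (c x y, c y x)

/-- The partition of triples induced by a colouring of pairs. -/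
def tri {V κ : Type} (c : V → V → κ) (ω : V × V × V) : κ × κ × κ :=
  (c ω.1 ω.2.1, c ω.1 ω.2.2, c ω.2.1 ω.2.2)

/-- The partition of triples induced by a vertex partition and a colouring of pairs. -/
def cell {V ι κ : Type} (q : V → ι) (c : V → V → κ) (ω : V × V × V) :
    (ι × ι × ι) × (κ × κ × κ) :=
  ((q ω.1, q ω.2.1, q ω.2.2), tri c ω)

/-- `F` has correlation at most `θ` with products of bounded functions of pairs. -/
def PairUniform {V : Type} [Fintype V] (F : V × V × V → ℝ) (θ : ℝ) : Prop :=
  ∀ a b e : V × V → ℝ, (∀ p, |a p| ≤ 1) → (∀ p, |b p| ≤ 1) → (∀ p, |e p| ≤ 1) →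
    |𝔼 ω : V × V × V, F ω * (a (ω.1, ω.2.1) * b (ω.1, ω.2.2) * e (ω.2.1, ω.2.2))| ≤ θ

lemma weak_hypergraph_regularity {θ : ℝ} (hθ : 0 < θ) (k : ℕ) (hk : 1 < k * θ ^ 2) (V : Type)
    [Fintype V] [Nonempty V] (f : V × V × V → ℝ) (h0 : ∀ p, 0 ≤ f p) (h1 : ∀ p, f p ≤ 1)
    (s : PCol V) :
    ∃ s' : PCol V, (∀ x y x' y', s'.c x y = s'.c x' y' → s.c x y = s.c x' y') ∧
      PairUniform (fun ω => f ω - CE (tri (symm s'.c)) f ω) θ ∧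
      Fintype.card s'.κ ≤ (fun n => 8 * n)^[k] (Fintype.card s.κ) := by
  refine exists_of_increment
    (fun s s' : PCol V => ∀ x y x' y', s'.c x y = s'.c x' y' → s.c x y = s.c x' y')
    (fun s _ _ _ _ h => h) (fun a b c hab hbc x y x' y' h => hab _ _ _ _ (hbc _ _ _ _ h))
    (fun s => energy (tri (symm s.c)) f) (fun s => Fintype.card s.κ)
    (fun s' => PairUniform (fun ω => f ω - CE (tri (symm s'.c)) f ω) θ)
    (δ := θ ^ 2) (B := 1) (fun s => energy_le_one _ h0 h1) (fun n => 8 * n) ?_ ?_ ?_ k s ?_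
  · intro a b h; exact Nat.mul_le_mul_left 8 h
  · intro n; show n ≤ 8 * n; omega
  · intro s hs
    unfold PairUniform at hs
    push Not at hs
    obtain ⟨a, b, e, ha, hb, he, hab⟩ := hs
    set F : V × V × V → ℝ := fun ω => f ω - CE (tri (symm s.c)) f ω
    change θ < |𝔼 ω : V × V × V, F ω * (a (ω.1, ω.2.1) * b (ω.1, ω.2.2) * e (ω.2.1, ω.2.2))| at hab
    obtain ⟨S, hS⟩ := exists_sgn (fun ω : V × V × V => (ω.1, ω.2.1))
      (fun ω => F ω * (b (ω.1, ω.2.2) * e (ω.2.1, ω.2.2))) a ha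
    obtain ⟨T, hT⟩ := exists_sgn (fun ω : V × V × V => (ω.1, ω.2.2))
      (fun ω => F ω * (sgn (S (ω.1, ω.2.1)) * e (ω.2.1, ω.2.2))) b hb
    obtain ⟨R, hR⟩ := exists_sgn (fun ω : V × V × V => (ω.2.1, ω.2.2))
      (fun ω => F ω * (sgn (S (ω.1, ω.2.1)) * sgn (T (ω.1, ω.2.2)))) e he
    have hθ' : θ ≤ |𝔼 ω : V × V × V, F ω *
        (sgn (S (ω.1, ω.2.1)) * sgn (T (ω.1, ω.2.2)) * sgn (R (ω.2.1, ω.2.2)))| := by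
      have e1 : ∀ ω : V × V × V, F ω * (a (ω.1, ω.2.1) * b (ω.1, ω.2.2) * e (ω.2.1, ω.2.2))
        = F ω * (b (ω.1, ω.2.2) * e (ω.2.1, ω.2.2)) * a (ω.1, ω.2.1) := fun ω => by ring
      have e2 : ∀ ω : V × V × V, F ω * (b (ω.1, ω.2.2) * e (ω.2.1, ω.2.2)) * sgn (S (ω.1, ω.2.1))
        = F ω * (sgn (S (ω.1, ω.2.1)) * e (ω.2.1, ω.2.2)) * b (ω.1, ω.2.2) := fun ω => by ring
      have e3 : ∀ ω : V × V × V, F ω * (sgn (S (ω.1, ω.2.1)) * e (ω.2.1, ω.2.2)) *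
          sgn (T (ω.1, ω.2.2)) = F ω * (sgn (S (ω.1, ω.2.1)) * sgn (T (ω.1, ω.2.2))) *
          e (ω.2.1, ω.2.2) := fun ω => by ring
      simp only [e1] at hab
      simp only [e2] at hS
      simp only [e3] at hT
      simp only [mul_assoc] at hab hS hT hR ⊢
      exact ((hab.le.trans hS).trans hT).trans hR
    let s' : PCol V := ⟨s.κ × (Prop × Prop × Prop),
      fun x y => (s.c x y, 0 ≤ S (x, y), 0 ≤ T (x, y), 0 ≤ R (x, y))⟩
    have hr : ∀ x y x' y', s'.c x y = s'.c x' y' → s.c x y = s.c x' y' :=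
      fun x y x' y' h => (Prod.ext_iff.1 h).1
    have hS' : ∀ x y x' y', s'.c x y = s'.c x' y' → sgn (S (x, y)) = sgn (S (x', y')) := by
      intro x y x' y' h
      have : (0 ≤ S (x, y)) = (0 ≤ S (x', y')) := (Prod.ext_iff.1 (Prod.ext_iff.1 h).2).1
      simp only [sgn, this]
    have hT' : ∀ x y x' y', s'.c x y = s'.c x' y' → sgn (T (x, y)) = sgn (T (x', y')) := by
      intro x y x' y' h
      have : (0 ≤ T (x, y)) = (0 ≤ T (x', y')) :=
        (Prod.ext_iff.1 (Prod.ext_iff.1 (Prod.ext_iff.1 h).2).2).1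
      simp only [sgn, this]
    have hR' : ∀ x y x' y', s'.c x y = s'.c x' y' → sgn (R (x, y)) = sgn (R (x', y')) := by
      intro x y x' y' h
      have : (0 ≤ R (x, y)) = (0 ≤ R (x', y')) :=
        (Prod.ext_iff.1 (Prod.ext_iff.1 (Prod.ext_iff.1 h).2).2).2
      simp only [sgn, this]
    have hsplit : ∀ {κ : Type} {c : V → V → κ} {ω ω' : V × V × V}, tri (symm c) ω =
        tri (symm c) ω' → (c ω.1 ω.2.1 = c ω'.1 ω'.2.1 ∧ c ω.2.1 ω.1 = c ω'.2.1 ω'.1) ∧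
        (c ω.1 ω.2.2 = c ω'.1 ω'.2.2 ∧ c ω.2.2 ω.1 = c ω'.2.2 ω'.1) ∧
        (c ω.2.1 ω.2.2 = c ω'.2.1 ω'.2.2 ∧ c ω.2.2 ω.2.1 = c ω'.2.2 ω'.2.1) := by
      intro κ c ω ω' h
      simpa only [tri, symm, Prod.mk.injEq] using h
    have hr2 : Refines (tri (symm s'.c)) (tri (symm s.c)) := fun ω ω' h => by
      obtain ⟨⟨h1, h2⟩, ⟨h3, h4⟩, ⟨h5, h6⟩⟩ := hsplit h
      simp only [tri, symm, Prod.mk.injEq]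
      exact ⟨⟨hr _ _ _ _ h1, hr _ _ _ _ h2⟩, ⟨hr _ _ _ _ h3, hr _ _ _ _ h4⟩,
        ⟨hr _ _ _ _ h5, hr _ _ _ _ h6⟩⟩
    refine ⟨s', hr, ?_, ?_⟩
    · refine energy_increment hr2 f (fun ω => sgn (S (ω.1, ω.2.1)) * sgn (T (ω.1, ω.2.2)) *
        sgn (R (ω.2.1, ω.2.2))) ?_ ?_ hθ.le hθ'
      · intro ω ω' h
        obtain ⟨⟨h1, h2⟩, ⟨h3, h4⟩, ⟨h5, h6⟩⟩ := hsplit h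
        simp only [hS' _ _ _ _ h1, hT' _ _ _ _ h3, hR' _ _ _ _ h5]
      · intro p; simp only [abs_mul, abs_sgn, mul_one, le_refl]
    · show Fintype.card (s.κ × (Prop × Prop × Prop)) ≤ 8 * Fintype.card s.κ
      simp only [Fintype.card_prod, Fintype.card_prop]; omega
  · have := energy_nonneg (tri (symm s.c)) f
    linarith

/-- A function above the identity bounding `F` on the square `[0, n]²`. -/
def hull₂ (F : ℕ → ℕ → ℕ) (n : ℕ) : ℕ := n + ∑ i ∈ range (n + 1), ∑ j ∈ range (n + 1), F i j

lemma le_hull₂_self (F : ℕ → ℕ → ℕ) (n : ℕ) : n ≤ hull₂ F n := Nat.le_add_right _ _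

lemma le_hull₂ (F : ℕ → ℕ → ℕ) {i j n : ℕ} (hi : i ≤ n) (hj : j ≤ n) : F i j ≤ hull₂ F n :=
  calc F i j ≤ ∑ j ∈ range (n + 1), F i j :=
        single_le_sum (f := F i) (fun _ _ => Nat.zero_le _) (mem_range.2 (by omega))
    _ ≤ ∑ i ∈ range (n + 1), ∑ j ∈ range (n + 1), F i j :=
        single_le_sum (f := fun i => ∑ j ∈ range (n + 1), F i j) (fun _ _ => Nat.zero_le _)
          (mem_range.2 (by omega))
    _ ≤ _ := Nat.le_add_left _ _

/-- The mass of the irregular pairs. -/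
noncomputable def irregMass {V ι κ : Type} [Fintype V] [Fintype ι] (q : V → ι) (c : V → V → κ)
    (η : ℝ) : ℝ := ∑ i, ∑ j, wt q i * wt q j * ind (¬ RegPair q c η i j)

theorem hypergraph_regularity {ε : ℝ} (hε : 0 < ε) (η : ℕ → ℝ) (hη : ∀ m, 0 < η m)
    (θ : ℕ → ℕ → ℝ) (hθ : ∀ m t, 0 < θ m t) : ∃ M : ℕ, ∀ (V : Type) [Fintype V] [Nonempty V]
    (f : V × V × V → ℝ), (∀ p, 0 ≤ f p) → (∀ p, f p ≤ 1) →
    ∃ (κ ι : Type) (_ : Fintype κ) (_ : Fintype ι) (c : V → V → κ) (τ : κ → κ) (q : V → ι)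
      (f₁ : V × V × V → ℝ), Fintype.card κ ≤ M ∧ Fintype.card ι ≤ M ∧
      (∀ α, τ (τ α) = α) ∧ (∀ x y, c y x = τ (c x y)) ∧
      irregMass q c (η (Fintype.card κ)) ≤ η (Fintype.card κ) ∧
      (∀ p, 0 ≤ f₁ p) ∧ (∀ p, f₁ p ≤ 1) ∧
      𝔼 ω, (f₁ ω - CE (cell q c) f ω) ^ 2 ≤ ε ∧
      PairUniform (fun ω => f ω - f₁ ω) (θ (Fintype.card κ) (Fintype.card ι)) := by
  have hk : ∀ m t, ∃ k : ℕ, (1 : ℝ) < k * θ m t ^ 2 := fun m t => by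
    obtain ⟨k, hk⟩ := exists_nat_gt ((1 : ℝ) / θ m t ^ 2)
    exact ⟨k, (div_lt_iff₀ (pow_pos (hθ m t) 2)).1 hk⟩
  choose k hk using hk
  choose Tr hTr using fun m t => graph_regularity (hη m) m t
  obtain ⟨K, hK⟩ : ∃ K : ℕ, (1 : ℝ) < K * ε := by
    obtain ⟨K, hK⟩ := exists_nat_gt ((1 : ℝ) / ε)
    exact ⟨K, (div_lt_iff₀ hε).1 hK⟩
  set F₁ : ℕ → ℕ → ℕ := fun a t =>
    (fun n => 8 * n)^[k (a * a) t] ((a * a) * (t * t))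
  set F₂ : ℕ → ℕ → ℕ := fun a t => Tr (a * a) t
  set G : ℕ → ℕ := fun n => hull₂ F₂ (hull₂ F₁ n)
  set N₀ := G 1
  set N := ∑ s ∈ range (K + 1), G^[s] N₀
  refine ⟨N * N, ?_⟩
  intro V _ _ f h0 h1
  have step : ∀ σ : PCol V × VCol V, ∃ σ' : PCol V × VCol V,
      (∀ x y x' y', σ'.1.c x y = σ'.1.c x' y' → symm σ.1.c x y = symm σ.1.c x' y' ∧
        σ.2.q x = σ.2.q x' ∧ σ.2.q y = σ.2.q y') ∧
      PairUniform (fun ω => f ω - CE (tri (symm σ'.1.c)) f ω)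
        (θ (Fintype.card (σ.1.κ × σ.1.κ)) (Fintype.card σ.2.κ)) ∧
      irregMass σ'.2.q (symm σ'.1.c) (η (Fintype.card (σ'.1.κ × σ'.1.κ))) ≤
        η (Fintype.card (σ'.1.κ × σ'.1.κ)) ∧
      (∀ n, Fintype.card σ.1.κ ≤ n → Fintype.card σ.2.κ ≤ n →
        Fintype.card σ'.1.κ ≤ G n ∧ Fintype.card σ'.2.κ ≤ G n) := by
    rintro ⟨s, v⟩
    obtain ⟨s', hr, hu, hc⟩ := weak_hypergraph_regularity
      (hθ (Fintype.card (s.κ × s.κ)) (Fintype.card v.κ)) _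
      (hk (Fintype.card (s.κ × s.κ)) (Fintype.card v.κ)) V f h0 h1
      ⟨(s.κ × s.κ) × (v.κ × v.κ), fun x y => (symm s.c x y, v.q x, v.q y)⟩
    obtain ⟨v', -, hc', hm⟩ := hTr (Fintype.card (s'.κ × s'.κ)) (Fintype.card v.κ) V
      (s'.κ × s'.κ) le_rfl (symm s'.c) v le_rfl
    refine ⟨⟨s', v'⟩, ?_, hu, hm, ?_⟩
    · intro x y x' y' h
      have := hr _ _ _ _ h
      simpa only [Prod.mk.injEq] using this
    · intro n h1 h2
      simp only [Fintype.card_prod] at hc hc'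
      have b1 : Fintype.card s'.κ ≤ hull₂ F₁ n := hc.trans (le_hull₂ F₁ h1 h2)
      have b2 : Fintype.card v.κ ≤ hull₂ F₁ n := h2.trans (le_hull₂_self _ _)
      exact ⟨b1.trans (le_hull₂_self _ _), hc'.trans (le_hull₂ F₂ b1 b2)⟩
  choose nxt hR hU hI hC using step
  set σ₀ : PCol V × VCol V := ⟨⟨Unit, fun _ _ => ()⟩, ⟨Unit, fun _ => ()⟩⟩
  set σ : ℕ → PCol V × VCol V := fun n => nxt^[n] (nxt σ₀)
  have hσ : ∀ n, σ (n + 1) = nxt (σ n) := fun n => Function.iterate_succ_apply' _ _ _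
  have hcard : ∀ n, Fintype.card (σ n).1.κ ≤ G^[n] N₀ ∧ Fintype.card (σ n).2.κ ≤ G^[n] N₀ := by
    intro n
    induction n with
    | zero => exact hC σ₀ 1 (by simp [σ₀]) (by simp [σ₀])
    | succ n ih =>
      rw [hσ, Function.iterate_succ_apply']
      exact hC _ _ ih.1 ih.2
  have hirr : ∀ n, irregMass (σ n).2.q (symm (σ n).1.c)
      (η (Fintype.card ((σ n).1.κ × (σ n).1.κ))) ≤ η (Fintype.card ((σ n).1.κ × (σ n).1.κ)) := by
    intro n
    cases n with
    | zero => exact hI _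
    | succ n => rw [hσ]; exact hI _
  have hrefDT : ∀ n, Refines (tri (symm (σ (n + 1)).1.c)) (cell (σ n).2.q (symm (σ n).1.c)) := by
    intro n ω ω' h
    rw [hσ] at h
    simp only [tri, symm, Prod.mk.injEq] at h
    obtain ⟨⟨h1, h2⟩, ⟨h3, h4⟩, ⟨h5, h6⟩⟩ := h
    have r1 := hR _ _ _ _ _ h1
    have r3 := hR _ _ _ _ _ h3
    have r5 := hR _ _ _ _ _ h5
    simp only [cell, tri, Prod.mk.injEq]
    exact ⟨⟨r1.2.1, r1.2.2, r3.2.2⟩, r1.1, r3.1, r5.1⟩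
  have hrefTD : ∀ n, Refines (cell (σ n).2.q (symm (σ n).1.c)) (tri (symm (σ n).1.c)) :=
    fun n ω ω' h => (Prod.ext_iff.1 h).2
  obtain ⟨s, hsK, hs⟩ := exists_small_increment
    (fun n => energy (cell (σ n).2.q (symm (σ n).1.c)) f)
    (fun n => energy (tri (symm (σ (n + 1)).1.c)) f) (δ := ε) (B := 1)
    (fun n => energy_mono (hrefTD (n + 1)) f) (energy_nonneg _ _)
    (fun n => energy_le_one _ h0 h1) K hK
  have hN : G^[s] N₀ ≤ N :=
    single_le_sum (f := fun s => G^[s] N₀) (fun _ _ => Nat.zero_le _) (mem_range.2 (by omega))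
  refine ⟨(σ s).1.κ × (σ s).1.κ, (σ s).2.κ, inferInstance, inferInstance, symm (σ s).1.c,
    Prod.swap, (σ s).2.q, CE (tri (symm (σ (s + 1)).1.c)) f, ?_, ?_, fun _ => Prod.swap_swap _,
    fun _ _ => rfl, hirr s, CE_nonneg _ h0, CE_le_one _ h1, ?_, ?_⟩
  · rw [Fintype.card_prod]
    exact Nat.mul_le_mul ((hcard s).1.trans hN) ((hcard s).1.trans hN)
  · exact ((hcard s).2.trans hN).trans (Nat.le_mul_self N)
  · rw [energy_pythag (hrefDT s)]
    exact hs
  · have := hU (σ s)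
    rwa [← hσ] at this

open Function (update)

section Resample
variable {V I : Type} [Fintype V] [Nonempty V] [Fintype I]

lemma expect_resample (s : I) (F : (I → V) → ℝ) : 𝔼 x, F x = 𝔼 x, 𝔼 u, F (update x s u) := by
  have e : 𝔼 p : (I → V) × V, F (update p.1 s p.2) = 𝔼 p : (I → V) × V, F p.1 := by
    refine Fintype.expect_equiv
      ⟨fun p => (update p.1 s p.2, p.1 s), fun p => (update p.1 s p.2, p.1 s), ?_, ?_⟩ _ _ ?_
    · intro p; simp
    · intro p; simp
    · intro p; rfl
  rw [expect_prod, expect_prod] at e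
  rw [e]
  simp

/-- Replace three coordinates of `x`. -/
noncomputable def upd3 (x : I → V) (a b c : I) (u v w : V) : I → V := update (update (update x a u) b v) c w

lemma expect_resample₂ (s t : I) (F : (I → V) → ℝ) :
    𝔼 x, F x = 𝔼 x, 𝔼 u, 𝔼 v, F (update (update x s u) t v) := by
  rw [expect_resample t F, expect_resample s]

lemma expect_resample₃ (a b c : I) (F : (I → V) → ℝ) :
    𝔼 x, F x = 𝔼 x, 𝔼 u, 𝔼 v, 𝔼 w, F (upd3 x a b c u v w) := by
  rw [expect_resample c F, expect_resample b, expect_resample a]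
  rfl

/-- `Q` is, in the coordinates `s` and `t`, a product of bounded functions of one coordinate. -/
def Split (s t : I) (Q : (I → V) → ℝ) : Prop :=
  ∀ x, ∃ a b : V → ℝ, (∀ u, |a u| ≤ 1) ∧ (∀ u, |b u| ≤ 1) ∧
    ∀ u v, Q (update (update x s u) t v) = a u * b v

/-- `Q` is, in the coordinates `a`, `b` and `c`, a product of bounded functions of two
coordinates. -/
def Split3 (a b c : I) (Q : (I → V) → ℝ) : Prop :=
  ∀ x, ∃ α β γ : V × V → ℝ, (∀ p, |α p| ≤ 1) ∧ (∀ p, |β p| ≤ 1) ∧ (∀ p, |γ p| ≤ 1) ∧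
    ∀ u v w, Q (upd3 x a b c u v w) = α (u, v) * β (u, w) * γ (v, w)

lemma abs_mul_le_one {a b : ℝ} (ha : |a| ≤ 1) (hb : |b| ≤ 1) : |a * b| ≤ 1 := by
  rw [abs_mul]; exact mul_le_one₀ ha (abs_nonneg _) hb

lemma Split.mul {s t : I} {Q R : (I → V) → ℝ} (hQ : Split s t Q) (hR : Split s t R) :
    Split s t fun x => Q x * R x := by
  intro x
  obtain ⟨a, b, ha, hb, h⟩ := hQ x
  obtain ⟨a', b', ha', hb', h'⟩ := hR x
  refine ⟨fun u => a u * a' u, fun u => b u * b' u, fun u => abs_mul_le_one (ha u) (ha' u),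
    fun u => abs_mul_le_one (hb u) (hb' u), fun u v => ?_⟩
  simp only [h, h']; ring

lemma Split3.mul {a b c : I} {Q R : (I → V) → ℝ} (hQ : Split3 a b c Q) (hR : Split3 a b c R) :
    Split3 a b c fun x => Q x * R x := by
  intro x
  obtain ⟨α, β, γ, hα, hβ, hγ, h⟩ := hQ x
  obtain ⟨α', β', γ', hα', hβ', hγ', h'⟩ := hR x
  refine ⟨fun u => α u * α' u, fun u => β u * β' u, fun u => γ u * γ' u,
    fun u => abs_mul_le_one (hα u) (hα' u), fun u => abs_mul_le_one (hβ u) (hβ' u),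
    fun u => abs_mul_le_one (hγ u) (hγ' u), fun u v w => ?_⟩
  simp only [h, h']; ring

lemma Split.one (s t : I) : Split s t fun _ : I → V => 1 :=
  fun _ => ⟨fun _ => 1, fun _ => 1, by simp, by simp, by simp⟩

lemma Split3.one (a b c : I) : Split3 a b c fun _ : I → V => 1 :=
  fun _ => ⟨fun _ => 1, fun _ => 1, fun _ => 1, by simp, by simp, by simp, by simp⟩

lemma Split.prod {s t : I} {J : Type*} (K : Finset J) {Q : J → (I → V) → ℝ}
    (h : ∀ j ∈ K, Split s t (Q j)) : Split s t fun x => ∏ j ∈ K, Q j x := by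
  induction K using Finset.induction_on with
  | empty => simpa using Split.one s t
  | insert j K hj ih =>
    simp only [prod_insert hj]
    exact (h j (mem_insert_self _ _)).mul (ih fun i hi => h i (mem_insert_of_mem hi))

lemma Split3.prod {a b c : I} {J : Type*} (K : Finset J) {Q : J → (I → V) → ℝ}
    (h : ∀ j ∈ K, Split3 a b c (Q j)) : Split3 a b c fun x => ∏ j ∈ K, Q j x := by
  induction K using Finset.induction_on with
  | empty => simpa using Split3.one a b c
  | insert j K hj ih =>
    simp only [prod_insert hj]
    exact (h j (mem_insert_self _ _)).mul (ih fun i hi => h i (mem_insert_of_mem hi))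

lemma Split.of_dependsOn {s t : I} {Q : (I → V) → ℝ} {S : Set I} (hQ : DependsOn Q S)
    (h1 : ∀ x, |Q x| ≤ 1) (h : s ∉ S ∨ t ∉ S) : Split s t Q := by
  intro x
  rcases h with h | h
  · refine ⟨fun _ => 1, fun v => Q (update x t v), by simp, fun v => h1 _, fun u v => ?_⟩
    rw [one_mul]
    refine hQ fun i hi => ?_
    have : i ≠ s := fun e => h (e ▸ hi)
    by_cases e : i = t
    · subst e; simp
    · simp [e, this]
  · refine ⟨fun u => Q (update x s u), fun _ => 1, fun v => h1 _, by simp, fun u v => ?_⟩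
    rw [mul_one]
    refine hQ fun i hi => ?_
    have : i ≠ t := fun e => h (e ▸ hi)
    simp [this]

lemma Split3.of_dependsOn {a b c : I} {Q : (I → V) → ℝ} {S : Set I} (hQ : DependsOn Q S)
    (h1 : ∀ x, |Q x| ≤ 1) (h : a ∉ S ∨ b ∉ S ∨ c ∉ S) : Split3 a b c Q := by
  intro x
  rcases h with h | h | h
  · refine ⟨fun _ => 1, fun _ => 1, fun p => Q (update (update x b p.1) c p.2), by simp, by simp,
      fun v => h1 _, fun u v w => ?_⟩
    rw [one_mul, one_mul]
    refine hQ fun i hi => ?_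
    have : i ≠ a := fun e => h (e ▸ hi)
    by_cases e : i = c
    · subst e; simp [upd3]
    · by_cases e' : i = b
      · subst e'; simp [upd3, e]
      · simp [upd3, e, this, e']
  · refine ⟨fun _ => 1, fun p => Q (update (update x a p.1) c p.2), fun _ => 1, by simp,
      fun v => h1 _, by simp, fun u v w => ?_⟩
    rw [one_mul, mul_one]
    refine hQ fun i hi => ?_
    have : i ≠ b := fun e => h (e ▸ hi)
    by_cases e : i = c
    · subst e; simp [upd3]
    · simp [upd3, e, this]
  · refine ⟨fun p => Q (update (update x a p.1) b p.2), fun _ => 1, fun _ => 1,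
      fun v => h1 _, by simp, by simp, fun u v w => ?_⟩
    rw [mul_one, mul_one]
    refine hQ fun i hi => ?_
    have : i ≠ c := fun e => h (e ▸ hi)
    simp [upd3, this]

end Resample

section Counting
variable {V I ι κ : Type} [Fintype V] [Nonempty V] [Fintype I]
variable (q : V → ι) (c : V → V → κ) (p : I → ι) (col : I × I → κ)

/-- The indicator that `x` lies in the prescribed parts. -/
noncomputable def inParts (x : I → V) : ℝ := ∏ s, ind (q (x s) = p s)

/-- The indicator that the pair `e` has the prescribed colour. -/
noncomputable def hasCol (e : I × I) (x : I → V) : ℝ := ind (c (x e.1) (x e.2) = col e)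

/-- The prescribed density for the pair `e`. -/
noncomputable def edgeDens (e : I × I) : ℝ := dens q c (p e.1) (p e.2) (col e)

lemma inParts_nonneg (x : I → V) : 0 ≤ inParts q p x := prod_nonneg fun _ _ => ind_nonneg _

lemma inParts_le_one (x : I → V) : inParts q p x ≤ 1 :=
  prod_le_one (fun _ _ => ind_nonneg _) fun _ _ => ind_le_one _

lemma expect_inParts : 𝔼 x, inParts q p x = ∏ s, wt q (p s) := by
  simp only [wt, Fintype.expect_eq_sum_div_card, inParts]
  rw [prod_div_distrib, prod_univ_sum]
  simp

lemma inParts_update_update {s t : I} (hst : s ≠ t) (x : I → V) (u v : V) :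
    inParts q p (update (update x s u) t v) = ind (q u = p s) * ind (q v = p t) *
      ∏ r ∈ univ.erase t |>.erase s, ind (q (x r) = p r) := by
  unfold inParts
  rw [← mul_prod_erase _ _ (mem_univ t), ← mul_prod_erase _ _ (mem_erase.2 ⟨hst, mem_univ s⟩)]
  have : ∀ r ∈ (univ.erase t).erase s, ind (q (update (update x s u) t v r) = p r)
      = ind (q (x r) = p r) := by
    intro r hr
    simp only [mem_erase] at hr
    simp [hr.1, hr.2.1]
  rw [prod_congr rfl this]
  simp [hst]
  ring

lemma inParts_upd3 {a b d : I} (hab : a ≠ b) (had : a ≠ d) (hbd : b ≠ d) (x : I → V) (u v w : V) :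
    inParts q p (upd3 x a b d u v w) = ind (q u = p a) * ind (q v = p b) * ind (q w = p d) *
      ∏ r ∈ ((univ.erase d).erase b).erase a, ind (q (x r) = p r) := by
  unfold inParts
  rw [← mul_prod_erase _ _ (mem_univ d), ← mul_prod_erase _ _ (mem_erase.2 ⟨hbd, mem_univ b⟩),
    ← mul_prod_erase _ _ (mem_erase.2 ⟨hab, mem_erase.2 ⟨had, mem_univ a⟩⟩)]
  have : ∀ r ∈ ((univ.erase d).erase b).erase a, ind (q (upd3 x a b d u v w r) = p r)
      = ind (q (x r) = p r) := by
    intro r hr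
    simp only [mem_erase] at hr
    simp [upd3, hr.1, hr.2.1, hr.2.2.1]
  rw [prod_congr rfl this]
  simp [upd3, hab, had, hbd]
  ring

variable {q c p col}

lemma edge_replace {η : ℝ} {e : I × I} (he : e.1 ≠ e.2) (hreg : RegPair q c η (p e.1) (p e.2))
    {Q : (I → V) → ℝ} (hQ : Split e.1 e.2 Q) :
    |𝔼 x, inParts q p x * Q x * (hasCol c col e x - edgeDens q c p col e)|
      ≤ η * 𝔼 x, inParts q p x := by
  rw [expect_resample₂ e.1 e.2, expect_resample₂ e.1 e.2 (inParts q p), mul_expect]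
  refine (abs_expect_le _ _).trans (expect_mono fun x => ?_)
  obtain ⟨a, b, ha, hb, hab⟩ := hQ x
  simp only [inParts_update_update q p he, hab, ← expect_mul]
  set R := ∏ r ∈ (univ.erase e.2).erase e.1, ind (q (x r) = p r)
  have hR : 0 ≤ R := prod_nonneg fun _ _ => ind_nonneg _
  have h1 : ∀ u v, ind (q u = p e.1) * ind (q v = p e.2) * R * (a u * b v) *
      (hasCol c col e (update (update x e.1 u) e.2 v) - edgeDens q c p col e)
      = R * (ind (q u = p e.1) * ind (q v = p e.2) * (ind (c u v = col e) -
        dens q c (p e.1) (p e.2) (col e)) * (a u * b v)) := by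
    intro u v
    simp only [hasCol, edgeDens, Function.update_self, Function.update_of_ne he]
    ring
  simp only [h1, ← mul_expect, abs_mul, abs_of_nonneg hR]
  have h2 := hreg (col e) a b ha hb
  have h3 : (𝔼 u, ind (q u = p e.1) * 𝔼 v, ind (q v = p e.2)) = wt q (p e.1) * wt q (p e.2) := by
    rw [← expect_mul]; rfl
  rw [h3]
  calc _ ≤ R * (η * (wt q (p e.1) * wt q (p e.2))) := mul_le_mul_of_nonneg_left h2 hR
    _ = _ := by ring

lemma edgeDens_nonneg (e : I × I) : 0 ≤ edgeDens q c p col e := dens_nonneg _ _ _ _ _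

lemma edgeDens_le_one (e : I × I) : edgeDens q c p col e ≤ 1 := dens_le_one _ _ _ _ _

lemma hasCol_nonneg (e : I × I) (x : I → V) : 0 ≤ hasCol c col e x := ind_nonneg _
lemma hasCol_le_one (e : I × I) (x : I → V) : hasCol c col e x ≤ 1 := ind_le_one _

lemma hasCol_dependsOn (e : I × I) : DependsOn (hasCol c col e) ({e.1, e.2} : Set I) := by
  intro x y h
  simp only [hasCol, h e.1 (by simp), h e.2 (by simp)]

lemma edges_replace {η : ℝ} (rk : I → ℕ) (E : Finset (I × I))
    (hE : ∀ e ∈ E, rk e.1 < rk e.2) (hreg : ∀ e ∈ E, RegPair q c η (p e.1) (p e.2))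
    {G : (I → V) → ℝ} (hG : ∀ e ∈ E, Split e.1 e.2 G) :
    |𝔼 x, inParts q p x * (G x * ∏ e ∈ E, hasCol c col e x) -
      (∏ e ∈ E, edgeDens q c p col e) * 𝔼 x, inParts q p x * G x|
      ≤ #E * (η * 𝔼 x, inParts q p x) := by
  induction E using Finset.induction_on with
  | empty => simp
  | insert e E he ih =>
    have ih' := ih (fun e' h => hE e' (mem_insert_of_mem h))
      (fun e' h => hreg e' (mem_insert_of_mem h)) (fun e' h => hG e' (mem_insert_of_mem h))
    have hlt := hE e (mem_insert_self _ _)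
    have hne : e.1 ≠ e.2 := fun h => by rw [h] at hlt; exact lt_irrefl _ hlt
    have hQ : Split e.1 e.2 fun x => G x * ∏ e ∈ E, hasCol c col e x := by
      refine (hG e (mem_insert_self _ _)).mul (Split.prod E fun e' he' => ?_)
      refine Split.of_dependsOn (hasCol_dependsOn e') (fun x => abs_ind_le_one _) ?_
      by_contra! hcon
      simp only [Set.mem_insert_iff, Set.mem_singleton_iff] at hcon
      have hlt' := hE e' (mem_insert_of_mem he')
      have hee : e ≠ e' := fun h => he (h ▸ he')
      obtain ⟨h1 | h1, h2 | h2⟩ := hcon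
      · exact hne (h1.trans h2.symm)
      · exact hee (Prod.ext h1 h2)
      · rw [h1, h2] at hlt; omega
      · exact hne (h1.trans h2.symm)
    have h1 := edge_replace hne (hreg e (mem_insert_self _ _)) hQ (col := col)
    rw [prod_insert he, card_insert_of_notMem he]
    simp only [prod_insert he]
    set W := 𝔼 x, inParts q p x
    set d := edgeDens q c p col e
    set X := 𝔼 x, inParts q p x * (G x * ∏ e ∈ E, hasCol c col e x)
    set Y := 𝔼 x, inParts q p x * G x
    set D := ∏ e ∈ E, edgeDens q c p col e
    set Z := 𝔼 x, inParts q p x * (G x * ∏ e ∈ E, hasCol c col e x) * (hasCol c col e x - d)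
    have h2 : 𝔼 x, inParts q p x * (G x * (hasCol c col e x * ∏ e ∈ E, hasCol c col e x))
        = Z + d * X := by
      simp only [Z, X, mul_expect, ← expect_add_distrib]
      exact expect_congr rfl fun x _ => by ring
    rw [h2]
    have h3 : Z + d * X - d * D * Y = Z + d * (X - D * Y) := by ring
    rw [h3]
    have hd0 : 0 ≤ d := edgeDens_nonneg e
    have hd1 : d ≤ 1 := edgeDens_le_one e
    calc _ ≤ |Z| + |d * (X - D * Y)| := abs_add_le _ _
      _ ≤ η * W + 1 * |X - D * Y| := by
        rw [abs_mul, abs_of_nonneg hd0]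
        exact add_le_add h1 (mul_le_mul_of_nonneg_right hd1 (abs_nonneg _))
      _ ≤ _ := by push_cast; linarith

end Counting

/-- The probability `r` of an event or of its complement, according to the sign `s`. -/
noncomputable def sgnVal (s : Prop) (r : ℝ) : ℝ := if s then r else 1 - r

lemma sgnVal_nonneg {s : Prop} {r : ℝ} (h0 : 0 ≤ r) (h1 : r ≤ 1) : 0 ≤ sgnVal s r := by
  unfold sgnVal; split_ifs <;> linarith

lemma sgnVal_le_one {s : Prop} {r : ℝ} (h0 : 0 ≤ r) (h1 : r ≤ 1) : sgnVal s r ≤ 1 := by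
  unfold sgnVal; split_ifs <;> linarith

lemma abs_sgnVal_le_one {s : Prop} {r : ℝ} (h0 : 0 ≤ r) (h1 : r ≤ 1) : |sgnVal s r| ≤ 1 := by
  rw [abs_of_nonneg (sgnVal_nonneg h0 h1)]; exact sgnVal_le_one h0 h1

lemma abs_sgnVal_sub (s : Prop) (r r' : ℝ) : |sgnVal s r - sgnVal s r'| = |r - r'| := by
  unfold sgnVal
  split_ifs
  · rfl
  · rw [abs_sub_comm r r']; congr 1; ring

lemma abs_prod_sub_prod_le {J : Type*} (K : Finset J) (a b : J → ℝ)
    (ha0 : ∀ j ∈ K, 0 ≤ a j) (ha1 : ∀ j ∈ K, a j ≤ 1) (hb0 : ∀ j ∈ K, 0 ≤ b j)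
    (hb1 : ∀ j ∈ K, b j ≤ 1) : |∏ j ∈ K, a j - ∏ j ∈ K, b j| ≤ ∑ j ∈ K, |a j - b j| := by
  induction K using Finset.induction_on with
  | empty => simp
  | insert j K hj ih =>
    have ih' := ih (fun i hi => ha0 i (mem_insert_of_mem hi)) (fun i hi => ha1 i (mem_insert_of_mem hi))
      (fun i hi => hb0 i (mem_insert_of_mem hi)) (fun i hi => hb1 i (mem_insert_of_mem hi))
    rw [prod_insert hj, prod_insert hj, sum_insert hj]
    have hA0 : 0 ≤ ∏ i ∈ K, a i := prod_nonneg fun i hi => ha0 i (mem_insert_of_mem hi)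
    have hA1 : ∏ i ∈ K, a i ≤ 1 := prod_le_one (fun i hi => ha0 i (mem_insert_of_mem hi))
      fun i hi => ha1 i (mem_insert_of_mem hi)
    have e : a j * ∏ i ∈ K, a i - b j * ∏ i ∈ K, b i
        = (a j - b j) * ∏ i ∈ K, a i + b j * (∏ i ∈ K, a i - ∏ i ∈ K, b i) := by ring
    rw [e]
    refine (abs_add_le _ _).trans (add_le_add ?_ ?_)
    · rw [abs_mul, abs_of_nonneg hA0]; exact mul_le_of_le_one_right (abs_nonneg _) hA1
    · rw [abs_mul, abs_of_nonneg (hb0 j (mem_insert_self _ _))]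
      exact (mul_le_of_le_one_left (abs_nonneg _) (hb1 j (mem_insert_self _ _))).trans ih'

section Counting
variable {V I ι κ : Type} [Fintype V]

/-- The triple of values of `x` at `n`. -/
def tup (x : I → V) (n : I × I × I) : V × V × V := (x n.1, x n.2.1, x n.2.2)

/-- The expectation of `g` over the cell `X`. -/
noncomputable def cellE (q : V → ι) (c : V → V → κ) (g : V × V × V → ℝ)
    (X : (ι × ι × ι) × (κ × κ × κ)) : ℝ := 𝔼 ω, ind (cell q c ω = X) * g ω

/-- The product of the sizes of the parts of the cell `X`. -/
noncomputable def cellW (q : V → ι) (X : (ι × ι × ι) × (κ × κ × κ)) : ℝ :=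
  wt q X.1.1 * wt q X.1.2.1 * wt q X.1.2.2

/-- The product of the densities of the cell `X`. -/
noncomputable def cellD (q : V → ι) (c : V → V → κ) (X : (ι × ι × ι) × (κ × κ × κ)) : ℝ :=
  dens q c X.1.1 X.1.2.1 X.2.1 * dens q c X.1.1 X.1.2.2 X.2.2.1 *
    dens q c X.1.2.1 X.1.2.2 X.2.2.2

lemma expect_triple {V : Type} [Fintype V] (g : V × V × V → ℝ) :
    𝔼 ω, g ω = 𝔼 u, 𝔼 v, 𝔼 w, g (u, v, w) := by
  rw [expect_prod]
  exact expect_congr rfl fun u _ => expect_prod _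

variable [Nonempty V] [Fintype I]

lemma triple_replace {θ : ℝ} {a b d : I} (hab : a ≠ b) (had : a ≠ d) (hbd : b ≠ d)
    {f f₁ : V × V × V → ℝ} (hu : PairUniform (fun ω => f ω - f₁ ω) θ) (s : Prop)
    {Q : (I → V) → ℝ} (hQ : Split3 a b d Q) :
    |𝔼 x, Q x * (sgnVal s (f (tup x (a, b, d))) - sgnVal s (f₁ (tup x (a, b, d))))| ≤ θ := by
  rw [expect_resample₃ a b d]
  refine (abs_expect_le _ _).trans (expect_le_const fun x => ?_)
  obtain ⟨α, β, γ, hα, hβ, hγ, h⟩ := hQ x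
  have h1 := hu α β γ hα hβ hγ
  rw [expect_triple] at h1
  simp only [h]
  have h2 : ∀ u v w, tup (upd3 x a b d u v w) (a, b, d) = (u, v, w) := by
    intro u v w; simp [tup, upd3, hab, had, hbd]
  simp only [h2]
  by_cases hs : s
  · simp only [sgnVal, hs, if_true]
    refine le_trans (le_of_eq ?_) h1
    congr 1
    exact expect_congr rfl fun u _ => expect_congr rfl fun v _ => expect_congr rfl fun w _ => by
      ring
  · simp only [sgnVal, hs, if_false]
    rw [← abs_neg]
    refine le_trans (le_of_eq ?_) h1
    congr 1
    simp only [← expect_neg_distrib]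
    exact expect_congr rfl fun u _ => expect_congr rfl fun v _ => expect_congr rfl fun w _ => by
      ring

lemma tup_dependsOn (n : I × I × I) (g : V × V × V → ℝ) :
    DependsOn (fun x : I → V => g (tup x n)) ({n.1, n.2.1, n.2.2} : Set I) := by
  intro x y h
  simp only [tup, h n.1 (by simp), h n.2.1 (by simp), h n.2.2 (by simp)]

lemma triples_replace {θ : ℝ} (rk : I → ℕ) {f f₁ : V × V × V → ℝ}
    (hu : PairUniform (fun ω => f ω - f₁ ω) θ) (h0 : ∀ ω, 0 ≤ f ω) (h1 : ∀ ω, f ω ≤ 1)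
    (h0' : ∀ ω, 0 ≤ f₁ ω) (h1' : ∀ ω, f₁ ω ≤ 1) (sg : I × I × I → Prop)
    (N : Finset (I × I × I)) (hN : ∀ n ∈ N, rk n.1 < rk n.2.1 ∧ rk n.2.1 < rk n.2.2)
    (R : (I → V) → ℝ) (hR : ∀ n ∈ N, Split3 n.1 n.2.1 n.2.2 R) :
    |𝔼 x, R x * ∏ n ∈ N, sgnVal (sg n) (f (tup x n)) -
      𝔼 x, R x * ∏ n ∈ N, sgnVal (sg n) (f₁ (tup x n))| ≤ #N * θ := by
  have hsplit : ∀ n n' : I × I × I, n ≠ n' → rk n.1 < rk n.2.1 → rk n.2.1 < rk n.2.2 →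
      rk n'.1 < rk n'.2.1 → rk n'.2.1 < rk n'.2.2 → ∀ g : V × V × V → ℝ, (∀ ω, 0 ≤ g ω) →
      (∀ ω, g ω ≤ 1) →
      Split3 n.1 n.2.1 n.2.2 fun x : I → V => sgnVal (sg n') (g (tup x n')) := by
    rintro ⟨a, b, d⟩ ⟨a', b', d'⟩ hne r1 r2 r3 r4 g hg0 hg1
    refine Split3.of_dependsOn (tup_dependsOn (a', b', d') fun ω => sgnVal (sg (a', b', d')) (g ω))
      (fun x => abs_sgnVal_le_one (hg0 _) (hg1 _)) ?_
    by_contra! hcon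
    simp only [Set.mem_insert_iff, Set.mem_singleton_iff] at hcon r1 r2 r3 r4
    obtain ⟨ha, hb, hd⟩ := hcon
    apply hne
    rcases ha with rfl | rfl | rfl <;> rcases hb with rfl | rfl | rfl <;>
      rcases hd with rfl | rfl | rfl <;> first | rfl | omega
  induction N using Finset.induction_on generalizing R with
  | empty => simp
  | insert n N hn ih =>
    obtain ⟨r1, r2⟩ := hN n (mem_insert_self _ _)
    have hN' : ∀ n' ∈ N, rk n'.1 < rk n'.2.1 ∧ rk n'.2.1 < rk n'.2.2 :=
      fun n' h => hN n' (mem_insert_of_mem h)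
    have hne : ∀ n' ∈ N, n' ≠ n := fun n' h e => hn (e ▸ h)
    have A := ih hN' (fun x => R x * sgnVal (sg n) (f₁ (tup x n))) fun n' h' =>
      (hR n' (mem_insert_of_mem h')).mul
        (hsplit n' n (hne n' h') (hN' n' h').1 (hN' n' h').2 r1 r2 f₁ h0' h1')
    have B := triple_replace (a := n.1) (b := n.2.1) (d := n.2.2) (fun e => by rw [e] at r1; omega)
      (fun e => by rw [e] at r1; omega) (fun e => by rw [e] at r2; omega) hu (sg n)
      ((hR n (mem_insert_self _ _)).mul (Split3.prod N fun n' h' =>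
        hsplit n n' (hne n' h').symm r1 r2 (hN' n' h').1 (hN' n' h').2 f h0 h1))
    rw [card_insert_of_notMem hn]
    simp only [prod_insert hn]
    have e : 𝔼 x, R x * (sgnVal (sg n) (f (tup x n)) * ∏ n ∈ N, sgnVal (sg n) (f (tup x n))) -
        𝔼 x, R x * (sgnVal (sg n) (f₁ (tup x n)) * ∏ n ∈ N, sgnVal (sg n) (f₁ (tup x n))) =
        𝔼 x, R x * (∏ n ∈ N, sgnVal (sg n) (f (tup x n))) *
          (sgnVal (sg n) (f (tup x n)) - sgnVal (sg n) (f₁ (tup x n))) +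
        (𝔼 x, R x * sgnVal (sg n) (f₁ (tup x n)) * ∏ n ∈ N, sgnVal (sg n) (f (tup x n)) -
          𝔼 x, R x * sgnVal (sg n) (f₁ (tup x n)) * ∏ n ∈ N, sgnVal (sg n) (f₁ (tup x n))) := by
      rw [← expect_sub_distrib, ← expect_sub_distrib, ← expect_add_distrib]
      exact expect_congr rfl fun x _ => by ring
    rw [e]
    refine (abs_add_le _ _).trans ((add_le_add B A).trans (le_of_eq ?_))
    push_cast; ring

variable {q : V → ι} {c : V → V → κ} {p : I → ι} {col : I × I → κ}

/-- The cell prescribed for the triple `n`. -/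
def cellOf (p : I → ι) (col : I × I → κ) (n : I × I × I) : (ι × ι × ι) × (κ × κ × κ) :=
  ((p n.1, p n.2.1, p n.2.2), (col (n.1, n.2.1), col (n.1, n.2.2), col (n.2.1, n.2.2)))

lemma ind_cell (u v w : V) (i j k : ι) (α β γ : κ) :
    ind (cell q c (u, v, w) = ((i, j, k), (α, β, γ))) = ind (q u = i) * ind (q v = j) *
      ind (q w = k) * (ind (c u v = α) * ind (c u w = β) * ind (c v w = γ)) := by
  simp only [cell, tri, Prod.mk.injEq, ind_and]; ring

lemma cell_error {ε' η : ℝ} (rk : I → ℕ) (E : Finset (I × I)) (hE : ∀ e ∈ E, rk e.1 < rk e.2)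
    (hreg : ∀ e ∈ E, RegPair q c η (p e.1) (p e.2)) {n : I × I × I}
    (h1 : (n.1, n.2.1) ∈ E) (h2 : (n.1, n.2.2) ∈ E) (h3 : (n.2.1, n.2.2) ∈ E)
    {g : V × V × V → ℝ} (hg0 : ∀ ω, 0 ≤ g ω) (hg1 : ∀ ω, g ω ≤ 1)
    (hcell : cellE q c g (cellOf p col n) ≤
      ε' * (cellW q (cellOf p col n) * cellD q c (cellOf p col n))) :
    𝔼 x, inParts q p x * (g (tup x n) * ∏ e ∈ E, hasCol c col e x) ≤
      ε' * ((∏ e ∈ E, edgeDens q c p col e) * 𝔼 x, inParts q p x) +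
        #E * (η * 𝔼 x, inParts q p x) := by
  obtain ⟨a, b, d⟩ := n
  simp only at h1 h2 h3
  have r1 := hE _ h1
  have r2 := hE _ h2
  have r3 := hE _ h3
  simp only at r1 r2 r3
  have hab : a ≠ b := fun e => by rw [e] at r1; omega
  have had : a ≠ d := fun e => by rw [e] at r2; omega
  have hbd : b ≠ d := fun e => by rw [e] at r3; omega
  set E' := ((E.erase (b, d)).erase (a, d)).erase (a, b)
  have hE'E : E' ⊆ E := ((erase_subset _ _).trans (erase_subset _ _)).trans (erase_subset _ _)
  have m2 : (a, d) ∈ E.erase (b, d) := mem_erase.2 ⟨fun h => hab (Prod.ext_iff.1 h).1, h2⟩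
  have m1 : (a, b) ∈ (E.erase (b, d)).erase (a, d) :=
    mem_erase.2 ⟨fun h => hbd (Prod.ext_iff.1 h).2,
      mem_erase.2 ⟨fun h => hab (Prod.ext_iff.1 h).1, h1⟩⟩
  have hprod : ∀ φ : I × I → ℝ, ∏ e ∈ E, φ e = φ (a, b) * φ (a, d) * φ (b, d) * ∏ e ∈ E', φ e := by
    intro φ
    rw [← mul_prod_erase _ _ h3, ← mul_prod_erase _ _ m2, ← mul_prod_erase _ _ m1]; ring
  set G : (I → V) → ℝ := fun x => g (tup x (a, b, d)) *
    (hasCol c col (a, b) x * hasCol c col (a, d) x * hasCol c col (b, d) x) with hGdef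
  have hG0 : ∀ x, 0 ≤ G x := fun x => mul_nonneg (hg0 _)
    (mul_nonneg (mul_nonneg (hasCol_nonneg _ _) (hasCol_nonneg _ _)) (hasCol_nonneg _ _))
  have hG1 : ∀ x, |G x| ≤ 1 := fun x => by
    rw [abs_of_nonneg (hG0 x)]
    refine mul_le_one₀ (hg1 _) ?_ ?_
    · exact mul_nonneg (mul_nonneg (hasCol_nonneg _ _) (hasCol_nonneg _ _)) (hasCol_nonneg _ _)
    · exact mul_le_one₀ (mul_le_one₀ (hasCol_le_one _ _) (hasCol_nonneg _ _) (hasCol_le_one _ _))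
        (hasCol_nonneg _ _) (hasCol_le_one _ _)
  have hGdep : DependsOn G ({a, b, d} : Set I) := by
    intro x y h
    have ha := h a (by simp)
    have hb := h b (by simp)
    have hd := h d (by simp)
    simp only [G, tup, hasCol, ha, hb, hd]
  have hsplit : ∀ e ∈ E', Split e.1 e.2 G := by
    rintro ⟨s, t⟩ he
    refine Split.of_dependsOn hGdep hG1 ?_
    by_contra! hcon
    simp only [Set.mem_insert_iff, Set.mem_singleton_iff] at hcon
    have hr := hE _ (hE'E he)
    simp only [E', mem_erase, ne_eq, Prod.mk.injEq] at he hr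
    obtain ⟨k1, k2, k3, -⟩ := he
    obtain ⟨hs, ht⟩ := hcon
    rcases hs with rfl | rfl | rfl <;> rcases ht with rfl | rfl | rfl <;>
      first | omega | simp_all
  have key := edges_replace rk E' (fun e he => hE e (hE'E he)) (fun e he => hreg e (hE'E he)) hsplit
    (col := col)
  have hW : 𝔼 x, inParts q p x * G x ≤
      ε' * (edgeDens q c p col (a, b) * edgeDens q c p col (a, d) * edgeDens q c p col (b, d)) *
        𝔼 x, inParts q p x := by
    rw [expect_resample₃ a b d, expect_resample₃ a b d (inParts q p), mul_expect]
    refine expect_mono fun x => ?_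
    simp only [inParts_upd3 q p hab had hbd]
    set R := ∏ r ∈ ((univ.erase d).erase b).erase a, ind (q (x r) = p r)
    have hR : 0 ≤ R := prod_nonneg fun _ _ => ind_nonneg _
    have e1 : ∀ u v w, ind (q u = p a) * ind (q v = p b) * ind (q w = p d) * R *
        G (upd3 x a b d u v w) = R * (ind (cell q c (u, v, w) = cellOf p col (a, b, d)) *
          g (u, v, w)) := by
      intro u v w
      have h2 : tup (upd3 x a b d u v w) (a, b, d) = (u, v, w) := by
        simp [tup, upd3, hab, had, hbd]
      have h3 : upd3 x a b d u v w a = u := by simp [upd3, hab, had]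
      have h4 : upd3 x a b d u v w b = v := by simp [upd3, hbd]
      have h5 : upd3 x a b d u v w d = w := by simp [upd3]
      simp only [cellOf, ind_cell, G, h2, hasCol, h3, h4, h5]
      ring
    simp only [e1, ← mul_expect]
    have e2 : 𝔼 u, 𝔼 v, 𝔼 w, ind (q u = p a) * ind (q v = p b) * ind (q w = p d) * R
        = R * (wt q (p a) * wt q (p b) * wt q (p d)) := by
      simp only [← expect_mul, ← mul_expect, wt]
      ring
    rw [e2, ← expect_triple fun ω => ind (cell q c ω = cellOf p col (a, b, d)) * g ω]
    calc _ ≤ R * _ := mul_le_mul_of_nonneg_left hcell hR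
      _ = _ := by simp only [cellW, cellD, cellOf, edgeDens]; ring
  have hWnn : 0 ≤ 𝔼 x, inParts q p x := expect_nn (inParts_nonneg q p)
  have hη : 0 ≤ η * 𝔼 x, inParts q p x := by
    have := edge_replace hab (hreg _ h1) (Split.one a b) (col := col)
    exact (abs_nonneg _).trans this
  have hD0 : 0 ≤ ∏ e ∈ E', edgeDens q c p col e := prod_nonneg fun e _ => edgeDens_nonneg e
  have e3 : 𝔼 x, inParts q p x * (g (tup x (a, b, d)) * ∏ e ∈ E, hasCol c col e x)
      = 𝔼 x, inParts q p x * (G x * ∏ e ∈ E', hasCol c col e x) := by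
    refine expect_congr rfl fun x _ => ?_
    rw [hprod fun e => hasCol c col e x]; simp only [G]; ring
  rw [e3, hprod]
  have h4 := (abs_le.1 key).2
  have h5 : (#E' : ℝ) * (η * 𝔼 x, inParts q p x) ≤ #E * (η * 𝔼 x, inParts q p x) :=
    mul_le_mul_of_nonneg_right (by exact_mod_cast card_le_card hE'E) hη
  have h6 := mul_le_mul_of_nonneg_left hW hD0
  nlinarith

end Counting

section Embedding
variable {V I ι κ : Type} [Fintype V] [Nonempty V] [Fintype I]
  {q : V → ι} {c : V → V → κ} {p : I → ι} {col : I × I → κ}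

lemma split3_inParts {a b d : I} (hab : a ≠ b) : Split3 a b d (inParts q p) := by
  refine Split3.prod univ fun s _ => ?_
  refine Split3.of_dependsOn (S := {s}) ?_ (fun x => abs_ind_le_one _) ?_
  · intro x y h
    simp only [h s (by simp)]
  · by_contra! hcon
    simp only [Set.mem_singleton_iff] at hcon
    exact hab (hcon.1.trans hcon.2.1.symm)

lemma split3_hasCol {a b d : I} (hab : a ≠ b) (had : a ≠ d) (hbd : b ≠ d) (e : I × I) :
    Split3 a b d (hasCol c col e) := by
  refine Split3.of_dependsOn (hasCol_dependsOn e) (fun x => abs_ind_le_one _) ?_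
  by_contra! hcon
  simp only [Set.mem_insert_iff, Set.mem_singleton_iff] at hcon
  obtain ⟨h1 | h1, h2 | h2, h3 | h3⟩ := hcon <;> simp_all

theorem counting_lower_bound {K : ℕ} {μ δ ω ε' η θ : ℝ} (hμ0 : 0 < μ) (hμ1 : μ ≤ 1) (hδ0 : 0 < δ)
    (hδ1 : δ ≤ 1) (hω0 : 0 < ω) (hω1 : ω ≤ 1) (hε' : 0 ≤ ε') (hη : 0 ≤ η) (hθ : 0 ≤ θ)
    (hεK : ε' * (8 * K) ≤ μ ^ K) (hηK : η * (8 * (K * (K + 1))) ≤ μ ^ K * δ ^ K)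
    (hθK : θ * (8 * K) ≤ μ ^ K * δ ^ K * ω ^ K)
    (rk : I → ℕ) (E : Finset (I × I)) (N : Finset (I × I × I)) (hIK : Fintype.card I ≤ K)
    (hEK : #E ≤ K) (hNK : #N ≤ K) (hE : ∀ e ∈ E, rk e.1 < rk e.2)
    (hN : ∀ n ∈ N, (n.1, n.2.1) ∈ E ∧ (n.1, n.2.2) ∈ E ∧ (n.2.1, n.2.2) ∈ E)
    (hreg : ∀ e ∈ E, RegPair q c η (p e.1) (p e.2))
    (hδ : ∀ e ∈ E, δ ≤ edgeDens q c p col e) (hω : ∀ s, ω ≤ wt q (p s))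
    {f f₁ : V × V × V → ℝ} (hu : PairUniform (fun ω => f ω - f₁ ω) θ) (h0 : ∀ ω, 0 ≤ f ω)
    (h1 : ∀ ω, f ω ≤ 1) (h0' : ∀ ω, 0 ≤ f₁ ω) (h1' : ∀ ω, f₁ ω ≤ 1) (sg : I × I × I → Prop)
    (D : I × I × I → ℝ) (hD0 : ∀ n ∈ N, 0 ≤ D n) (hD1 : ∀ n ∈ N, D n ≤ 1)
    (hcell : ∀ n ∈ N, cellE q c (fun ω => |f₁ ω - D n|) (cellOf p col n) ≤
      ε' * (cellW q (cellOf p col n) * cellD q c (cellOf p col n)))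
    (hD : ∀ n ∈ N, μ ≤ sgnVal (sg n) (D n)) :
    μ ^ K * δ ^ K * ω ^ K / 2 ≤ 𝔼 x : I → V, (inParts q p x * ∏ e ∈ E, hasCol c col e x) *
      ∏ n ∈ N, sgnVal (sg n) (f (tup x n)) := by
  set T : (I → V) → ℝ := fun x => inParts q p x * ∏ e ∈ E, hasCol c col e x
  have hT0 : ∀ x, 0 ≤ T x := fun x =>
    mul_nonneg (inParts_nonneg q p x) (prod_nonneg fun e _ => hasCol_nonneg e x)
  set W := 𝔼 x, inParts q p x with hWdef
  set Dd := ∏ e ∈ E, edgeDens q c p col e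
  have hrk : ∀ n ∈ N, rk n.1 < rk n.2.1 ∧ rk n.2.1 < rk n.2.2 := fun n hn =>
    ⟨hE _ (hN n hn).1, hE _ (hN n hn).2.2⟩
  have A := triples_replace rk hu h0 h1 h0' h1' sg N hrk T fun n hn => by
    obtain ⟨r1, r2⟩ := hrk n hn
    have hab : n.1 ≠ n.2.1 := fun e => by rw [e] at r1; omega
    have had : n.1 ≠ n.2.2 := fun e => by rw [e] at r1; omega
    have hbd : n.2.1 ≠ n.2.2 := fun e => by rw [e] at r2; omega
    exact (split3_inParts hab).mul (Split3.prod E fun e _ => split3_hasCol hab had hbd e)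
  have B : |𝔼 x, T x * ∏ n ∈ N, sgnVal (sg n) (f₁ (tup x n)) -
      (∏ n ∈ N, sgnVal (sg n) (D n)) * 𝔼 x, T x| ≤ #N * (ε' * (Dd * W) + #E * (η * W)) := by
    rw [mul_expect, ← expect_sub_distrib]
    have h2 : ∀ x, |T x * ∏ n ∈ N, sgnVal (sg n) (f₁ (tup x n)) -
        (∏ n ∈ N, sgnVal (sg n) (D n)) * T x| ≤ ∑ n ∈ N, T x * |f₁ (tup x n) - D n| := by
      intro x
      have e : T x * ∏ n ∈ N, sgnVal (sg n) (f₁ (tup x n)) - (∏ n ∈ N, sgnVal (sg n) (D n)) * T x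
          = T x * (∏ n ∈ N, sgnVal (sg n) (f₁ (tup x n)) - ∏ n ∈ N, sgnVal (sg n) (D n)) := by ring
      rw [e, abs_mul, abs_of_nonneg (hT0 x), ← mul_sum]
      refine mul_le_mul_of_nonneg_left ?_ (hT0 x)
      refine (abs_prod_sub_prod_le N _ _ (fun n _ => sgnVal_nonneg (h0' _) (h1' _))
        (fun n _ => sgnVal_le_one (h0' _) (h1' _)) (fun n hn => sgnVal_nonneg (hD0 n hn) (hD1 n hn))
        fun n hn => sgnVal_le_one (hD0 n hn) (hD1 n hn)).trans (sum_le_sum fun n _ => ?_)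
      rw [abs_sgnVal_sub]
    refine (abs_expect_le _ _).trans ((expect_mono h2).trans ?_)
    rw [expect_sum, ← nsmul_eq_mul]
    refine sum_le_card_nsmul _ _ _ fun n hn => ?_
    have := cell_error rk E hE hreg (hN n hn).1 (hN n hn).2.1 (hN n hn).2.2
      (g := fun ω => |f₁ ω - D n|) (fun ω => abs_nonneg _) (fun ω => by
        rw [abs_le]; constructor <;> linarith [h0' ω, h1' ω, hD0 n hn, hD1 n hn]) (hcell n hn)
    refine le_trans (le_of_eq (expect_congr rfl fun x _ => ?_)) this
    simp only [T]; ring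
  have C : |𝔼 x, T x - Dd * W| ≤ #E * (η * W) := by
    have := edges_replace rk E hE hreg (G := fun _ => 1) (fun e _ => Split.one _ _) (col := col)
    simpa only [one_mul, mul_one] using this
  have hS0 : μ ^ K ≤ ∏ n ∈ N, sgnVal (sg n) (D n) := by
    calc μ ^ K ≤ μ ^ #N := pow_le_pow_of_le_one hμ0.le hμ1 hNK
      _ = ∏ n ∈ N, μ := by rw [prod_const]
      _ ≤ _ := prod_le_prod (fun _ _ => hμ0.le) hD
  have hS1 : ∏ n ∈ N, sgnVal (sg n) (D n) ≤ 1 :=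
    prod_le_one (fun n hn => sgnVal_nonneg (hD0 n hn) (hD1 n hn))
      fun n hn => sgnVal_le_one (hD0 n hn) (hD1 n hn)
  have hDd : δ ^ K ≤ Dd := by
    calc δ ^ K ≤ δ ^ #E := pow_le_pow_of_le_one hδ0.le hδ1 hEK
      _ = ∏ e ∈ E, δ := by rw [prod_const]
      _ ≤ _ := prod_le_prod (fun _ _ => hδ0.le) hδ
  have hW : ω ^ K ≤ W := by
    rw [hWdef, expect_inParts]
    calc ω ^ K ≤ ω ^ Fintype.card I := pow_le_pow_of_le_one hω0.le hω1 hIK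
      _ = ∏ s : I, ω := by rw [prod_const]; rfl
      _ ≤ _ := prod_le_prod (fun _ _ => hω0.le) fun s _ => hω s
  have hE' : (#E : ℝ) ≤ K := by exact_mod_cast hEK
  have hN' : (#N : ℝ) ≤ K := by exact_mod_cast hNK
  have hμK : 0 < μ ^ K := by positivity
  have hδK : 0 < δ ^ K := by positivity
  have hωK : 0 < ω ^ K := by positivity
  set S₀ := ∏ n ∈ N, sgnVal (sg n) (D n)
  set X := 𝔼 x, T x
  set Y := 𝔼 x, T x * ∏ n ∈ N, sgnVal (sg n) (f₁ (tup x n))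
  have hW0 : 0 < W := hωK.trans_le hW
  have hDd0 : 0 < Dd := hδK.trans_le hDd
  have hηW : 0 ≤ η * W := mul_nonneg hη hW0.le
  have hεW : 0 ≤ ε' * (Dd * W) := by positivity
  have c1 : (#N : ℝ) * θ ≤ K * θ := mul_le_mul_of_nonneg_right hN' hθ
  have c2 : (#E : ℝ) * (η * W) ≤ K * (η * W) := mul_le_mul_of_nonneg_right hE' hηW
  have c3 : (#N : ℝ) * (ε' * (Dd * W) + #E * (η * W)) ≤ K * (ε' * (Dd * W) + K * (η * W)) :=
    mul_le_mul hN' (by linarith) (by positivity) (by positivity)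
  have d1 := (abs_le.1 A).1
  have d2 := (abs_le.1 B).1
  have d3 := (abs_le.1 C).1
  have hX0 : 0 ≤ X := expect_nn hT0
  have d4 : μ ^ K * (Dd * W) - K * (η * W) ≤ S₀ * X := by
    have k1 : S₀ * (Dd * W - K * (η * W)) ≤ S₀ * X :=
      mul_le_mul_of_nonneg_left (by linarith) (hμK.le.trans hS0)
    have k2 : S₀ * (K * (η * W)) ≤ 1 * (K * (η * W)) :=
      mul_le_mul_of_nonneg_right hS1 (by positivity)
    have k3 : μ ^ K * (Dd * W) ≤ S₀ * (Dd * W) := mul_le_mul_of_nonneg_right hS0 (by positivity)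
    linarith
  have f1 : K * (ε' * (Dd * W)) ≤ μ ^ K / 8 * (Dd * W) := by
    have := mul_le_mul_of_nonneg_right hεK (show 0 ≤ Dd * W by positivity)
    linarith
  have f2 : K * (η * W) + K * (K * (η * W)) ≤ μ ^ K / 8 * (Dd * W) := by
    have k1 := mul_le_mul_of_nonneg_right hηK hW0.le
    have k2 : μ ^ K * δ ^ K * W ≤ μ ^ K * Dd * W :=
      mul_le_mul_of_nonneg_right (mul_le_mul_of_nonneg_left hDd hμK.le) hW0.le
    linarith
  have f4 : μ ^ K * δ ^ K * ω ^ K ≤ μ ^ K * (Dd * W) := by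
    rw [mul_assoc]
    exact mul_le_mul_of_nonneg_left (mul_le_mul hDd hW hωK.le hDd0.le) hμK.le
  have f5 : 0 < μ ^ K * δ ^ K * ω ^ K := by positivity
  linarith

lemma expect_not_injective_le : 𝔼 x : I → V, ind (¬ Function.Injective x) ≤
    (Fintype.card I : ℝ) ^ 2 / Fintype.card V := by
  have hV : (0 : ℝ) < Fintype.card V := by exact_mod_cast Fintype.card_pos
  have h1 : ∀ x : I → V, ind (¬ Function.Injective x) ≤
      ∑ e : I × I, ind (e.1 ≠ e.2 ∧ x e.1 = x e.2) := by
    intro x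
    by_cases h : Function.Injective x
    · rw [ind_false (by simpa using h)]; exact sum_nonneg fun _ _ => ind_nonneg _
    · rw [ind_true h]
      simp only [Function.Injective, not_forall] at h
      obtain ⟨s, t, hst, hne⟩ := h
      calc (1 : ℝ) = ind ((s, t).1 ≠ (s, t).2 ∧ x (s, t).1 = x (s, t).2) := by
            rw [ind_true]; exact ⟨hne, hst⟩
        _ ≤ _ := single_le_sum (f := fun e : I × I => ind (e.1 ≠ e.2 ∧ x e.1 = x e.2))
          (fun _ _ => ind_nonneg _) (mem_univ (s, t))
  refine (expect_mono h1).trans ?_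
  rw [expect_sum]
  have h2 : ∀ e : I × I, 𝔼 x : I → V, ind (e.1 ≠ e.2 ∧ x e.1 = x e.2) ≤ 1 / Fintype.card V := by
    rintro ⟨s, t⟩
    by_cases hst : s = t
    · simp [hst]
    · rw [expect_resample s]
      refine expect_le_const fun x => ?_
      simp only [ne_eq, hst, not_false_eq_true, true_and, Function.update_self,
        Function.update_of_ne (Ne.symm hst)]
      rw [Fintype.expect_eq_sum_div_card]
      refine div_le_div_of_nonneg_right (le_of_eq ?_) hV.le
      simp [ind]
  refine (sum_le_sum fun e _ => h2 e).trans (le_of_eq ?_)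
  simp only [sum_const, card_univ, Fintype.card_prod, nsmul_eq_mul]
  push_cast
  ring

theorem exists_embedding {K : ℕ} {μ δ ω ε' η θ : ℝ} (hμ0 : 0 < μ) (hμ1 : μ ≤ 1) (hδ0 : 0 < δ)
    (hδ1 : δ ≤ 1) (hω0 : 0 < ω) (hω1 : ω ≤ 1) (hε' : 0 ≤ ε') (hη : 0 ≤ η) (hθ : 0 ≤ θ)
    (hεK : ε' * (8 * K) ≤ μ ^ K) (hηK : η * (8 * (K * (K + 1))) ≤ μ ^ K * δ ^ K)
    (hθK : θ * (8 * K) ≤ μ ^ K * δ ^ K * ω ^ K)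
    (hV : (K : ℝ) ^ 2 < μ ^ K * δ ^ K * ω ^ K / 2 * Fintype.card V)
    (rk : I → ℕ) (E : Finset (I × I)) (N : Finset (I × I × I)) (hIK : Fintype.card I ≤ K)
    (hEK : #E ≤ K) (hNK : #N ≤ K) (hE : ∀ e ∈ E, rk e.1 < rk e.2)
    (hN : ∀ n ∈ N, (n.1, n.2.1) ∈ E ∧ (n.1, n.2.2) ∈ E ∧ (n.2.1, n.2.2) ∈ E)
    (hreg : ∀ e ∈ E, RegPair q c η (p e.1) (p e.2))
    (hδ : ∀ e ∈ E, δ ≤ edgeDens q c p col e) (hω : ∀ s, ω ≤ wt q (p s))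
    (Ed : V × V × V → Prop) {f₁ : V × V × V → ℝ}
    (hu : PairUniform (fun ω => ind (Ed ω) - f₁ ω) θ)
    (h0' : ∀ ω, 0 ≤ f₁ ω) (h1' : ∀ ω, f₁ ω ≤ 1) (sg : I × I × I → Prop)
    (D : I × I × I → ℝ) (hD0 : ∀ n ∈ N, 0 ≤ D n) (hD1 : ∀ n ∈ N, D n ≤ 1)
    (hcell : ∀ n ∈ N, cellE q c (fun ω => |f₁ ω - D n|) (cellOf p col n) ≤
      ε' * (cellW q (cellOf p col n) * cellD q c (cellOf p col n)))
    (hD : ∀ n ∈ N, μ ≤ sgnVal (sg n) (D n)) :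
    ∃ x : I → V, Function.Injective x ∧ ∀ n ∈ N, (Ed (tup x n) ↔ sg n) := by
  by_contra! hcon
  have hVpos : (0 : ℝ) < Fintype.card V := by exact_mod_cast Fintype.card_pos
  have key := counting_lower_bound hμ0 hμ1 hδ0 hδ1 hω0 hω1 hε' hη hθ hεK hηK hθK rk E N hIK hEK hNK
    hE hN hreg hδ hω hu (fun _ => ind_nonneg _) (fun _ => ind_le_one _) h0' h1' sg D hD0 hD1
    hcell hD
  have h1 : 𝔼 x : I → V, (inParts q p x * ∏ e ∈ E, hasCol c col e x) *
      ∏ n ∈ N, sgnVal (sg n) (ind (Ed (tup x n))) ≤ 𝔼 x : I → V, ind (¬ Function.Injective x) := by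
    refine expect_mono fun x => ?_
    by_cases hx : Function.Injective x
    · obtain ⟨n, hn, hne⟩ := hcon x hx
      rw [ind_false (by simpa using hx), prod_eq_zero hn, mul_zero]
      unfold sgnVal
      rcases hne with ⟨ha, hb⟩ | ⟨ha, hb⟩ <;> simp [ha, hb]
    · rw [ind_true hx]
      refine mul_le_one₀ (mul_le_one₀ (inParts_le_one _ _ _)
        (prod_nonneg fun _ _ => hasCol_nonneg _ _)
        (prod_le_one (fun _ _ => hasCol_nonneg _ _) fun _ _ => hasCol_le_one _ _))
        (prod_nonneg fun _ _ => sgnVal_nonneg (ind_nonneg _) (ind_le_one _))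
        (prod_le_one (fun _ _ => sgnVal_nonneg (ind_nonneg _) (ind_le_one _))
          fun _ _ => sgnVal_le_one (ind_nonneg _) (ind_le_one _))
  have h2 := key.trans (h1.trans expect_not_injective_le)
  have h3 : (Fintype.card I : ℝ) ^ 2 ≤ (K : ℝ) ^ 2 :=
    pow_le_pow_left₀ (Nat.cast_nonneg _) (by exact_mod_cast hIK) 2
  rw [le_div_iff₀ hVpos] at h2
  linarith

end Embedding

/-- Transport of an induced sub-3-graph along an injective labelling. -/
lemma exists_induced_copy {I : Type} [Fintype I] (H : ThreeGraph) (x ψ : I → ℕ)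
    (hx : Function.Injective x) (hψ : Function.Injective ψ) (hxH : ∀ s, x s ∈ H.verts) :
    ∃ H' : ThreeGraph, H.ContainsInduced H' ∧ H'.verts = univ.image ψ ∧
      ∀ r s t, (({ψ r, ψ s, ψ t} : Finset ℕ) ∈ H'.edges ↔
        ({x r, x s, x t} : Finset ℕ) ∈ H.edges) := by
  set φ : ℕ → ℕ := Function.extend ψ x fun _ => 0
  have hφ : ∀ s, φ (ψ s) = x s := fun s => hψ.extend_apply _ _ _
  set f : ℕ → ℕ := Function.extend x ψ fun _ => 0
  have hf : ∀ s, f (x s) = ψ s := fun s => hx.extend_apply _ _ _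
  let H' : ThreeGraph :=
    { verts := univ.image ψ
      edges := (univ.image ψ).powerset.filter fun e => e.image φ ∈ H.edges ∧ e.card = 3
      edges_sub := fun e he => by
        rw [mem_filter, mem_powerset] at he
        exact ⟨he.1, he.2.2⟩ }
  have key : ∀ r s t, (({ψ r, ψ s, ψ t} : Finset ℕ) ∈ H'.edges ↔
      ({x r, x s, x t} : Finset ℕ) ∈ H.edges) := by
    intro r s t
    have e1 : ({ψ r, ψ s, ψ t} : Finset ℕ) = ({r, s, t} : Finset I).image ψ := by
      simp [image_insert]
    have e2 : ({x r, x s, x t} : Finset ℕ) = ({r, s, t} : Finset I).image x := by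
      simp [image_insert]
    have e3 : ({ψ r, ψ s, ψ t} : Finset ℕ).image φ = {x r, x s, x t} := by
      simp [image_insert, hφ]
    simp only [H', mem_filter, mem_powerset, e3]
    constructor
    · exact fun h => h.2.1
    · intro h
      refine ⟨?_, h, ?_⟩
      · rw [e1]; exact image_subset_image (subset_univ _)
      · have := (H.edges_sub _ h).2
        rw [e2, card_image_of_injective _ hx] at this
        rw [e1, card_image_of_injective _ hψ, this]
  refine ⟨H', ⟨univ.image x, f, ?_, ?_⟩, rfl, key⟩
  · have hv : (H.induce (univ.image x)).verts = univ.image x := by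
      simp only [ThreeGraph.induce]
      refine inter_eq_right.2 fun n hn => ?_
      obtain ⟨s, -, rfl⟩ := mem_image.1 hn
      exact hxH s
    rw [hv]
    refine ⟨fun n hn => ?_, fun n hn n' hn' h => ?_, fun n hn => ?_⟩
    · obtain ⟨s, -, rfl⟩ := mem_image.1 (mem_coe.1 hn)
      rw [hf]; exact mem_coe.2 (mem_image_of_mem _ (mem_univ _))
    · obtain ⟨s, -, rfl⟩ := mem_image.1 (mem_coe.1 hn)
      obtain ⟨s', -, rfl⟩ := mem_image.1 (mem_coe.1 hn')
      rw [hf, hf] at h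
      rw [hψ h]
    · obtain ⟨s, -, rfl⟩ := mem_image.1 (mem_coe.1 hn)
      exact ⟨x s, mem_coe.2 (mem_image_of_mem _ (mem_univ _)), hf s⟩
  · intro a ha b hb d hd
    have hmem : ∀ {n}, n ∈ (H.induce (univ.image x)).verts → ∃ s, x s = n := fun hn => by
      obtain ⟨s, -, h⟩ := mem_image.1 (mem_inter.1 hn).2
      exact ⟨s, h⟩
    obtain ⟨r, rfl⟩ := hmem ha
    obtain ⟨s, rfl⟩ := hmem hb
    obtain ⟨t, rfl⟩ := hmem hd
    rw [hf, hf, hf, key]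
    simp only [ThreeGraph.induce, mem_filter, and_iff_left_iff_imp]
    intro _ n hn
    simp only [mem_insert, mem_singleton] at hn
    rcases hn with rfl | rfl | rfl <;> exact mem_image_of_mem _ (mem_univ _)

/-- A numbering of the patterns. -/
noncomputable def patCode {K : ℕ} (v : Fin K → Bool) : ℕ := Fintype.equivFin (Fin K → Bool) v

lemma patCode_injective {K : ℕ} : Function.Injective (patCode (K := K)) := fun _ _ h =>
  (Fintype.equivFin _).injective (Fin.ext h)

/-- The bigraph whose right vertices are the patterns in `S`. -/
noncomputable def patBG {K : ℕ} (S : Finset (Fin K → Bool)) : Bigraph where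
  left := range K
  right := S.image patCode
  edges := (univ ×ˢ S).biUnion fun p : Fin K × (Fin K → Bool) =>
    if p.2 p.1 = true then {((p.1 : ℕ), patCode p.2)} else ∅
  edges_sub := by
    intro e he
    obtain ⟨p, hp, he⟩ := mem_biUnion.1 he
    split_ifs at he with h
    · rw [mem_singleton] at he
      rw [he]
      exact mem_product.2 ⟨mem_range.2 p.1.2, mem_image_of_mem _ (mem_product.1 hp).2⟩
    · simp at he

lemma mem_patBG_edges {K : ℕ} {S : Finset (Fin K → Bool)} (u : Fin K) {v : Fin K → Bool}
    (hv : v ∈ S) : ((u : ℕ), patCode v) ∈ (patBG S).edges ↔ v u = true := by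
  simp only [patBG, mem_biUnion, mem_product, mem_univ, true_and]
  constructor
  · rintro ⟨p, hp, he⟩
    split_ifs at he with h
    · rw [mem_singleton, Prod.mk.injEq] at he
      rw [patCode_injective he.2, Fin.ext he.1]; exact h
    · simp at he
  · intro h
    refine ⟨(u, v), hv, ?_⟩
    simp [h]

lemma patBG_irreducible {K : ℕ} {S : Finset (Fin K → Bool)}
    (hS : ∀ u u', u ≠ u' → ∃ v ∈ S, v u ≠ v u') : (patBG S).Irreducible := by
  constructor
  · intro u hu u' hu' h
    lift u to Fin K using mem_range.1 hu
    lift u' to Fin K using mem_range.1 hu'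
    by_contra hne
    obtain ⟨v, hv, hvu⟩ := hS u u' fun e => hne (by rw [e])
    have := h (patCode v)
    rw [mem_patBG_edges u hv, mem_patBG_edges u' hv] at this
    exact hvu (Bool.eq_iff_iff.2 this)
  · intro v hv v' hv' h
    obtain ⟨v, hvS, rfl⟩ := mem_image.1 hv
    obtain ⟨v', hvS', rfl⟩ := mem_image.1 hv'
    congr 1
    funext u
    have := h u
    rw [mem_patBG_edges u hvS, mem_patBG_edges u hvS'] at this
    exact Bool.eq_iff_iff.2 this

/-- The vertices of a blowup: `A`, `B` and the classes `C_v`, `v ∈ S`. -/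
abbrev BlowVerts {K : ℕ} (m : ℕ) (S : Finset (Fin K → Bool)) : Type :=
  Fin m ⊕ Fin m ⊕ (S × Fin m)

/-- `H` contains the blowup of the pattern bigraph of `S` along the colouring `col`. -/
def HasBlowup {K m : ℕ} (H : ThreeGraph) (S : Finset (Fin K → Bool))
    (col : Fin m → Fin m → Fin K) : Prop :=
  ∃ x : BlowVerts m S → H.verts, Function.Injective x ∧ ∀ i j (v : S) r,
    (({((x (.inl i) : H.verts) : ℕ), ((x (.inr (.inl j)) : H.verts) : ℕ),
      ((x (.inr (.inr (v, r))) : H.verts) : ℕ)} : Finset ℕ) ∈ H.edges ↔ v.1 (col i j) = true)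

lemma gDim_of_hasBlowup {K m : ℕ} {H : ThreeGraph} {S : Finset (Fin K → Bool)}
    (h : ∀ col : Fin m → Fin m → Fin K, HasBlowup H S col) : GDimAtLeast (patBG S) H m := by
  intro Γ hA hB
  let a : Fin m ≃ Γ.A := (finCongr hA.symm).trans Γ.A.equivFin.symm
  let b : Fin m ≃ Γ.B := (finCongr hB.symm).trans Γ.B.equivFin.symm
  have hcol : ∀ i j, ∃ u : Fin K, ({(a i : ℕ), (b j : ℕ)} : Finset ℕ) ∈ Γ.P u := by
    intro i j
    have h1 : ({(a i : ℕ), (b j : ℕ)} : Finset ℕ) ∈ (patBG S).left.biUnion Γ.P := by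
      rw [Γ.P_cover]
      exact mem_image.2 ⟨(a i, b j), mem_product.2 ⟨(a i).2, (b j).2⟩, rfl⟩
    obtain ⟨u, hu, h2⟩ := mem_biUnion.1 h1
    exact ⟨⟨u, mem_range.1 hu⟩, h2⟩
  choose col hcol using hcol
  obtain ⟨x, hx, hxe⟩ := h col
  set base := (Γ.A ∪ Γ.B).sup id + 1
  have hbase : ∀ n ∈ Γ.A ∪ Γ.B, n < base := fun n hn =>
    Nat.lt_succ_of_le (le_sup (f := id) hn)
  let ψ : BlowVerts m S → ℕ := fun s => match s with
    | .inl i => a i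
    | .inr (.inl j) => b j
    | .inr (.inr (v, r)) => base + (r + m * patCode v.1)
  have hcode : ∀ (r r' : Fin m) (c c' : ℕ), (r : ℕ) + m * c = r' + m * c' → r = r' ∧ c = c' := by
    intro r r' c c' he
    have hm : 0 < m := r.pos
    have h1 := congrArg (· % m) he
    have h2 := congrArg (· / m) he
    simp only [Nat.add_mul_mod_self_left, Nat.mod_eq_of_lt r.2, Nat.mod_eq_of_lt r'.2] at h1
    simp only [Nat.add_mul_div_left _ _ hm, Nat.div_eq_of_lt r.2, Nat.div_eq_of_lt r'.2,
      zero_add] at h2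
    exact ⟨Fin.ext h1, h2⟩
  have hab : ∀ i j, (a i : ℕ) ≠ b j := fun i j e =>
    disjoint_left.1 Γ.disjAB (a i).2 (e ▸ (b j).2)
  have ha : ∀ i, (a i : ℕ) < base := fun i => hbase _ (mem_union_left _ (a i).2)
  have hb : ∀ i, (b i : ℕ) < base := fun i => hbase _ (mem_union_right _ (b i).2)
  have hψ : Function.Injective ψ := by
    rintro (i | j | ⟨v, r⟩) (i' | j' | ⟨v', r'⟩) he <;> simp only [ψ] at he
    · rw [a.injective (Subtype.ext he)]
    · exact absurd he (hab _ _)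
    · have := ha i; omega
    · exact absurd he.symm (hab _ _)
    · rw [b.injective (Subtype.ext he)]
    · have := hb j; omega
    · have := ha i'; omega
    · have := hb j'; omega
    · obtain ⟨h1, h2⟩ := hcode r r' _ _ (Nat.add_left_cancel he)
      rw [h1, Subtype.ext (patCode_injective h2)]
  obtain ⟨H', hH', hverts, hedges⟩ := exists_induced_copy H (fun s => (x s : ℕ)) ψ
    (Subtype.val_injective.comp hx) hψ fun s => (x s).2
  refine ⟨H', ⟨fun c => univ.image fun r : Fin m => base + (r + m * c), ?_, ?_, ?_, ?_, ?_⟩, hH'⟩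
  · intro v hv
    rw [card_image_of_injective, card_univ, Fintype.card_fin]
    intro r r' he
    exact (hcode r r' v v (Nat.add_left_cancel he)).1
  · intro v _ v' _ hne
    rw [disjoint_left]
    intro n hn hn'
    obtain ⟨r, -, rfl⟩ := mem_image.1 hn
    obtain ⟨r', -, he⟩ := mem_image.1 hn'
    exact hne (hcode r' r _ _ (Nat.add_left_cancel he)).2.symm
  · intro v _
    rw [disjoint_left]
    intro n hn hn'
    obtain ⟨r, -, rfl⟩ := mem_image.1 hn
    have := hbase _ hn'
    omega
  · rw [hverts]
    ext n
    simp only [mem_image, mem_univ, true_and, mem_union, mem_biUnion]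
    constructor
    · rintro ⟨i | j | ⟨v, r⟩, rfl⟩
      · exact Or.inl (Or.inl (a i).2)
      · exact Or.inl (Or.inr (b j).2)
      · exact Or.inr ⟨patCode v.1, mem_image_of_mem _ v.2, r, rfl⟩
    · rintro ((h | h) | ⟨c, hc, r, rfl⟩)
      · exact ⟨.inl (a.symm ⟨n, h⟩), by simp [ψ]⟩
      · exact ⟨.inr (.inl (b.symm ⟨n, h⟩)), by simp [ψ]⟩
      · obtain ⟨v, hv, rfl⟩ := mem_image.1 hc
        exact ⟨.inr (.inr (⟨v, hv⟩, r)), rfl⟩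
  · intro u hu c hc e he z hz
    obtain ⟨v, hv, rfl⟩ := mem_image.1 hc
    obtain ⟨r, -, rfl⟩ := mem_image.1 hz
    lift u to Fin K using mem_range.1 hu
    have he' : e ∈ pairsAB Γ.A Γ.B := by
      rw [← Γ.P_cover]; exact mem_biUnion.2 ⟨_, hu, he⟩
    obtain ⟨⟨s, t⟩, hst, rfl⟩ := mem_image.1 he'
    obtain ⟨hs, ht⟩ := mem_product.1 hst
    obtain ⟨i, hi⟩ : ∃ i, (a i : ℕ) = s := ⟨a.symm ⟨s, hs⟩, by simp⟩
    obtain ⟨j, hj⟩ : ∃ j, (b j : ℕ) = t := ⟨b.symm ⟨t, ht⟩, by simp⟩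
    have hu' : u = col i j := by
      by_contra hne
      have h1 := hcol i j
      rw [hi, hj] at h1
      exact disjoint_left.1 (Γ.P_disj u hu (col i j) (mem_range.2 (col i j).2)
        fun h => hne (Fin.ext h)) he h1
    have h1 := hedges (.inl i) (.inr (.inl j)) (.inr (.inr (⟨v, hv⟩, r)))
    rw [hxe i j ⟨v, hv⟩ r] at h1
    have h2 : ({ψ (.inl i), ψ (.inr (.inl j)), ψ (.inr (.inr (⟨v, hv⟩, r)))} : Finset ℕ) =
        insert (base + (r + m * patCode v)) {s, t} := by
      simp only [ψ, hi, hj]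
      ext n; simp only [mem_insert, mem_singleton]; tauto
    rw [h2, ← hu', ← mem_patBG_edges u hv] at h1
    exact ⟨h1.2, fun h => h ∘ h1.1⟩

/-- If no bigraph of `B_ℋ` has more than `L` left vertices, then for each family of patterns
separating `L + 1` rows some bounded blowup is missing from each member of `ℋ`. -/
lemma exists_missing_blowup {ℋ : Set ThreeGraph} {L : ℕ}
    (hub : ∀ K : ℕ, (∃ G : Bigraph, InBH ℋ G ∧ G.left.card = K) → K ≤ L) :
    ∃ M : ℕ, ∀ H ∈ ℋ, ∀ S : Finset (Fin (L + 1) → Bool),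
      (∀ u u', u ≠ u' → ∃ v ∈ S, v u ≠ v u') →
        ∃ m ≤ M, ∃ col : Fin m → Fin m → Fin (L + 1), ¬ HasBlowup H S col := by
  have h : ∀ S : Finset (Fin (L + 1) → Bool), ∃ m : ℕ,
      (∀ u u', u ≠ u' → ∃ v ∈ S, v u ≠ v u') →
        ∀ H ∈ ℋ, ∃ col : Fin m → Fin m → Fin (L + 1), ¬ HasBlowup H S col := by
    intro S
    by_cases hS : ∀ u u', u ≠ u' → ∃ v ∈ S, v u ≠ v u'
    · have h1 : ¬ InBH ℋ (patBG S) := fun hin => by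
        have := hub (L + 1) ⟨_, hin, by simp [patBG]⟩
        omega
      have h2 : ∃ m, ∀ H ∈ ℋ, ¬ GDimAtLeast (patBG S) H m := by
        by_contra! hc
        exact h1 ⟨patBG_irreducible hS, hc⟩
      obtain ⟨m, hm⟩ := h2
      refine ⟨m, fun _ H hH => ?_⟩
      by_contra! hc
      exact hm H hH (gDim_of_hasBlowup hc)
    · exact ⟨0, fun h => absurd h hS⟩
  choose m hm using h
  exact ⟨univ.sup m, fun H hH S hS => ⟨m S, le_sup (mem_univ S), hm S hS H hH⟩⟩

/-- The index of a cell: three parts and three colours. -/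
abbrev CellIx (ι κ : Type) : Type := (ι × ι × ι) × (κ × κ × κ)

section Cells
variable {V ι κ : Type} [Fintype V] {q : V → ι} {c : V → V → κ}

/-- The expected mass of a cell. -/
noncomputable def cellM (q : V → ι) (c : V → V → κ) (X : CellIx ι κ) : ℝ :=
  cellW q X * cellD q c X

lemma cellW_nonneg (X : CellIx ι κ) : 0 ≤ cellW q X :=
  mul_nonneg (mul_nonneg (wt_nonneg _ _) (wt_nonneg _ _)) (wt_nonneg _ _)

lemma cellD_nonneg (X : CellIx ι κ) : 0 ≤ cellD q c X :=
  mul_nonneg (mul_nonneg (dens_nonneg _ _ _ _ _) (dens_nonneg _ _ _ _ _)) (dens_nonneg _ _ _ _ _)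

lemma cellM_nonneg (X : CellIx ι κ) : 0 ≤ cellM q c X :=
  mul_nonneg (cellW_nonneg X) (cellD_nonneg X)

lemma cellE_nonneg {g : V × V × V → ℝ} (hg : ∀ ω, 0 ≤ g ω) (X : CellIx ι κ) :
    0 ≤ cellE q c g X := expect_nn fun _ => mul_nonneg (ind_nonneg _) (hg _)

lemma cellE_mono {g h : V × V × V → ℝ} (hg : ∀ ω, g ω ≤ h ω) (X : CellIx ι κ) :
    cellE q c g X ≤ cellE q c h X :=
  expect_mono fun _ => mul_le_mul_of_nonneg_left (hg _) (ind_nonneg _)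

lemma sum_cell [Fintype ι] [Fintype κ] (F : CellIx ι κ → ℝ) :
    ∑ X, F X = ∑ i, ∑ j, ∑ k, ∑ α, ∑ β, ∑ γ, F ((i, j, k), (α, β, γ)) := by
  simp only [Fintype.sum_prod_type]

lemma sum_cellE_mul [Fintype ι] [Fintype κ] (g : V × V × V → ℝ) (h : CellIx ι κ → ℝ) :
    ∑ X, cellE q c g X * h X = 𝔼 ω, g ω * h (cell q c ω) := by
  simp only [cellE, expect_mul, ← expect_sum]
  refine expect_congr rfl fun ω _ => ?_
  rw [← sum_ind_eq (cell q c ω) h, mul_sum]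
  exact sum_congr rfl fun X _ => by ring

lemma sum_cellE [Fintype ι] [Fintype κ] (g : V × V × V → ℝ) :
    ∑ X : CellIx ι κ, cellE q c g X = 𝔼 ω, g ω := by
  simpa using sum_cellE_mul g (fun _ : CellIx ι κ => (1 : ℝ)) (q := q) (c := c)

lemma expect_tup [Nonempty V] (g : V × V × V → ℝ) :
    𝔼 x : Fin 3 → V, g (tup x (0, 1, 2)) = 𝔼 ω, g ω := by
  refine Fintype.expect_bijective (fun x : Fin 3 → V => tup x (0, 1, 2)) ⟨fun x y h => ?_, ?_⟩ _ _
    fun _ => rfl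
  · simp only [tup, Prod.mk.injEq] at h
    funext s
    fin_cases s
    exacts [h.1, h.2.1, h.2.2]
  · rintro ⟨u, v, w⟩
    exact ⟨![u, v, w], rfl⟩

lemma abs_cellE_one_sub_le [Nonempty V] {η : ℝ} {X : CellIx ι κ} (h1 : RegPair q c η X.1.1 X.1.2.1)
    (h2 : RegPair q c η X.1.1 X.1.2.2) (h3 : RegPair q c η X.1.2.1 X.1.2.2) :
    |cellE q c (fun _ => 1) X - cellM q c X| ≤ 3 * η * cellW q X := by
  obtain ⟨⟨i, j, k⟩, ⟨α, β, γ⟩⟩ := X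
  let p : Fin 3 → ι := ![i, j, k]
  let col : Fin 3 × Fin 3 → κ := fun e => if e = (0, 1) then α else if e = (0, 2) then β else γ
  let E : Finset (Fin 3 × Fin 3) := {(0, 1), (0, 2), (1, 2)}
  have key := edges_replace (q := q) (c := c) (p := p) (col := col) (η := η) (fun s => (s : ℕ)) E
    (by decide) (by
      intro e he
      simp only [E, mem_insert, mem_singleton] at he
      rcases he with rfl | rfl | rfl
      exacts [h1, h2, h3]) (G := fun _ => 1) (fun e _ => Split.one _ _)
  have e1 : ∏ e ∈ E, edgeDens q c p col e = cellD q c ((i, j, k), (α, β, γ)) := by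
    simp only [E]
    rw [prod_insert (by decide), prod_insert (by decide), prod_singleton, ← mul_assoc]
    rfl
  have e2 := expect_inParts (q := q) (p := p)
  have e2' : ∏ s, wt q (p s) = cellW q ((i, j, k), (α, β, γ)) := by
    rw [Fin.prod_univ_three]
    rfl
  have e3 : ∀ inst : Fintype (Fin 3 → V),
      𝔼 x ∈ @univ _ inst, inParts q p x * (1 * ∏ e ∈ E, hasCol c col e x) =
      cellE q c (fun _ => 1) ((i, j, k), (α, β, γ)) := by
    intro inst
    obtain rfl : inst = Pi.instFintype := Subsingleton.elim _ _
    rw [cellE, ← expect_tup]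
    refine expect_congr rfl fun x _ => ?_
    simp only [tup, ind_cell, inParts, Fin.prod_univ_three, E]
    rw [prod_insert (by decide), prod_insert (by decide), prod_singleton]
    simp only [hasCol, p, col]
    simp
    left; ring
  have e4 : (#E : ℝ) = 3 := by
    have : #E = 3 := by
      simp only [E]
      rw [card_insert_of_notMem (by decide), card_insert_of_notMem (by decide), card_singleton]
    rw [this]; norm_num
  rw [e1, e3, e4] at key
  simp only [mul_one, e2, e2'] at key
  rw [cellM, mul_comm (cellW q _)]
  linarith

end Cells

section Mass
variable {V ι κ : Type} [Fintype V] [Nonempty V] [Fintype ι] [Fintype κ] {q : V → ι}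
  {c : V → V → κ}

lemma sum_cellM_mul_le (φ : ι → ι → κ → ℝ) (hφ : ∀ i j α, 0 ≤ φ i j α) :
    ∑ X, cellM q c X * φ X.1.1 X.1.2.1 X.2.1 ≤
      ∑ i, ∑ j, wt q i * wt q j * ∑ α, dens q c i j α * φ i j α := by
  rw [sum_cell]
  refine sum_le_sum fun i _ => sum_le_sum fun j _ => ?_
  set A := ∑ α, dens q c i j α * φ i j α
  have hA : 0 ≤ A := sum_nonneg fun α _ => mul_nonneg (dens_nonneg _ _ _ _ _) (hφ _ _ _)
  have h : ∀ k, ∑ α, ∑ β, ∑ γ, cellM q c ((i, j, k), (α, β, γ)) * φ i j α ≤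
      wt q i * wt q j * A * wt q k := by
    intro k
    have e : ∑ α, ∑ β, ∑ γ, cellM q c ((i, j, k), (α, β, γ)) * φ i j α =
        wt q i * wt q j * A * wt q k * ((∑ β, dens q c i k β) * ∑ γ, dens q c j k γ) := by
      simp only [A]
      rw [mul_sum, sum_mul, sum_mul]
      refine sum_congr rfl fun α _ => ?_
      rw [sum_mul_sum, mul_sum]
      refine sum_congr rfl fun β _ => ?_
      rw [mul_sum]
      exact sum_congr rfl fun γ _ => by simp only [cellM, cellW, cellD]; ring
    rw [e]
    refine mul_le_of_le_one_right ?_ (mul_le_one₀ (sum_dens_le _ _ _ _)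
      (sum_nonneg fun _ _ => dens_nonneg _ _ _ _ _) (sum_dens_le _ _ _ _))
    have := wt_nonneg q i; have := wt_nonneg q j; have := wt_nonneg q k
    positivity
  refine (sum_le_sum fun k _ => h k).trans ?_
  rw [← mul_sum, sum_wt, mul_one]

lemma dens_swap {τ : κ → κ} (hτ : ∀ α, τ (τ α) = α) (hc : ∀ x y, c y x = τ (c x y)) (i j : ι)
    (α : κ) : dens q c j i (τ α) = dens q c i j α := by
  rw [dens, dens, expect_comm, mul_comm (wt q j)]
  congr 1
  refine expect_congr rfl fun x _ => expect_congr rfl fun y _ => ?_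
  rw [hc x y, mul_comm (ind (q y = j))]
  congr 1
  refine ind_congr ⟨fun h => ?_, fun h => by rw [h]⟩
  rw [← hτ (c x y), h, hτ]

/-- Exchange of the last two vertices of a cell. -/
def flipYZ (τ : κ → κ) (X : CellIx ι κ) : CellIx ι κ :=
  ((X.1.1, X.1.2.2, X.1.2.1), (X.2.2.1, X.2.1, τ X.2.2.2))

/-- Exchange of the first two vertices of a cell. -/
def flipXY (τ : κ → κ) (X : CellIx ι κ) : CellIx ι κ :=
  ((X.1.2.1, X.1.1, X.1.2.2), (τ X.2.1, X.2.2.2, X.2.2.1))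

variable {τ : κ → κ}

lemma flipYZ_invol (hτ : ∀ α, τ (τ α) = α) : Function.Involutive (flipYZ (ι := ι) τ) := by
  rintro ⟨⟨i, j, k⟩, ⟨α, β, γ⟩⟩; simp [flipYZ, hτ]

lemma flipXY_invol (hτ : ∀ α, τ (τ α) = α) : Function.Involutive (flipXY (ι := ι) τ) := by
  rintro ⟨⟨i, j, k⟩, ⟨α, β, γ⟩⟩; simp [flipXY, hτ]

lemma cellM_flipYZ (hτ : ∀ α, τ (τ α) = α) (hc : ∀ x y, c y x = τ (c x y)) (X : CellIx ι κ) :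
    cellM q c (flipYZ τ X) = cellM q c X := by
  simp only [cellM, cellW, cellD, flipYZ, dens_swap hτ hc]; ring

lemma cellM_flipXY (hτ : ∀ α, τ (τ α) = α) (hc : ∀ x y, c y x = τ (c x y)) (X : CellIx ι κ) :
    cellM q c (flipXY τ X) = cellM q c X := by
  simp only [cellM, cellW, cellD, flipXY, dens_swap hτ hc]; ring

lemma sum_flipYZ (hτ : ∀ α, τ (τ α) = α) (hc : ∀ x y, c y x = τ (c x y)) (F : CellIx ι κ → ℝ) :
    ∑ X, cellM q c X * F (flipYZ τ X) = ∑ X, cellM q c X * F X :=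
  Fintype.sum_bijective _ (flipYZ_invol hτ).bijective _ _ fun X => by rw [cellM_flipYZ hτ hc]

lemma sum_flipXY (hτ : ∀ α, τ (τ α) = α) (hc : ∀ x y, c y x = τ (c x y)) (F : CellIx ι κ → ℝ) :
    ∑ X, cellM q c X * F (flipXY τ X) = ∑ X, cellM q c X * F X :=
  Fintype.sum_bijective _ (flipXY_invol hτ).bijective _ _ fun X => by rw [cellM_flipXY hτ hc]

lemma cellE_flipYZ (hτ : ∀ α, τ (τ α) = α) (hc : ∀ x y, c y x = τ (c x y)) {f : V × V × V → ℝ}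
    (hf : ∀ x y z, f (x, z, y) = f (x, y, z)) (X : CellIx ι κ) :
    cellE q c f (flipYZ τ X) = cellE q c f X := by
  obtain ⟨⟨i, j, k⟩, ⟨α, β, γ⟩⟩ := X
  rw [cellE, cellE, expect_triple, expect_triple]
  refine expect_congr rfl fun x _ => ?_
  rw [expect_comm]
  refine expect_congr rfl fun y _ => expect_congr rfl fun z _ => ?_
  rw [hf]
  congr 1
  refine ind_congr ?_
  simp only [cell, tri, flipYZ, Prod.mk.injEq, hc y z]
  have : τ (c y z) = τ γ ↔ c y z = γ := ⟨fun h => by rw [← hτ (c y z), h, hτ], fun h => by rw [h]⟩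
  rw [this]; tauto

lemma cellE_flipXY (hτ : ∀ α, τ (τ α) = α) (hc : ∀ x y, c y x = τ (c x y)) {f : V × V × V → ℝ}
    (hf : ∀ x y z, f (y, x, z) = f (x, y, z)) (X : CellIx ι κ) :
    cellE q c f (flipXY τ X) = cellE q c f X := by
  obtain ⟨⟨i, j, k⟩, ⟨α, β, γ⟩⟩ := X
  rw [cellE, cellE, expect_triple, expect_triple, expect_comm]
  refine expect_congr rfl fun x _ => expect_congr rfl fun y _ => expect_congr rfl fun z _ => ?_
  rw [hf]
  congr 1
  refine ind_congr ?_
  simp only [cell, tri, flipXY, Prod.mk.injEq, hc x y]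
  have : τ (c x y) = τ α ↔ c x y = α := ⟨fun h => by rw [← hτ (c x y), h, hτ], fun h => by rw [h]⟩
  rw [this]; tauto

lemma sum_cellM_mul_le₂ (hτ : ∀ α, τ (τ α) = α) (hc : ∀ x y, c y x = τ (c x y))
    (φ : ι → ι → κ → ℝ) (hφ : ∀ i j α, 0 ≤ φ i j α) :
    ∑ X, cellM q c X * φ X.1.1 X.1.2.2 X.2.2.1 ≤
      ∑ i, ∑ j, wt q i * wt q j * ∑ α, dens q c i j α * φ i j α := by
  have := sum_flipYZ (q := q) hτ hc fun X => φ X.1.1 X.1.2.1 X.2.1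
  exact this.le.trans (sum_cellM_mul_le φ hφ)

lemma sum_cellM_mul_le₃ (hτ : ∀ α, τ (τ α) = α) (hc : ∀ x y, c y x = τ (c x y))
    (φ : ι → ι → κ → ℝ) (hφ : ∀ i j α, 0 ≤ φ i j α) :
    ∑ X, cellM q c X * φ X.1.2.1 X.1.2.2 X.2.2.2 ≤
      ∑ i, ∑ j, wt q i * wt q j * ∑ α, dens q c i j α * φ i j α := by
  have := sum_flipXY (q := q) hτ hc fun X => φ X.1.1 X.1.2.2 X.2.2.1
  exact this.le.trans (sum_cellM_mul_le₂ hτ hc φ hφ)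

/-- The three pairs of parts of a cell are regular. -/
def RegCell (q : V → ι) (c : V → V → κ) (η : ℝ) (X : CellIx ι κ) : Prop :=
  RegPair q c η X.1.1 X.1.2.1 ∧ RegPair q c η X.1.1 X.1.2.2 ∧ RegPair q c η X.1.2.1 X.1.2.2

lemma sum_irreg_le (η : ℝ) : ∑ i, ∑ j, wt q i * wt q j * ∑ α, dens q c i j α *
    ind (¬ RegPair q c η i j) ≤ irregMass q c η := by
  refine sum_le_sum fun i _ => sum_le_sum fun j _ => mul_le_mul_of_nonneg_left ?_
    (mul_nonneg (wt_nonneg _ _) (wt_nonneg _ _))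
  rw [← sum_mul]
  exact mul_le_of_le_one_left (ind_nonneg _) (sum_dens_le _ _ _ _)

lemma ind_not_regCell_le (η : ℝ) (X : CellIx ι κ) : ind (¬ RegCell q c η X) ≤
    ind (¬ RegPair q c η X.1.1 X.1.2.1) + ind (¬ RegPair q c η X.1.1 X.1.2.2) +
      ind (¬ RegPair q c η X.1.2.1 X.1.2.2) := by
  refine (ind_mono (q := (¬ RegPair q c η X.1.1 X.1.2.1 ∨ ¬ RegPair q c η X.1.1 X.1.2.2) ∨
    ¬ RegPair q c η X.1.2.1 X.1.2.2) fun h => ?_).trans ((ind_or_le _ _).trans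
      (add_le_add_left (ind_or_le _ _) _))
  unfold RegCell at h
  tauto

lemma sum_cellM_irreg_le (hτ : ∀ α, τ (τ α) = α) (hc : ∀ x y, c y x = τ (c x y)) (η : ℝ) :
    ∑ X : CellIx ι κ, cellM q c X * ind (¬ RegCell q c η X) ≤ 3 * irregMass q c η := by
  have h : ∀ X : CellIx ι κ, cellM q c X * ind (¬ RegCell q c η X) ≤
      cellM q c X * ind (¬ RegPair q c η X.1.1 X.1.2.1) +
        cellM q c X * ind (¬ RegPair q c η X.1.1 X.1.2.2) +
        cellM q c X * ind (¬ RegPair q c η X.1.2.1 X.1.2.2) := fun X => by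
    rw [← mul_add, ← mul_add]
    exact mul_le_mul_of_nonneg_left (ind_not_regCell_le η X) (cellM_nonneg X)
  refine (sum_le_sum fun X _ => h X).trans ?_
  rw [sum_add_distrib, sum_add_distrib]
  have h1 := sum_cellM_mul_le (q := q) (c := c) (fun i j _ => ind (¬ RegPair q c η i j))
    fun _ _ _ => ind_nonneg _
  have h2 := sum_cellM_mul_le₂ (q := q) hτ hc (fun i j _ => ind (¬ RegPair q c η i j))
    fun _ _ _ => ind_nonneg _
  have h3 := sum_cellM_mul_le₃ (q := q) hτ hc (fun i j _ => ind (¬ RegPair q c η i j))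
    fun _ _ _ => ind_nonneg _
  have := sum_irreg_le (q := q) (c := c) η
  linarith

lemma sum_cellE_irreg_le (η : ℝ) : ∑ X : CellIx ι κ, cellE q c (fun _ => 1) X *
    ind (¬ RegCell q c η X) ≤ 3 * irregMass q c η := by
  rw [sum_cellE_mul]
  have h : ∀ ω : V × V × V, 1 * ind (¬ RegCell q c η (cell q c ω)) ≤
      ind (¬ RegPair q c η (q ω.1) (q ω.2.1)) + ind (¬ RegPair q c η (q ω.1) (q ω.2.2)) +
        ind (¬ RegPair q c η (q ω.2.1) (q ω.2.2)) := fun ω => by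
    rw [one_mul]; exact ind_not_regCell_le η (cell q c ω)
  refine (expect_mono h).trans ?_
  have e : ∀ g : ι → ι → ℝ, 𝔼 x, 𝔼 y, g (q x) (q y) = ∑ i, ∑ j, wt q i * wt q j * g i j := by
    intro g
    simp only [← wt_mul_wt, expect_mul, ← expect_sum]
    refine expect_congr rfl fun x _ => expect_congr rfl fun y _ => ?_
    rw [← sum_ind_eq (q x) fun i => g i (q y)]
    refine sum_congr rfl fun i _ => ?_
    rw [← sum_ind_eq (q y) (g i), mul_sum]
    exact sum_congr rfl fun j _ => by ring
  have e' := e fun i j => ind (¬ RegPair q c η i j)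
  rw [expect_triple]
  simp only [expect_add_distrib, Fintype.expect_const]
  rw [e']
  unfold irregMass
  linarith

lemma sum_cellW : ∑ X : CellIx ι κ, cellW q X = (Fintype.card κ : ℝ) ^ 3 := by
  rw [sum_cell]
  simp only [cellW, sum_const, card_univ, nsmul_eq_mul, ← mul_sum, sum_wt, mul_one]
  ring

/-- The cells of a regular partition have nearly the expected masses. -/
lemma sum_abs_cellE_one_sub_le (hτ : ∀ α, τ (τ α) = α) (hc : ∀ x y, c y x = τ (c x y)) {η : ℝ}
    (hη : 0 ≤ η) : ∑ X : CellIx ι κ, |cellE q c (fun _ => 1) X - cellM q c X| ≤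
      3 * η * (Fintype.card κ : ℝ) ^ 3 + 6 * irregMass q c η := by
  have h : ∀ X : CellIx ι κ, |cellE q c (fun _ => 1) X - cellM q c X| ≤ 3 * η * cellW q X +
      (cellM q c X * ind (¬ RegCell q c η X) +
        cellE q c (fun _ => 1) X * ind (¬ RegCell q c η X)) := by
    intro X
    have hm := cellM_nonneg (q := q) (c := c) X
    have hE := cellE_nonneg (q := q) (c := c) (g := fun _ => 1) (fun _ => zero_le_one) X
    have hW := cellW_nonneg (q := q) X
    by_cases hX : RegCell q c η X
    · have := abs_cellE_one_sub_le hX.1 hX.2.1 hX.2.2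
      rw [ind_false (not_not.2 hX)]
      linarith
    · rw [ind_true hX, mul_one, mul_one, abs_le]
      constructor <;> nlinarith [mul_nonneg hη hW]
  refine (sum_le_sum fun X _ => h X).trans ?_
  rw [sum_add_distrib, sum_add_distrib, ← mul_sum, sum_cellW]
  have h1 := sum_cellM_irreg_le (q := q) hτ hc η
  have h2 := sum_cellE_irreg_le (q := q) (c := c) η
  linarith

end Mass

section Merge
variable {κ Λ : Type} [Fintype κ]

/-- The averaging kernel of a weight over the classes of a map. -/
noncomputable def avgKer (a : κ → ℝ) (C : κ → Λ) (s : Λ) (x : κ) : ℝ :=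
  ind (C x = s) * a x / ∑ y, ind (C y = s) * a y

/-- The weight `a x * avgKer a C (C x) y`, which is symmetric in `x` and `y`. -/
noncomputable def avgW (a : κ → ℝ) (C : κ → Λ) (x y : κ) : ℝ := a x * avgKer a C (C x) y

variable {a : κ → ℝ} {C : κ → Λ}

lemma avgKer_nonneg (ha : ∀ x, 0 ≤ a x) (s : Λ) (x : κ) : 0 ≤ avgKer a C s x :=
  div_nonneg (mul_nonneg (ind_nonneg _) (ha _))
    (sum_nonneg fun _ _ => mul_nonneg (ind_nonneg _) (ha _))

lemma sum_avgKer_le (s : Λ) : ∑ x, avgKer a C s x ≤ 1 := by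
  simp only [avgKer, ← sum_div]
  exact div_self_le_one _

lemma avgW_nonneg (ha : ∀ x, 0 ≤ a x) (x y : κ) : 0 ≤ avgW a C x y :=
  mul_nonneg (ha _) (avgKer_nonneg ha _ _)

lemma avgW_symm (x y : κ) : avgW a C x y = avgW a C y x := by
  unfold avgW avgKer
  by_cases h : C x = C y
  · rw [h]; simp; ring
  · have h' : ¬ C y = C x := fun e => h e.symm
    rw [ind_false h, ind_false h']; simp

lemma avgW_eq_zero {x y : κ} (h : C x ≠ C y) : avgW a C x y = 0 := by
  unfold avgW avgKer
  rw [ind_false fun e => h e.symm]; simp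

lemma sum_avgW (ha : ∀ x, 0 ≤ a x) (x : κ) : ∑ y, avgW a C x y = a x := by
  simp only [avgW, avgKer, ← mul_sum, ← sum_div]
  by_cases h : ∑ y, ind (C y = C x) * a y = 0
  · have := (sum_eq_zero_iff_of_nonneg fun y _ => mul_nonneg (ind_nonneg _) (ha y)).1 h x
      (mem_univ _)
    rw [ind_true rfl, one_mul] at this
    rw [this, zero_mul]
  · rw [div_self h, mul_one]

lemma sum_avgW' (ha : ∀ x, 0 ≤ a x) (y : κ) : ∑ x, avgW a C x y = a y := by
  simp only [avgW_symm _ y, sum_avgW ha]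

/-- A function of three variables is close in weighted mean to a function of the classes, if it
changes little when one variable is replaced by a random member of its class. -/
lemma exists_merge {b e : κ → ℝ} (ha : ∀ x, 0 ≤ a x) (hb : ∀ x, 0 ≤ b x) (he : ∀ x, 0 ≤ e x)
    (Ca Cb Ce : κ → Λ) (F : κ → κ → κ → ℝ) (h0 : ∀ x y z, 0 ≤ F x y z)
    (h1 : ∀ x y z, F x y z ≤ 1) : ∃ G : Λ → Λ → Λ → ℝ, (∀ s t u, 0 ≤ G s t u) ∧
      (∀ s t u, G s t u ≤ 1) ∧
      ∑ x, ∑ y, ∑ z, a x * b y * e z * |F x y z - G (Ca x) (Cb y) (Ce z)| ≤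
        ∑ x, ∑ x', avgW a Ca x x' * ∑ y, ∑ z, b y * e z * |F x y z - F x' y z| +
        ∑ y, ∑ y', avgW b Cb y y' * ∑ x, ∑ z, a x * e z * |F x y z - F x y' z| +
        ∑ z, ∑ z', avgW e Ce z z' * ∑ x, ∑ y, a x * b y * |F x y z - F x y z'| := by
  have hka := avgKer_nonneg (C := Ca) ha
  have hkb := avgKer_nonneg (C := Cb) hb
  have hke := avgKer_nonneg (C := Ce) he
  refine ⟨fun s t u => ∑ x, ∑ y, ∑ z, avgKer a Ca s x * avgKer b Cb t y * avgKer e Ce u z *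
    F x y z, fun s t u => ?_, fun s t u => ?_, ?_⟩
  · exact sum_nonneg fun x _ => sum_nonneg fun y _ => sum_nonneg fun z _ =>
      mul_nonneg (mul_nonneg (mul_nonneg (hka _ _) (hkb _ _)) (hke _ _)) (h0 _ _ _)
  · calc _ ≤ ∑ x, ∑ y, ∑ z, avgKer a Ca s x * avgKer b Cb t y * avgKer e Ce u z :=
          sum_le_sum fun x _ => sum_le_sum fun y _ => sum_le_sum fun z _ =>
            mul_le_of_le_one_right (mul_nonneg (mul_nonneg (hka _ _) (hkb _ _)) (hke _ _))
              (h1 _ _ _)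
      _ = (∑ x, avgKer a Ca s x) * (∑ y, avgKer b Cb t y) * ∑ z, avgKer e Ce u z := by
          rw [sum_mul_sum, sum_mul]
          refine sum_congr rfl fun x _ => ?_
          rw [sum_mul_sum]
      _ ≤ 1 := mul_le_one₀ (mul_le_one₀ (sum_avgKer_le _) (sum_nonneg fun _ _ => hkb _ _)
          (sum_avgKer_le _)) (sum_nonneg fun _ _ => hke _ _) (sum_avgKer_le _)
  · have key : ∀ x y z, a x * b y * e z * |F x y z - ∑ x', ∑ y', ∑ z', avgKer a Ca (Ca x) x' *
        avgKer b Cb (Cb y) y' * avgKer e Ce (Ce z) z' * F x' y' z'| ≤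
        ∑ x', ∑ y', ∑ z', avgW a Ca x x' * avgW b Cb y y' * avgW e Ce z z' *
          (|F x y z - F x' y z| + |F x' y z - F x' y' z| + |F x' y' z - F x' y' z'|) := by
      intro x y z
      have e1 : a x * b y * e z * F x y z = ∑ x', ∑ y', ∑ z',
          avgW a Ca x x' * avgW b Cb y y' * avgW e Ce z z' * F x y z := by
        simp only [← sum_mul, ← mul_sum, sum_avgW ha, sum_avgW hb, sum_avgW he]
      have e2 : a x * b y * e z * (∑ x', ∑ y', ∑ z', avgKer a Ca (Ca x) x' *
          avgKer b Cb (Cb y) y' * avgKer e Ce (Ce z) z' * F x' y' z') = ∑ x', ∑ y', ∑ z',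
          avgW a Ca x x' * avgW b Cb y y' * avgW e Ce z z' * F x' y' z' := by
        simp only [mul_sum]
        exact sum_congr rfl fun x' _ => sum_congr rfl fun y' _ => sum_congr rfl fun z' _ => by
          unfold avgW; ring
      have hp : 0 ≤ a x * b y * e z := mul_nonneg (mul_nonneg (ha _) (hb _)) (he _)
      rw [← abs_of_nonneg hp, ← abs_mul, mul_sub, e1, e2]
      simp only [← sum_sub_distrib, ← mul_sub]
      refine (abs_sum_le_sum_abs _ _).trans (sum_le_sum fun x' _ =>
        (abs_sum_le_sum_abs _ _).trans (sum_le_sum fun y' _ =>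
        (abs_sum_le_sum_abs _ _).trans (sum_le_sum fun z' _ => ?_)))
      have hw : 0 ≤ avgW a Ca x x' * avgW b Cb y y' * avgW e Ce z z' :=
        mul_nonneg (mul_nonneg (avgW_nonneg ha _ _) (avgW_nonneg hb _ _)) (avgW_nonneg he _ _)
      rw [abs_mul, abs_of_nonneg hw]
      refine mul_le_mul_of_nonneg_left ?_ hw
      refine (abs_sub_le _ (F x' y' z) _).trans (add_le_add_left (abs_sub_le _ _ _) _)
    refine (sum_le_sum fun x _ => sum_le_sum fun y _ => sum_le_sum fun z _ => key x y z).trans ?_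
    simp only [mul_add, sum_add_distrib]
    refine le_of_eq ?_
    congr 1
    · congr 1
      · refine sum_congr rfl fun x _ => ?_
        have : ∀ y z, ∑ x', ∑ y', ∑ z', avgW a Ca x x' * avgW b Cb y y' * avgW e Ce z z' *
            |F x y z - F x' y z| = ∑ x', avgW a Ca x x' * (b y * e z * |F x y z - F x' y z|) := by
          intro y z
          refine sum_congr rfl fun x' _ => ?_
          simp only [← sum_mul, ← mul_sum, sum_avgW hb, sum_avgW he]
          ring
        simp only [this]
        rw [sum_congr rfl fun y _ => sum_comm, sum_comm]
        simp only [mul_sum]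
      · have : ∀ x y z, ∑ x', ∑ y', ∑ z', avgW a Ca x x' * avgW b Cb y y' * avgW e Ce z z' *
            |F x' y z - F x' y' z| = ∑ y', avgW b Cb y y' * ∑ x', avgW a Ca x x' *
              (e z * |F x' y z - F x' y' z|) := by
          intro x y z
          rw [sum_comm]
          refine sum_congr rfl fun y' _ => ?_
          rw [mul_sum]
          refine sum_congr rfl fun x' _ => ?_
          simp only [← sum_mul, ← mul_sum, sum_avgW he]
          ring
        simp only [this]
        rw [sum_comm]
        refine sum_congr rfl fun y _ => ?_
        have h2 : ∀ y' z, ∑ x, ∑ x', avgW a Ca x x' * (e z * |F x' y z - F x' y' z|) =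
            ∑ x, a x * e z * |F x y z - F x y' z| := by
          intro y' z
          rw [sum_comm]
          simp only [← sum_mul, sum_avgW' ha, mul_assoc]
        rw [sum_congr rfl fun x _ => sum_comm, sum_comm]
        refine sum_congr rfl fun y' _ => ?_
        rw [sum_comm (s := univ (α := κ)) (f := fun x z => _)]
        simp only [← mul_sum, h2]
        rw [sum_comm]
    · have : ∀ x y z, ∑ x', ∑ y', ∑ z', avgW a Ca x x' * avgW b Cb y y' * avgW e Ce z z' *
            |F x' y' z - F x' y' z'| = ∑ z', avgW e Ce z z' * ∑ x', ∑ y', avgW a Ca x x' *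
              avgW b Cb y y' * |F x' y' z - F x' y' z'| := by
          intro x y z
          rw [sum_congr rfl fun x' _ => sum_comm, sum_comm]
          simp only [mul_sum]
          exact sum_congr rfl fun z' _ => sum_congr rfl fun x' _ => sum_congr rfl fun y' _ => by
            ring
      simp only [this]
      rw [sum_congr rfl fun x _ => sum_comm, sum_comm]
      refine sum_congr rfl fun z _ => ?_
      rw [sum_congr rfl fun x _ => sum_comm, sum_comm]
      refine sum_congr rfl fun z' _ => ?_
      simp only [← mul_sum]
      congr 1
      have h3 : ∀ x, ∑ y, ∑ x', ∑ y', avgW a Ca x x' * avgW b Cb y y' *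
          |F x' y' z - F x' y' z'| = ∑ x', avgW a Ca x x' * ∑ y', b y' *
          |F x' y' z - F x' y' z'| := by
        intro x
        rw [sum_comm]
        refine sum_congr rfl fun x' _ => ?_
        rw [sum_comm, mul_sum]
        refine sum_congr rfl fun y' _ => ?_
        simp only [← sum_mul, ← mul_sum, sum_avgW' hb]
        ring
      simp only [h3]
      rw [sum_comm]
      refine sum_congr rfl fun x' _ => ?_
      rw [← sum_mul, sum_avgW' ha, mul_sum]
      exact sum_congr rfl fun y _ => by ring

/-- Few far-apart points: the good points fall into `L` classes of small diameter. -/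
lemma exists_classes {L : ℕ} (hL : 1 ≤ L) (dist : κ → κ → ℝ) (R : ℝ)
    (hself : ∀ x, dist x x ≤ R) (hsymm : ∀ x y, dist x y = dist y x)
    (htri : ∀ x y z, dist x z ≤ dist x y + dist y z) (good : κ → Prop)
    (hfar : ∀ α : Fin (L + 1) → κ, (∀ u, good (α u)) → ∃ u u', u ≠ u' ∧ dist (α u) (α u') ≤ R) :
    ∃ cl : κ → Fin L, ∀ x y, good x → good y → cl x = cl y → dist x y ≤ 2 * R := by
  let P : Finset κ → Prop := fun S => (∀ x ∈ S, good x) ∧ ∀ x ∈ S, ∀ y ∈ S, x ≠ y → R < dist x y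
  obtain ⟨S, hS⟩ : ∃ S, Maximal P S := by
    obtain ⟨S, -, hS⟩ := (Set.toFinite {S | P S}).exists_le_maximal (a := ∅) (by simp [P])
    exact ⟨S, hS⟩
  have hcard : #S ≤ L := by
    by_contra h
    obtain ⟨T, hTS, hT⟩ := exists_subset_card_eq (show L + 1 ≤ #S by omega)
    let f := T.equivFinOfCardEq hT
    obtain ⟨u, u', huu, hd⟩ := hfar (fun u => (f.symm u : κ))
      fun u => hS.prop.1 _ (hTS (f.symm u).2)
    refine absurd (hS.prop.2 _ (hTS (f.symm u).2) _ (hTS (f.symm u').2) fun h => huu ?_)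
      (not_lt.2 hd)
    exact f.symm.injective (Subtype.ext h)
  have hnear : ∀ x, good x → ∃ y ∈ S, dist x y ≤ R := by
    intro x hx
    by_contra! h
    have hxS : x ∉ S := fun hm => absurd (h x hm) (not_lt.2 (hself x))
    have : P (insert x S) := by
      refine ⟨fun y hy => ?_, fun y hy z hz hne => ?_⟩
      · rcases mem_insert.1 hy with rfl | hy
        exacts [hx, hS.prop.1 _ hy]
      · rcases mem_insert.1 hy with hyx | hyS <;> rcases mem_insert.1 hz with hzx | hzS
        · exact absurd (hyx.trans hzx.symm) hne
        · rw [hyx]; exact h _ hzS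
        · rw [hzx, hsymm]; exact h _ hyS
        · exact hS.prop.2 _ hyS _ hzS hne
    exact hxS (hS.le_of_ge this (subset_insert _ _) (mem_insert_self _ _))
  choose! near hmem hdist using hnear
  have : ∃ g : κ → Fin L, ∀ x ∈ S, ∀ y ∈ S, g x = g y → x = y := by
    let f := S.equivFin
    refine ⟨fun x => if h : x ∈ S then Fin.castLE hcard (f ⟨x, h⟩) else ⟨0, hL⟩,
      fun x hx y hy h => ?_⟩
    simp only [hx, hy, dif_pos] at h
    exact congrArg Subtype.val (f.injective (Fin.castLE_injective _ h))
  obtain ⟨g, hg⟩ := this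
  refine ⟨fun x => g (near x), fun x y hx hy h => ?_⟩
  have hn := hg _ (hmem x hx) _ (hmem y hy) h
  have h1 := hdist x hx
  have h2 := hdist y hy
  have h3 := htri x (near x) y
  rw [hsymm y, ← hn] at h2
  linarith

end Merge

/-- A cell on which all the hypotheses of the embedding theorem hold. -/
structure GoodCell {V ι κ : Type} [Fintype V] (q : V → ι) (c : V → V → κ) (f₁ : V × V × V → ℝ)
    (D : CellIx ι κ → ℝ) (η δ ω ε' : ℝ) (X : CellIx ι κ) : Prop where
  reg : RegCell q c η X
  wt₁ : ω ≤ wt q X.1.1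
  wt₂ : ω ≤ wt q X.1.2.1
  wt₃ : ω ≤ wt q X.1.2.2
  dens₁ : δ ≤ dens q c X.1.1 X.1.2.1 X.2.1
  dens₂ : δ ≤ dens q c X.1.1 X.1.2.2 X.2.2.1
  dens₃ : δ ≤ dens q c X.1.2.1 X.1.2.2 X.2.2.2
  close : cellE q c (fun p => |f₁ p - D X|) X ≤ ε' * cellM q c X

/-- The edge relation of a 3-graph on triples of vertices. -/
def edgeRel (H : ThreeGraph) (p : H.verts × H.verts × H.verts) : Prop :=
  ({(p.1 : ℕ), (p.2.1 : ℕ), (p.2.2 : ℕ)} : Finset ℕ) ∈ H.edges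

/-- The numerical conditions of the embedding theorem. -/
structure EmbParams (K n : ℕ) (μ δ ω ε' η θ : ℝ) : Prop where
  μ_pos : 0 < μ
  μ_le : μ ≤ 1
  δ_pos : 0 < δ
  δ_le : δ ≤ 1
  ω_pos : 0 < ω
  ω_le : ω ≤ 1
  ε_nonneg : 0 ≤ ε'
  η_nonneg : 0 ≤ η
  θ_nonneg : 0 ≤ θ
  ε_small : ε' * (8 * K) ≤ μ ^ K
  η_small : η * (8 * (K * (K + 1))) ≤ μ ^ K * δ ^ K
  θ_small : θ * (8 * K) ≤ μ ^ K * δ ^ K * ω ^ K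
  size : (K : ℝ) ^ 2 < μ ^ K * δ ^ K * ω ^ K / 2 * n

section Blowup
variable {L m : ℕ} {S : Finset (Fin (L + 1) → Bool)}

/-- The side of a vertex of a blowup. -/
def blowRank : BlowVerts m S → ℕ
  | .inl _ => 0
  | .inr (.inl _) => 1
  | .inr (.inr _) => 2

variable {H : ThreeGraph} {ι κ : Type} {q : H.verts → ι} {c : H.verts → H.verts → κ}

/-- The part in which a vertex of a blowup is embedded. -/
def blowPart (i j : ι) (k : (Fin (L + 1) → Bool) → ι) : BlowVerts m S → ι
  | .inl _ => i
  | .inr (.inl _) => j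
  | .inr (.inr (v, _)) => k v

/-- The colour in which a pair of vertices of a blowup is embedded. -/
def blowCol (α : Fin (L + 1) → κ) (β γ : (Fin (L + 1) → Bool) → κ)
    (col : Fin m → Fin m → Fin (L + 1)) (e : BlowVerts m S × BlowVerts m S) : κ :=
  match e with
  | (.inl a, .inr (.inl b)) => α (col a b)
  | (.inl _, .inr (.inr (v, _))) => β v
  | (.inr (.inl _), .inr (.inr (v, _))) => γ v
  | _ => α 0

lemma hasBlowup_of_goodCell [Nonempty H.verts] {K₁ : ℕ} {μ δ ω ε' η θ : ℝ}
    (hp : EmbParams (K₁ ^ 3) (Fintype.card H.verts) μ δ ω ε' η θ) (hK₁ : 1 ≤ K₁)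
    (hK : m + (m + #S * m) ≤ K₁)
    {f₁ : H.verts × H.verts × H.verts → ℝ}
    (hu : PairUniform (fun p => ind (edgeRel H p) - f₁ p) θ)
    (h0 : ∀ p, 0 ≤ f₁ p) (h1 : ∀ p, f₁ p ≤ 1) {D : CellIx ι κ → ℝ} (hD0 : ∀ X, 0 ≤ D X)
    (hD1 : ∀ X, D X ≤ 1) (i j : ι) (α : Fin (L + 1) → κ) (k : (Fin (L + 1) → Bool) → ι)
    (β γ : (Fin (L + 1) → Bool) → κ) (hS : S.Nonempty)
    (hgood : ∀ u, ∀ v ∈ S, GoodCell q c f₁ D η δ ω ε' ((i, j, k v), (α u, β v, γ v)))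
    (hval : ∀ u, ∀ v ∈ S, μ ≤ sgnVal (v u = true) (D ((i, j, k v), (α u, β v, γ v))))
    (col : Fin m → Fin m → Fin (L + 1)) : HasBlowup H S col := by
  obtain ⟨v₀, hv₀⟩ := hS
  let sg : BlowVerts m S × BlowVerts m S × BlowVerts m S → Prop := fun n => match n with
    | (.inl a, .inr (.inl b), .inr (.inr (v, _))) => v.1 (col a b) = true
    | _ => True
  let p : BlowVerts m S → ι := blowPart i j k
  let cl : BlowVerts m S × BlowVerts m S → κ := blowCol α β γ col
  let E : Finset (BlowVerts m S × BlowVerts m S) := univ.filter fun e =>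
    blowRank e.1 < blowRank e.2
  let N : Finset (BlowVerts m S × BlowVerts m S × BlowVerts m S) := univ.filter fun n =>
    blowRank n.1 = 0 ∧ blowRank n.2.1 = 1 ∧ blowRank n.2.2 = 2
  have hI : Fintype.card (BlowVerts m S) ≤ K₁ := by
    simpa [BlowVerts] using hK
  have hE2 : ∀ P : BlowVerts m S × BlowVerts m S → Prop,
      (∀ a b, P (.inl a, .inr (.inl b))) →
      (∀ a v r, P (.inl a, .inr (.inr (v, r)))) →
      (∀ b v r, P (.inr (.inl b), .inr (.inr (v, r)))) → ∀ e ∈ E, P e := by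
    rintro P hP1 hP2 hP3 ⟨x, y⟩ he
    simp only [E, mem_filter, mem_univ, true_and] at he
    rcases x with a | b | ⟨v, r⟩ <;> rcases y with a' | b' | ⟨v', r'⟩ <;>
      first
        | exact hP1 _ _
        | exact hP2 _ _ _
        | exact hP3 _ _ _
        | (exfalso; simp [blowRank] at he)
  have hN2 : ∀ P : BlowVerts m S × BlowVerts m S × BlowVerts m S → Prop,
      (∀ a b v r, P (.inl a, .inr (.inl b), .inr (.inr (v, r)))) → ∀ n ∈ N, P n := by
    rintro P hP ⟨x, y, z⟩ hn
    simp only [N, mem_filter, mem_univ, true_and] at hn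
    obtain ⟨hx, hy, hz⟩ := hn
    rcases x with a | b | ⟨v, r⟩ <;> simp [blowRank] at hx
    rcases y with a' | b | ⟨v, r⟩ <;> simp [blowRank] at hy
    rcases z with a' | b' | ⟨v, r⟩ <;> simp [blowRank] at hz
    exact hP _ _ _ _
  have hpow : ∀ n, 1 ≤ n → n ≤ 3 → K₁ ^ n ≤ K₁ ^ 3 := fun n _ hn => Nat.pow_le_pow_right hK₁ hn
  obtain ⟨x, hx, hxN⟩ := exists_embedding (K := K₁ ^ 3) (q := q) (c := c) (p := p) (col := cl)
    hp.μ_pos hp.μ_le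
    hp.δ_pos hp.δ_le hp.ω_pos hp.ω_le hp.ε_nonneg hp.η_nonneg hp.θ_nonneg hp.ε_small hp.η_small
    hp.θ_small hp.size blowRank E N
    (hI.trans (by simpa using hpow 1 le_rfl (by norm_num)))
    ((card_le_univ _).trans (by
      rw [Fintype.card_prod]
      refine (Nat.mul_le_mul hI hI).trans ?_
      rw [← sq]; exact hpow 2 (by norm_num) (by norm_num)))
    ((card_le_univ _).trans (by
      rw [Fintype.card_prod, Fintype.card_prod]
      refine (Nat.mul_le_mul hI (Nat.mul_le_mul hI hI)).trans ?_
      rw [← sq, ← pow_succ']))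
    (fun e he => (mem_filter.1 he).2)
    (fun n hn => by
      obtain ⟨a, b, d⟩ := (mem_filter.1 hn).2
      refine ⟨?_, ?_, ?_⟩ <;> simp only [E, mem_filter, mem_univ, true_and] <;> omega)
    (hE2 _ (fun a b => (hgood 0 v₀ hv₀).reg.1) (fun a v r => (hgood 0 v v.2).reg.2.1)
      (fun b v r => (hgood 0 v v.2).reg.2.2))
    (hE2 _ (fun a b => (hgood _ v₀ hv₀).dens₁) (fun a v r => (hgood 0 v v.2).dens₂)
      (fun b v r => (hgood 0 v v.2).dens₃))
    (fun s => by
      rcases s with a | b | ⟨v, r⟩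
      exacts [(hgood 0 v₀ hv₀).wt₁, (hgood 0 v₀ hv₀).wt₂, (hgood 0 v v.2).wt₃])
    (edgeRel H) hu h0 h1 sg (fun n => D (cellOf p cl n)) (fun _ _ => hD0 _) (fun _ _ => hD1 _)
    (hN2 _ fun a b v r => (hgood _ v v.2).close) (hN2 _ fun a b v r => hval _ v v.2)
  refine ⟨x, hx, fun a b v r => ?_⟩
  exact hxN (.inl a, .inr (.inl b), .inr (.inr (v, r))) (mem_filter.2 ⟨mem_univ _, rfl, rfl, rfl⟩)

end Blowup

section Densities
variable {V ι κ : Type} [Fintype V] {q : V → ι} {c : V → V → κ} {f : V × V × V → ℝ}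

/-- The mean of `f` over a cell. -/
noncomputable def cellMean (q : V → ι) (c : V → V → κ) (f : V × V × V → ℝ) (X : CellIx ι κ) : ℝ :=
  cellE q c f X / cellE q c (fun _ => 1) X

lemma cellMean_nonneg (h0 : ∀ p, 0 ≤ f p) (X : CellIx ι κ) : 0 ≤ cellMean q c f X :=
  div_nonneg (cellE_nonneg h0 X) (cellE_nonneg (fun _ => zero_le_one) X)

lemma cellMean_le_one (h1 : ∀ p, f p ≤ 1) (X : CellIx ι κ) : cellMean q c f X ≤ 1 :=
  div_le_one_of_le₀ (cellE_mono h1 X) (cellE_nonneg (fun _ => zero_le_one) X)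

lemma cellMean_mul (h0 : ∀ p, 0 ≤ f p) (h1 : ∀ p, f p ≤ 1) (X : CellIx ι κ) :
    cellMean q c f X * cellE q c (fun _ => 1) X = cellE q c f X := by
  by_cases h : cellE q c (fun _ => 1) X = 0
  · rw [h, mul_zero]
    exact le_antisymm (cellE_nonneg h0 X) (h ▸ cellE_mono h1 X)
  · exact div_mul_cancel₀ _ h

lemma cellMean_cell [Nonempty V] (ω : V × V × V) :
    cellMean q c f (cell q c ω) = CE (cell q c) f ω := by
  unfold cellMean cellE CE
  simp only [mul_one]
  rw [Fintype.expect_eq_sum_div_card, Fintype.expect_eq_sum_div_card, div_div_div_cancel_right₀]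
  exact_mod_cast Fintype.card_ne_zero

variable {τ : κ → κ} [Nonempty V] [Fintype ι] [Fintype κ]

lemma cellMean_flipYZ (hτ : ∀ α, τ (τ α) = α) (hc : ∀ x y, c y x = τ (c x y))
    (hf : ∀ x y z, f (x, z, y) = f (x, y, z)) (X : CellIx ι κ) :
    cellMean q c f (flipYZ τ X) = cellMean q c f X := by
  rw [cellMean, cellMean, cellE_flipYZ hτ hc hf, cellE_flipYZ hτ hc fun _ _ _ => rfl]

lemma cellMean_flipXY (hτ : ∀ α, τ (τ α) = α) (hc : ∀ x y, c y x = τ (c x y))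
    (hf : ∀ x y z, f (y, x, z) = f (x, y, z)) (X : CellIx ι κ) :
    cellMean q c f (flipXY τ X) = cellMean q c f X := by
  rw [cellMean, cellMean, cellE_flipXY hτ hc hf, cellE_flipXY hτ hc fun _ _ _ => rfl]

lemma sum_wt_small_le (ω : ℝ) :
    ∑ i, wt q i * ind (¬ ω ≤ wt q i) ≤ max ω 0 * Fintype.card ι := by
  rw [mul_comm, ← nsmul_eq_mul, ← card_univ, ← sum_const]
  refine sum_le_sum fun i _ => ?_
  by_cases h : ω ≤ wt q i
  · rw [ind_false (not_not.2 h), mul_zero]; exact le_max_right _ _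
  · rw [ind_true h, mul_one]; exact (not_le.1 h).le.trans (le_max_left _ _)

lemma sum_cellM_bad_le (hτ : ∀ α, τ (τ α) = α) (hc : ∀ x y, c y x = τ (c x y))
    {f₁ : V × V × V → ℝ} {η δ ω ε' κ₀ : ℝ} (hω0 : 0 ≤ ω) (hδ0 : 0 ≤ δ) (hε' : 0 < ε')
    (hirr : irregMass q c η ≤ κ₀) (hω : Fintype.card ι * ω ≤ κ₀) (hδ : Fintype.card κ * δ ≤ κ₀)
    (hcl : 𝔼 p, |f₁ p - CE (cell q c) f p| ≤ ε' * κ₀) :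
    ∑ X : CellIx ι κ, cellM q c X * ind (¬ GoodCell q c f₁ (cellMean q c f) η δ ω ε' X) ≤
      10 * κ₀ := by
  have hw : ∑ i, wt q i * ind (¬ ω ≤ wt q i) ≤ κ₀ := by
    refine (sum_wt_small_le (q := q) ω).trans ?_
    rw [max_eq_left hω0, mul_comm]; exact hω
  have hd : ∀ i j, ∑ α, dens q c i j α * ind (¬ δ ≤ dens q c i j α) ≤ κ₀ := by
    intro i j
    refine le_trans ?_ hδ
    rw [← nsmul_eq_mul, ← card_univ, ← sum_const]
    refine sum_le_sum fun α _ => ?_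
    by_cases h : δ ≤ dens q c i j α
    · rw [ind_false (not_not.2 h), mul_zero]; exact hδ0
    · rw [ind_true h, mul_one]; exact (not_le.1 h).le
  have b1 : ∑ i, ∑ j, wt q i * wt q j * ∑ α, dens q c i j α * ind (¬ ω ≤ wt q i) ≤ κ₀ := by
    refine le_trans (sum_le_sum fun i _ => ?_) hw
    calc _ ≤ ∑ j, wt q i * ind (¬ ω ≤ wt q i) * wt q j := sum_le_sum fun j _ => by
          rw [← sum_mul]
          have := mul_le_of_le_one_left (ind_nonneg (¬ ω ≤ wt q i)) (sum_dens_le q c i j)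
          have := mul_le_mul_of_nonneg_left this (mul_nonneg (wt_nonneg q i) (wt_nonneg q j))
          linarith
      _ = _ := by rw [← mul_sum, sum_wt, mul_one]
  have b2 : ∑ i, ∑ j, wt q i * wt q j * ∑ α, dens q c i j α * ind (¬ ω ≤ wt q j) ≤ κ₀ := by
    rw [sum_comm]
    refine le_trans (sum_le_sum fun j _ => ?_) hw
    calc _ ≤ ∑ i, wt q j * ind (¬ ω ≤ wt q j) * wt q i := sum_le_sum fun i _ => by
          rw [← sum_mul]
          have := mul_le_of_le_one_left (ind_nonneg (¬ ω ≤ wt q j)) (sum_dens_le q c i j)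
          have := mul_le_mul_of_nonneg_left this (mul_nonneg (wt_nonneg q i) (wt_nonneg q j))
          linarith
      _ = _ := by rw [← mul_sum, sum_wt, mul_one]
  have b3 : ∑ i, ∑ j, wt q i * wt q j * ∑ α, dens q c i j α * ind (¬ δ ≤ dens q c i j α) ≤ κ₀ := by
    calc _ ≤ ∑ i, ∑ j, wt q i * wt q j * κ₀ := sum_le_sum fun i _ => sum_le_sum fun j _ =>
          mul_le_mul_of_nonneg_left (hd i j) (mul_nonneg (wt_nonneg q i) (wt_nonneg q j))
      _ = κ₀ := by simp only [← sum_mul, ← mul_sum, sum_wt, mul_one, one_mul]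
  have b4 : ∑ X : CellIx ι κ, cellM q c X * ind (¬ cellE q c (fun p => |f₁ p - cellMean q c f X|) X
      ≤ ε' * cellM q c X) ≤ κ₀ := by
    have h : ∀ X : CellIx ι κ, ε' * (cellM q c X * ind (¬ cellE q c
        (fun p => |f₁ p - cellMean q c f X|) X ≤ ε' * cellM q c X)) ≤
        cellE q c (fun p => |f₁ p - cellMean q c f X|) X := by
      intro X
      by_cases hX : cellE q c (fun p => |f₁ p - cellMean q c f X|) X ≤ ε' * cellM q c X
      · rw [ind_false (not_not.2 hX), mul_zero, mul_zero]
        exact cellE_nonneg (fun _ => abs_nonneg _) X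
      · rw [ind_true hX, mul_one]; exact (not_le.1 hX).le
    have h2 := sum_le_sum fun X (_ : X ∈ univ) => h X
    rw [← mul_sum] at h2
    have h3 : ∑ X : CellIx ι κ, cellE q c (fun p => |f₁ p - cellMean q c f X|) X =
        𝔼 p, |f₁ p - CE (cell q c) f p| := by
      simp only [cellE, ← expect_sum]
      refine expect_congr rfl fun p _ => ?_
      rw [sum_ind_eq (cell q c p) fun X => |f₁ p - cellMean q c f X|, cellMean_cell]
    rw [h3] at h2
    exact le_of_mul_le_mul_left (h2.trans hcl) hε'
  have hind : ∀ X : CellIx ι κ, ind (¬ GoodCell q c f₁ (cellMean q c f) η δ ω ε' X) ≤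
      ind (¬ RegCell q c η X) + ind (¬ ω ≤ wt q X.1.1) + ind (¬ ω ≤ wt q X.1.2.1) +
      ind (¬ ω ≤ wt q X.1.2.2) + ind (¬ δ ≤ dens q c X.1.1 X.1.2.1 X.2.1) +
      ind (¬ δ ≤ dens q c X.1.1 X.1.2.2 X.2.2.1) + ind (¬ δ ≤ dens q c X.1.2.1 X.1.2.2 X.2.2.2) +
      ind (¬ cellE q c (fun p => |f₁ p - cellMean q c f X|) X ≤ ε' * cellM q c X) := by
    intro X
    by_cases hX : GoodCell q c f₁ (cellMean q c f) η δ ω ε' X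
    · rw [ind_false (not_not.2 hX)]
      repeat' apply add_nonneg
      all_goals exact ind_nonneg _
    · have hn := ind_nonneg
      by_contra hcon
      rw [ind_true hX] at hcon
      refine hX ⟨?_, ?_, ?_, ?_, ?_, ?_, ?_, ?_⟩ <;> by_contra hP <;>
        · refine hcon ?_
          rw [ind_true hP]
          have h1 := hn (¬ RegCell q c η X)
          have h2 := hn (¬ ω ≤ wt q X.1.1)
          have h3 := hn (¬ ω ≤ wt q X.1.2.1)
          have h4 := hn (¬ ω ≤ wt q X.1.2.2)
          have h5 := hn (¬ δ ≤ dens q c X.1.1 X.1.2.1 X.2.1)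
          have h6 := hn (¬ δ ≤ dens q c X.1.1 X.1.2.2 X.2.2.1)
          have h7 := hn (¬ δ ≤ dens q c X.1.2.1 X.1.2.2 X.2.2.2)
          have h8 := hn (¬ cellE q c (fun p => |f₁ p - cellMean q c f X|) X ≤ ε' * cellM q c X)
          linarith
  refine (sum_le_sum fun X _ => mul_le_mul_of_nonneg_left (hind X) (cellM_nonneg X)).trans ?_
  simp only [mul_add, sum_add_distrib]
  have s1 := sum_cellM_irreg_le (q := q) hτ hc η
  have s2 := sum_cellM_mul_le (q := q) (c := c) (fun i _ _ => ind (¬ ω ≤ wt q i))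
    fun _ _ _ => ind_nonneg _
  have s3 := sum_cellM_mul_le (q := q) (c := c) (fun _ j _ => ind (¬ ω ≤ wt q j))
    fun _ _ _ => ind_nonneg _
  have s4 := sum_cellM_mul_le₂ (q := q) hτ hc (fun _ j _ => ind (¬ ω ≤ wt q j))
    fun _ _ _ => ind_nonneg _
  have s5 := sum_cellM_mul_le (q := q) (c := c) (fun i j α => ind (¬ δ ≤ dens q c i j α))
    fun _ _ _ => ind_nonneg _
  have s6 := sum_cellM_mul_le₂ (q := q) hτ hc (fun i j α => ind (¬ δ ≤ dens q c i j α))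
    fun _ _ _ => ind_nonneg _
  have s7 := sum_cellM_mul_le₃ (q := q) hτ hc (fun i j α => ind (¬ δ ≤ dens q c i j α))
    fun _ _ _ => ind_nonneg _
  linarith

end Densities

section Colours
variable {V ι κ : Type} [Fintype V] [Nonempty V] [Fintype ι] [Fintype κ] {q : V → ι}
  {c : V → V → κ}

/-- The weighted mean of a function over the cells that contain a given coloured pair. -/
noncomputable def linkSum (q : V → ι) (c : V → V → κ) (i j : ι) (F : ι → κ → κ → ℝ) : ℝ :=
  ∑ k, wt q k * ∑ β, ∑ γ, dens q c i k β * dens q c j k γ * F k β γ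

lemma linkSum_mono {i j : ι} {F G : ι → κ → κ → ℝ} (h : ∀ k β γ, F k β γ ≤ G k β γ) :
    linkSum q c i j F ≤ linkSum q c i j G :=
  sum_le_sum fun k _ => mul_le_mul_of_nonneg_left (sum_le_sum fun β _ => sum_le_sum fun γ _ =>
    mul_le_mul_of_nonneg_left (h k β γ) (mul_nonneg (dens_nonneg _ _ _ _ _)
      (dens_nonneg _ _ _ _ _))) (wt_nonneg _ _)

lemma linkSum_nonneg {i j : ι} {F : ι → κ → κ → ℝ} (h : ∀ k β γ, 0 ≤ F k β γ) :
    0 ≤ linkSum q c i j F :=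
  sum_nonneg fun k _ => mul_nonneg (wt_nonneg _ _) (sum_nonneg fun β _ => sum_nonneg fun γ _ =>
    mul_nonneg (mul_nonneg (dens_nonneg _ _ _ _ _) (dens_nonneg _ _ _ _ _)) (h k β γ))

lemma linkSum_add (i j : ι) (F G : ι → κ → κ → ℝ) :
    linkSum q c i j (fun k β γ => F k β γ + G k β γ) = linkSum q c i j F + linkSum q c i j G := by
  simp only [linkSum, mul_add, sum_add_distrib]

lemma linkSum_sum {U : Type} [Fintype U] (i j : ι) (F : U → ι → κ → κ → ℝ) :
    linkSum q c i j (fun k β γ => ∑ u, F u k β γ) = ∑ u, linkSum q c i j (F u) := by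
  simp only [linkSum]
  symm
  rw [sum_comm]
  refine sum_congr rfl fun k _ => ?_
  rw [← mul_sum, sum_comm]
  congr 1
  refine sum_congr rfl fun β _ => ?_
  rw [sum_comm]
  exact sum_congr rfl fun γ _ => (mul_sum _ _ _).symm

lemma linkSum_le_one {i j : ι} {F : ι → κ → κ → ℝ} (h : ∀ k β γ, F k β γ ≤ 1) :
    linkSum q c i j F ≤ 1 := by
  refine (linkSum_mono h).trans ?_
  refine le_trans (sum_le_sum fun k _ => ?_) (sum_wt q).le
  refine mul_le_of_le_one_right (wt_nonneg _ _) ?_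
  simp only [mul_one]
  rw [← sum_mul_sum]
  exact mul_le_one₀ (sum_dens_le _ _ _ _) (sum_nonneg fun _ _ => dens_nonneg _ _ _ _ _)
    (sum_dens_le _ _ _ _)

lemma sum_cellM_eq_linkSum (F : CellIx ι κ → ℝ) :
    ∑ X, cellM q c X * F X = ∑ i, ∑ j, wt q i * wt q j * ∑ α, dens q c i j α *
      linkSum q c i j fun k β γ => F ((i, j, k), (α, β, γ)) := by
  rw [sum_cell]
  refine sum_congr rfl fun i _ => sum_congr rfl fun j _ => ?_
  rw [sum_comm, mul_sum]
  refine sum_congr rfl fun α _ => ?_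
  simp only [linkSum, mul_sum]
  exact sum_congr rfl fun k _ => sum_congr rfl fun β _ => sum_congr rfl fun γ _ => by
    simp only [cellM, cellW, cellD]; ring

end Colours

section MergeCells
variable {V ι κ Λ : Type} [Fintype V] [Nonempty V] [Fintype ι] [Fintype κ] {q : V → ι}
  {c : V → V → κ} {τ : κ → κ}

/-- The mean change of `F` when the first colour of a cell is replaced. -/
noncomputable def colDist (q : V → ι) (c : V → V → κ) (F : CellIx ι κ → ℝ) (i j : ι)
    (α α' : κ) : ℝ :=
  linkSum q c i j fun k β γ => |F ((i, j, k), (α, β, γ)) - F ((i, j, k), (α', β, γ))|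

lemma colDist_self (F : CellIx ι κ → ℝ) (i j : ι) (α : κ) : colDist q c F i j α α = 0 := by
  simp [colDist, linkSum]

lemma colDist_symm (F : CellIx ι κ → ℝ) (i j : ι) (α α' : κ) :
    colDist q c F i j α α' = colDist q c F i j α' α := by
  simp only [colDist, abs_sub_comm]

lemma colDist_triangle (F : CellIx ι κ → ℝ) (i j : ι) (α β γ : κ) :
    colDist q c F i j α γ ≤ colDist q c F i j α β + colDist q c F i j β γ := by
  simp only [colDist]
  rw [← linkSum_add]
  exact linkSum_mono fun k _ _ => abs_sub_le _ _ _

lemma colDist_le_one {F : CellIx ι κ → ℝ} (h0 : ∀ X, 0 ≤ F X) (h1 : ∀ X, F X ≤ 1) (i j : ι)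
    (α α' : κ) : colDist q c F i j α α' ≤ 1 :=
  linkSum_le_one fun _ _ _ => abs_sub_le_of_nonneg_of_le (h0 _) (h1 _) (h0 _) (h1 _)

lemma colDist_eq₂ (hτ : ∀ α, τ (τ α) = α) (hc : ∀ x y, c y x = τ (c x y)) {F : CellIx ι κ → ℝ}
    (hYZ : ∀ X, F (flipYZ τ X) = F X) (i k : ι) (β β' : κ) :
    ∑ j, wt q j * ∑ α, ∑ γ, dens q c i j α * dens q c j k γ *
      |F ((i, j, k), (α, β, γ)) - F ((i, j, k), (α, β', γ))| = colDist q c F i k β β' := by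
  refine sum_congr rfl fun j _ => congrArg _ (sum_congr rfl fun α _ => ?_)
  refine Fintype.sum_bijective τ (Function.Involutive.bijective hτ) _ _ fun γ => ?_
  rw [dens_swap hτ hc, ← hYZ ((i, j, k), (α, β, γ)), ← hYZ ((i, j, k), (α, β', γ))]
  rfl

lemma colDist_eq₃ (hτ : ∀ α, τ (τ α) = α) (hc : ∀ x y, c y x = τ (c x y)) {F : CellIx ι κ → ℝ}
    (hYZ : ∀ X, F (flipYZ τ X) = F X) (hXY : ∀ X, F (flipXY τ X) = F X) (j k : ι) (γ γ' : κ) :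
    ∑ i, wt q i * ∑ α, ∑ β, dens q c i j α * dens q c i k β *
      |F ((i, j, k), (α, β, γ)) - F ((i, j, k), (α, β, γ'))| = colDist q c F j k γ γ' := by
  refine sum_congr rfl fun i _ => congrArg _ ?_
  refine Fintype.sum_bijective τ (Function.Involutive.bijective hτ) _ _ fun α => ?_
  refine Fintype.sum_bijective τ (Function.Involutive.bijective hτ) _ _ fun β => ?_
  rw [dens_swap hτ hc, dens_swap hτ hc, ← hXY ((i, j, k), (α, β, γ)),
    ← hXY ((i, j, k), (α, β, γ')), ← hYZ (flipXY τ _), ← hYZ (flipXY τ ((i, j, k), (α, β, γ')))]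
  rfl

/-- If colours of one class are mostly close, then a function on the cells is close in mean to a
function of the classes of the colours. -/
lemma exists_merge_cells (hτ : ∀ α, τ (τ α) = α) (hc : ∀ x y, c y x = τ (c x y))
    {F : CellIx ι κ → ℝ} (h0 : ∀ X, 0 ≤ F X) (h1 : ∀ X, F X ≤ 1)
    (hYZ : ∀ X, F (flipYZ τ X) = F X) (hXY : ∀ X, F (flipXY τ X) = F X)
    (good : ι → ι → κ → Prop) (cl : ι → ι → κ → Λ) {R B : ℝ} (hR : 0 ≤ R)
    (hcl : ∀ i j α α', good i j α → good i j α' → cl i j α = cl i j α' →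
      colDist q c F i j α α' ≤ R)
    (hB : ∑ i, ∑ j, wt q i * wt q j * ∑ α, dens q c i j α * ind (¬ good i j α) ≤ B) :
    ∃ g : CellIx ι Λ → ℝ, (∀ Y, 0 ≤ g Y) ∧ (∀ Y, g Y ≤ 1) ∧
      ∑ X : CellIx ι κ, cellM q c X * |F X - g (X.1, (cl X.1.1 X.1.2.1 X.2.1,
        cl X.1.1 X.1.2.2 X.2.2.1, cl X.1.2.1 X.1.2.2 X.2.2.2))| ≤ 3 * (R + 2 * B) := by
  have hd := fun i j α => dens_nonneg q c i j α
  have hw := wt_nonneg q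
  let T : ι → ι → ℝ := fun i j => ∑ α, ∑ α', avgW (dens q c i j) (cl i j) α α' *
    colDist q c F i j α α'
  have hT : ∀ i j, T i j ≤ R + 2 * ∑ α, dens q c i j α * ind (¬ good i j α) := by
    intro i j
    calc T i j ≤ ∑ α, ∑ α', (avgW (dens q c i j) (cl i j) α α' * R +
          avgW (dens q c i j) (cl i j) α α' * ind (¬ good i j α) +
          avgW (dens q c i j) (cl i j) α α' * ind (¬ good i j α')) := by
          refine sum_le_sum fun α _ => sum_le_sum fun α' _ => ?_
          by_cases hs : cl i j α = cl i j α'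
          · rw [← mul_add, ← mul_add]
            refine mul_le_mul_of_nonneg_left ?_ (avgW_nonneg (hd i j) _ _)
            have hle := colDist_le_one (q := q) (c := c) h0 h1 i j α α'
            have i1 := ind_nonneg (¬ good i j α)
            have i2 := ind_nonneg (¬ good i j α')
            by_cases hg : good i j α
            · by_cases hg' : good i j α'
              · have := hcl i j α α' hg hg' hs
                linarith
              · rw [ind_true hg']; linarith
            · rw [ind_true hg]; linarith
          · rw [avgW_eq_zero hs]; simp
      _ = R * ∑ α, dens q c i j α + 2 * ∑ α, dens q c i j α * ind (¬ good i j α) := by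
          simp only [sum_add_distrib]
          rw [sum_comm (f := fun α α' => avgW (dens q c i j) (cl i j) α α' * ind (¬ good i j α'))]
          simp only [← sum_mul, sum_avgW (hd i j), sum_avgW' (hd i j)]
          ring
      _ ≤ _ := by
          have := mul_le_of_le_one_right hR (sum_dens_le q c i j)
          linarith
  have hQ : ∑ i, ∑ j, wt q i * wt q j * T i j ≤ R + 2 * B := by
    calc _ ≤ ∑ i, ∑ j, (wt q i * wt q j * R +
          2 * (wt q i * wt q j * ∑ α, dens q c i j α * ind (¬ good i j α))) :=
          sum_le_sum fun i _ => sum_le_sum fun j _ => by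
            have := mul_le_mul_of_nonneg_left (hT i j) (mul_nonneg (hw i) (hw j))
            linarith
      _ = R + 2 * ∑ i, ∑ j, wt q i * wt q j * ∑ α, dens q c i j α * ind (¬ good i j α) := by
          simp only [sum_add_distrib, ← mul_sum, ← sum_mul, sum_wt, mul_one, one_mul]
      _ ≤ _ := by linarith
  have hG := fun i j k => exists_merge (hd i j) (hd i k) (hd j k) (cl i j) (cl i k) (cl j k)
    (fun α β γ => F ((i, j, k), (α, β, γ))) (fun _ _ _ => h0 _) (fun _ _ _ => h1 _)
  choose G hG0 hG1 hG using hG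
  refine ⟨fun Y => G Y.1.1 Y.1.2.1 Y.1.2.2 Y.2.1 Y.2.2.1 Y.2.2.2, fun _ => hG0 _ _ _ _ _ _,
    fun _ => hG1 _ _ _ _ _ _, ?_⟩
  have e0 : ∑ X : CellIx ι κ, cellM q c X * |F X - G X.1.1 X.1.2.1 X.1.2.2
      (cl X.1.1 X.1.2.1 X.2.1) (cl X.1.1 X.1.2.2 X.2.2.1) (cl X.1.2.1 X.1.2.2 X.2.2.2)| =
      ∑ i, ∑ j, ∑ k, wt q i * wt q j * wt q k * ∑ α, ∑ β, ∑ γ, dens q c i j α * dens q c i k β *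
        dens q c j k γ * |F ((i, j, k), (α, β, γ)) -
          G i j k (cl i j α) (cl i k β) (cl j k γ)| := by
    rw [sum_cell]
    refine sum_congr rfl fun i _ => sum_congr rfl fun j _ => sum_congr rfl fun k _ => ?_
    simp only [mul_sum]
    exact sum_congr rfl fun α _ => sum_congr rfl fun β _ => sum_congr rfl fun γ _ => by
      simp only [cellM, cellW, cellD]; ring
  refine e0.le.trans ((sum_le_sum fun i _ => sum_le_sum fun j _ => sum_le_sum fun k _ =>
    mul_le_mul_of_nonneg_left (hG i j k) (mul_nonneg (mul_nonneg (hw i) (hw j)) (hw k))).trans ?_)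
  simp only [mul_add, sum_add_distrib]
  have t1 : ∑ i, ∑ j, ∑ k, wt q i * wt q j * wt q k * ∑ α, ∑ α',
      avgW (dens q c i j) (cl i j) α α' * ∑ β, ∑ γ, dens q c i k β * dens q c j k γ *
        |F ((i, j, k), (α, β, γ)) - F ((i, j, k), (α', β, γ))| =
      ∑ i, ∑ j, wt q i * wt q j * T i j := by
    refine sum_congr rfl fun i _ => sum_congr rfl fun j _ => ?_
    simp only [mul_assoc, ← mul_sum]
    congr 2
    simp only [mul_sum (s := (univ : Finset κ)), T]
    rw [sum_comm]
    refine sum_congr rfl fun α _ => ?_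
    rw [sum_comm]
    refine sum_congr rfl fun α' _ => ?_
    simp only [colDist, linkSum, mul_sum]
    exact sum_congr rfl fun k _ => sum_congr rfl fun β _ => sum_congr rfl fun γ _ => by ring
  have t2 : ∑ i, ∑ j, ∑ k, wt q i * wt q j * wt q k * ∑ β, ∑ β',
      avgW (dens q c i k) (cl i k) β β' * ∑ α, ∑ γ, dens q c i j α * dens q c j k γ *
        |F ((i, j, k), (α, β, γ)) - F ((i, j, k), (α, β', γ))| =
      ∑ i, ∑ j, wt q i * wt q j * T i j := by
    refine sum_congr rfl fun i _ => ?_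
    rw [sum_comm]
    refine sum_congr rfl fun k _ => ?_
    have : ∀ j x, wt q i * wt q j * wt q k * x = wt q i * wt q k * (wt q j * x) := fun j x => by
      ring
    simp only [this, ← mul_sum]
    congr 1
    simp only [mul_sum (s := (univ : Finset κ)), T]
    rw [sum_comm]
    refine sum_congr rfl fun β _ => ?_
    rw [sum_comm]
    refine sum_congr rfl fun β' _ => ?_
    rw [← colDist_eq₂ hτ hc hYZ]
    simp only [mul_sum]
    exact sum_congr rfl fun k _ => sum_congr rfl fun β _ => sum_congr rfl fun γ _ => by ring
  have t3 : ∑ i, ∑ j, ∑ k, wt q i * wt q j * wt q k * ∑ γ, ∑ γ',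
      avgW (dens q c j k) (cl j k) γ γ' * ∑ α, ∑ β, dens q c i j α * dens q c i k β *
        |F ((i, j, k), (α, β, γ)) - F ((i, j, k), (α, β, γ'))| =
      ∑ i, ∑ j, wt q i * wt q j * T i j := by
    rw [sum_comm]
    refine sum_congr rfl fun j _ => ?_
    rw [sum_comm]
    refine sum_congr rfl fun k _ => ?_
    have : ∀ i x, wt q i * wt q j * wt q k * x = wt q j * wt q k * (wt q i * x) := fun j x => by
      ring
    simp only [this, ← mul_sum]
    congr 1
    simp only [mul_sum (s := (univ : Finset κ)), T]
    rw [sum_comm]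
    refine sum_congr rfl fun γ _ => ?_
    rw [sum_comm]
    refine sum_congr rfl fun γ' _ => ?_
    rw [← colDist_eq₃ hτ hc hYZ hXY]
    simp only [mul_sum]
    exact sum_congr rfl fun k _ => sum_congr rfl fun β _ => sum_congr rfl fun γ _ => by ring
  rw [t1, t2, t3]
  linarith

end MergeCells

/-- The indicator function of the edges. -/
noncomputable def edgeFn (H : ThreeGraph) (p : H.verts × H.verts × H.verts) : ℝ :=
  ind (edgeRel H p)

lemma edgeFn_swapYZ (H : ThreeGraph) (x y z : H.verts) :
    edgeFn H (x, z, y) = edgeFn H (x, y, z) := by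
  unfold edgeFn edgeRel
  simp only [pair_comm]

lemma edgeFn_swapXY (H : ThreeGraph) (x y z : H.verts) :
    edgeFn H (y, x, z) = edgeFn H (x, y, z) := by
  unfold edgeFn edgeRel
  exact ind_congr (by rw [Finset.insert_comm])

section Cluster
variable {L M K₁ : ℕ} {H : ThreeGraph} {ι κ : Type}
  {q : H.verts → ι} {c : H.verts → H.verts → κ} {f₁ : H.verts × H.verts × H.verts → ℝ}
  {μ δ ω ε' η θ : ℝ}

/-- The cell density rounded to `0` or `1`. -/
noncomputable def cellVal (q : H.verts → ι) (c : H.verts → H.verts → κ) (X : CellIx ι κ) : ℝ :=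
  ind (1 / 2 ≤ cellMean q c (edgeFn H) X)

/-- The standing assumptions: the embedding theorem applies and blowups are missing. -/
structure ClusterHyp (L M K₁ : ℕ) (H : ThreeGraph) (f₁ : H.verts × H.verts × H.verts → ℝ)
    (μ δ ω ε' η θ : ℝ) : Prop where
  L_pos : 1 ≤ L
  missing : ∀ S : Finset (Fin (L + 1) → Bool), (∀ u u', u ≠ u' → ∃ v ∈ S, v u ≠ v u') →
    ∃ m ≤ M, ∃ col : Fin m → Fin m → Fin (L + 1), ¬ HasBlowup H S col
  params : EmbParams (K₁ ^ 3) (Fintype.card H.verts) μ δ ω ε' η θ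
  K_large : M + (M + 2 ^ (L + 1) * M) + 1 ≤ K₁
  μ_half : μ ≤ 1 / 2
  unif : PairUniform (fun p => edgeFn H p - f₁ p) θ
  f_nonneg : ∀ p, 0 ≤ f₁ p
  f_le : ∀ p, f₁ p ≤ 1

variable [Nonempty H.verts]

lemma edgeFn_nonneg (p : H.verts × H.verts × H.verts) : 0 ≤ edgeFn H p := ind_nonneg _

lemma edgeFn_le_one (p : H.verts × H.verts × H.verts) : edgeFn H p ≤ 1 := ind_le_one _

lemma ClusterHyp.false_of_pattern (h : ClusterHyp L M K₁ H f₁ μ δ ω ε' η θ)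
    (S : Finset (Fin (L + 1) → Bool)) (hS : ∀ u u', u ≠ u' → ∃ v ∈ S, v u ≠ v u')
    (i j : ι) (α : Fin (L + 1) → κ) (k : (Fin (L + 1) → Bool) → ι)
    (β γ : (Fin (L + 1) → Bool) → κ)
    (hgood : ∀ u, ∀ v ∈ S, GoodCell q c f₁ (cellMean q c (edgeFn H)) η δ ω ε'
      ((i, j, k v), (α u, β v, γ v)))
    (hval : ∀ u, ∀ v ∈ S, μ ≤ sgnVal (v u = true)
      (cellMean q c (edgeFn H) ((i, j, k v), (α u, β v, γ v)))) : False := by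
  obtain ⟨m, hm, col, hcol⟩ := h.missing S hS
  have hne : S.Nonempty := by
    have := h.L_pos
    obtain ⟨v, hv, -⟩ := hS ⟨0, by omega⟩ ⟨1, by omega⟩ (by simp)
    exact ⟨v, hv⟩
  have hcard : #S ≤ 2 ^ (L + 1) := by
    refine (card_le_univ S).trans ?_
    simp
  have hK := h.K_large
  refine hcol (hasBlowup_of_goodCell h.params (by omega) ?_ h.unif h.f_nonneg h.f_le
    (cellMean_nonneg edgeFn_nonneg) (cellMean_le_one edgeFn_le_one) i j α k β γ hne hgood hval col)
  have := Nat.mul_le_mul hcard hm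
  omega

lemma ClusterHyp.dichotomy (h : ClusterHyp L M K₁ H f₁ μ δ ω ε' η θ) (X : CellIx ι κ)
    (hX : GoodCell q c f₁ (cellMean q c (edgeFn H)) η δ ω ε' X) :
    cellMean q c (edgeFn H) X < μ ∨ 1 - μ < cellMean q c (edgeFn H) X := by
  by_contra! hcon
  obtain ⟨⟨i, j, k⟩, ⟨α, β, γ⟩⟩ := X
  refine h.false_of_pattern univ (fun u u' huu => ⟨fun w => decide (w = u), mem_univ _, ?_⟩) i j
    (fun _ => α) (fun _ => k) (fun _ => β) (fun _ => γ) (fun _ _ _ => hX) fun u v _ => ?_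
  · simp [huu.symm]
  · unfold sgnVal
    split_ifs
    · exact hcon.1
    · linarith [hcon.2]

variable [Fintype ι] [Fintype κ]

lemma ClusterHyp.exists_near (h : ClusterHyp L M K₁ H f₁ μ δ ω ε' η θ) {ζ : ℝ} (i j : ι)
    (α : Fin (L + 1) → κ) (hα : ∀ u, linkSum q c i j (fun k β γ => ind (¬ GoodCell q c f₁
      (cellMean q c (edgeFn H)) η δ ω ε' ((i, j, k), (α u, β, γ)))) ≤ ζ) :
    ∃ u u', u ≠ u' ∧ colDist q c (cellVal q c) i j (α u) (α u') ≤ (L + 1) * ζ := by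
  by_contra! hcon
  have key : ∀ u u', u ≠ u' → ∃ k β γ, (∀ w, GoodCell q c f₁
      (cellMean q c (edgeFn H)) η δ ω ε' ((i, j, k), (α w, β, γ))) ∧
      cellVal q c ((i, j, k), (α u, β, γ)) ≠ cellVal q c ((i, j, k), (α u', β, γ)) := by
    intro u u' huu
    by_contra! hno
    refine absurd (hcon u u' huu) (not_lt.2 ?_)
    have hle : colDist q c (cellVal q c) i j (α u) (α u') ≤
        linkSum q c i j fun k β γ => ∑ w, ind (¬ GoodCell q c f₁
          (cellMean q c (edgeFn H)) η δ ω ε' ((i, j, k), (α w, β, γ))) := by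
      refine linkSum_mono fun k β γ => ?_
      by_cases hg : ∀ w, GoodCell q c f₁
          (cellMean q c (edgeFn H)) η δ ω ε' ((i, j, k), (α w, β, γ))
      · rw [hno k β γ hg, sub_self, abs_zero]
        exact sum_nonneg fun _ _ => ind_nonneg _
      · push Not at hg
        obtain ⟨w, hw⟩ := hg
        refine (abs_sub_le_of_nonneg_of_le (ind_nonneg _) (ind_le_one _) (ind_nonneg _)
          (ind_le_one _)).trans ?_
        refine le_trans (ind_true hw).ge (single_le_sum (f := fun w => ind (¬ GoodCell q c f₁
          (cellMean q c (edgeFn H)) η δ ω ε' ((i, j, k), (α w, β, γ))))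
          (fun _ _ => ind_nonneg _) (mem_univ w))
    refine hle.trans ?_
    rw [linkSum_sum]
    refine (sum_le_sum fun w _ => hα w).trans ?_
    simp
  let pat : ι × κ × κ → Fin (L + 1) → Bool := fun t u =>
    decide (1 / 2 ≤ cellMean q c (edgeFn H) ((i, j, t.1), (α u, t.2.1, t.2.2)))
  let S : Finset (Fin (L + 1) → Bool) := univ.filter fun v => ∃ t, pat t = v ∧ ∀ w,
    GoodCell q c f₁ (cellMean q c (edgeFn H)) η δ ω ε' ((i, j, t.1), (α w, t.2.1, t.2.2))
  obtain ⟨k₀, β₀, γ₀, -⟩ := key ⟨0, by omega⟩ ⟨1, by have := h.L_pos; omega⟩ (by simp)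
  have : Nonempty (ι × κ × κ) := ⟨(k₀, β₀, γ₀)⟩
  have hS : ∀ v ∈ S, ∃ t, pat t = v ∧ ∀ w, GoodCell q c f₁ (cellMean q c (edgeFn H)) η δ ω ε'
      ((i, j, t.1), (α w, t.2.1, t.2.2)) := fun v hv => (mem_filter.1 hv).2
  choose! t ht htg using hS
  refine h.false_of_pattern S (fun u u' huu => ?_) i j α (fun v => (t v).1) (fun v => (t v).2.1)
    (fun v => (t v).2.2) (fun u v hv => htg v hv u) fun u v hv => ?_
  · obtain ⟨k, β, γ, hg, hne⟩ := key u u' huu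
    refine ⟨pat (k, β, γ), mem_filter.2 ⟨mem_univ _, _, rfl, hg⟩, fun he => hne ?_⟩
    simp only [pat, decide_eq_decide] at he
    exact ind_congr he
  · have hv' := congrFun (ht v hv) u
    have hμ := h.μ_half
    unfold sgnVal
    split_ifs with hvu
    · rw [hvu] at hv'
      have : 1 / 2 ≤ cellMean q c (edgeFn H) ((i, j, (t v).1), (α u, (t v).2.1, (t v).2.2)) := by
        simpa [pat] using hv'
      linarith
    · have hvf : v u = false := by simpa using hvu
      rw [hvf] at hv'
      have : ¬ 1 / 2 ≤ cellMean q c (edgeFn H) ((i, j, (t v).1), (α u, (t v).2.1, (t v).2.2)) := by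
        simpa [pat] using hv'
      linarith

/-- A partition whose cells are mostly good can be merged to one with `L` colours. -/
lemma ClusterHyp.exists_merged (h : ClusterHyp L M K₁ H f₁ μ δ ω ε' η θ) {τ : κ → κ}
    (hτ : ∀ α, τ (τ α) = α) (hc : ∀ x y, c y x = τ (c x y)) {ζ B TV : ℝ} (hζ : 0 < ζ)
    (hB : ∑ X : CellIx ι κ, cellM q c X * ind (¬ GoodCell q c f₁ (cellMean q c (edgeFn H))
      η δ ω ε' X) ≤ B)
    (hTV : ∑ X : CellIx ι κ, |cellE q c (fun _ => 1) X - cellM q c X| ≤ TV) :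
    ∃ (cl : ι → ι → κ → Fin L) (g : CellIx ι (Fin L) → ℝ),
      𝔼 p, |edgeFn H p - g (cell q (fun x y => cl (q x) (q y) (c x y)) p)| ≤
        μ + B + 3 * (2 * ((L + 1) * ζ) + 2 * (B / ζ)) + 2 * TV := by
  set Good : CellIx ι κ → Prop := GoodCell q c f₁ (cellMean q c (edgeFn H)) η δ ω ε'
  let bad : ι → ι → κ → ℝ := fun i j α =>
    linkSum q c i j fun k β γ => ind (¬ Good ((i, j, k), (α, β, γ)))
  have hcls : ∀ i j, ∃ cl : κ → Fin L, ∀ α α', bad i j α ≤ ζ → bad i j α' ≤ ζ → cl α = cl α' →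
      colDist q c (cellVal q c) i j α α' ≤ 2 * ((L + 1) * ζ) := fun i j =>
    exists_classes h.L_pos (colDist q c (cellVal q c) i j) ((L + 1) * ζ)
      (fun α => by rw [colDist_self]; positivity) (colDist_symm _ i j) (colDist_triangle _ i j)
      (fun α => bad i j α ≤ ζ) fun α hα => h.exists_near i j α hα
  choose cl hcl using hcls
  have hbadmass : ∑ i, ∑ j, wt q i * wt q j * ∑ α, dens q c i j α * ind (¬ bad i j α ≤ ζ) ≤
      B / ζ := by
    rw [le_div_iff₀ hζ]
    refine le_trans ?_ hB
    rw [sum_cellM_eq_linkSum (fun X => ind (¬ Good X))]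
    simp only [sum_mul]
    refine sum_le_sum fun i _ => sum_le_sum fun j _ => ?_
    rw [mul_assoc]
    refine mul_le_mul_of_nonneg_left ?_ (mul_nonneg (wt_nonneg _ _) (wt_nonneg _ _))
    rw [sum_mul]
    refine sum_le_sum fun α _ => ?_
    rw [mul_assoc]
    refine mul_le_mul_of_nonneg_left ?_ (dens_nonneg _ _ _ _ _)
    by_cases hb : bad i j α ≤ ζ
    · rw [ind_false (not_not.2 hb), zero_mul]
      exact linkSum_nonneg fun _ _ _ => ind_nonneg _
    · rw [ind_true hb, one_mul]; exact (not_le.1 hb).le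
  obtain ⟨g, hg0, hg1, hg⟩ := exists_merge_cells (q := q) hτ hc (F := cellVal q c)
    (fun _ => ind_nonneg _)
    (fun _ => ind_le_one _)
    (fun X => by rw [cellVal, cellMean_flipYZ hτ hc (edgeFn_swapYZ H)]; rfl)
    (fun X => by rw [cellVal, cellMean_flipXY hτ hc (edgeFn_swapXY H)]; rfl)
    (fun i j α => bad i j α ≤ ζ) cl (R := 2 * ((L + 1) * ζ)) (by positivity) hcl hbadmass
  refine ⟨cl, g, ?_⟩
  let W : CellIx ι κ → ℝ := fun X => |cellVal q c X - g (X.1, (cl X.1.1 X.1.2.1 X.2.1,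
        cl X.1.1 X.1.2.2 X.2.2.1, cl X.1.2.1 X.1.2.2 X.2.2.2))|
  have hW0 : ∀ X, 0 ≤ W X := fun X => abs_nonneg _
  have hW1 : ∀ X, W X ≤ 1 := fun X =>
    abs_sub_le_of_nonneg_of_le (ind_nonneg _) (ind_le_one _) (hg0 _) (hg1 _)
  have hE1 := fun X => cellE_nonneg (q := q) (c := c) (g := fun _ => 1) (fun _ => zero_le_one) X
  have transfer : ∀ W : CellIx ι κ → ℝ, (∀ X, 0 ≤ W X) → (∀ X, W X ≤ 1) →
      ∑ X, cellE q c (fun _ => 1) X * W X ≤ ∑ X, cellM q c X * W X + TV := by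
    intro W hW0 hW1
    have : ∑ X, cellE q c (fun _ => 1) X * W X ≤ ∑ X, (cellM q c X * W X +
        |cellE q c (fun _ => 1) X - cellM q c X|) := sum_le_sum fun X _ => by
      have h1 := le_abs_self (cellE q c (fun _ => 1) X - cellM q c X)
      have h2 := abs_nonneg (cellE q c (fun _ => 1) X - cellM q c X)
      nlinarith [mul_le_mul_of_nonneg_right h1 (hW0 X), mul_le_mul_of_nonneg_left (hW1 X) h2]
    rw [sum_add_distrib] at this
    linarith
  have hval : 𝔼 p, |edgeFn H p - cellVal q c (cell q c p)| ≤ μ + B + TV := by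
    have e : 𝔼 p, |edgeFn H p - cellVal q c (cell q c p)| =
        ∑ X, cellE q c (fun p => |edgeFn H p - cellVal q c X|) X := by
      simp only [cellE, ← expect_sum]
      refine expect_congr rfl fun p _ => ?_
      rw [sum_ind_eq (cell q c p) fun X => |edgeFn H p - cellVal q c X|]
    rw [e]
    have hX : ∀ X : CellIx ι κ, cellE q c (fun p => |edgeFn H p - cellVal q c X|) X ≤
        μ * cellE q c (fun _ => 1) X + cellE q c (fun _ => 1) X * ind (¬ Good X) := by
      intro X
      by_cases hG : Good X
      · rw [ind_false (not_not.2 hG), mul_zero, add_zero]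
        have hm := cellMean_mul (q := q) (c := c) (edgeFn_nonneg (H := H)) edgeFn_le_one X
        rcases h.dichotomy X hG with hlt | hlt
        · have hv : cellVal q c X = 0 := ind_false (by have := h.μ_half; linarith)
          simp only [hv, sub_zero, abs_of_nonneg (edgeFn_nonneg _)]
          rw [← hm]
          exact mul_le_mul_of_nonneg_right hlt.le (hE1 X)
        · have hv : cellVal q c X = 1 := ind_true (by have := h.μ_half; linarith)
          have e2 : cellE q c (fun p => |edgeFn H p - cellVal q c X|) X =
              cellE q c (fun _ => 1) X - cellE q c (edgeFn H) X := by
            simp only [cellE]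
            rw [← expect_sub_distrib]
            refine expect_congr rfl fun p _ => ?_
            rw [hv, abs_of_nonpos (by linarith [edgeFn_le_one p])]
            ring
          rw [e2, ← hm]
          nlinarith [hE1 X]
      · have hμ := h.params.μ_pos
        rw [ind_true hG, mul_one]
        have h1 : cellE q c (fun p => |edgeFn H p - cellVal q c X|) X ≤
            cellE q c (fun _ => 1) X := cellE_mono (fun p =>
          abs_sub_le_of_nonneg_of_le (edgeFn_nonneg _) (edgeFn_le_one _) (ind_nonneg _)
            (ind_le_one _)) X
        have := mul_nonneg hμ.le (hE1 X)
        linarith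
    refine (sum_le_sum fun X _ => hX X).trans ?_
    rw [sum_add_distrib, ← mul_sum, sum_cellE, Fintype.expect_const, mul_one]
    have := transfer (fun X => ind (¬ Good X)) (fun _ => ind_nonneg _) fun _ => ind_le_one _
    linarith
  have hW : 𝔼 p, W (cell q c p) ≤ 3 * (2 * ((L + 1) * ζ) + 2 * (B / ζ)) + TV := by
    have e := sum_cellE_mul (q := q) (c := c) (fun _ => 1) W
    simp only [one_mul] at e
    rw [← e]
    have := transfer W hW0 hW1
    linarith
  have hfin : 𝔼 p, |edgeFn H p - g (cell q (fun x y => cl (q x) (q y) (c x y)) p)| ≤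
      𝔼 p, (|edgeFn H p - cellVal q c (cell q c p)| + W (cell q c p)) :=
    expect_mono fun p => abs_sub_le _ _ _
  rw [expect_add_distrib] at hfin
  linarith

end Cluster

section Merge
variable {V ι κ κ' : Type} [Fintype V] [Fintype κ] {q : V → ι} {c : V → V → κ}

lemma ind_merge (cl : ι → ι → κ → κ') (i j : ι) (β : κ') (x y : V) :
    ind (q x = i) * ind (q y = j) * ind (cl (q x) (q y) (c x y) = β) =
      ∑ α, ind (cl i j α = β) * (ind (q x = i) * ind (q y = j) * ind (c x y = α)) := by
  by_cases hx : q x = i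
  · by_cases hy : q y = j
    · subst hx hy
      simp [ind]
    · simp [hy]
  · simp [hx]

lemma dens_merge (cl : ι → ι → κ → κ') (i j : ι) (β : κ') :
    dens q (fun x y => cl (q x) (q y) (c x y)) i j β =
      ∑ α, ind (cl i j α = β) * dens q c i j α := by
  simp only [dens, ind_merge, expect_sum, ← mul_expect, sum_div, mul_div_assoc]

lemma regPair_merge (cl : ι → ι → κ → κ') {η : ℝ} {i j : ι}
    (h : RegPair q c η i j) :
    RegPair q (fun x y => cl (q x) (q y) (c x y)) (Fintype.card κ * η) i j := by
  intro β a b ha hb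
  have e : ∀ x y : V, ind (q x = i) * ind (q y = j) * (ind (cl (q x) (q y) (c x y) = β) -
      dens q (fun x y => cl (q x) (q y) (c x y)) i j β) * (a x * b y) =
      ∑ α, ind (cl i j α = β) * (ind (q x = i) * ind (q y = j) *
        (ind (c x y = α) - dens q c i j α) * (a x * b y)) := by
    intro x y
    rw [mul_sub, ind_merge, dens_merge, mul_sum, ← sum_sub_distrib, sum_mul]
    exact sum_congr rfl fun α _ => by ring
  simp only [e, expect_sum, ← mul_expect]
  refine (abs_sum_le_sum_abs _ _).trans ?_
  refine (sum_le_sum (g := fun _ => η * (wt q i * wt q j)) fun α _ => ?_).trans ?_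
  · rw [abs_mul]
    exact (mul_le_of_le_one_left (abs_nonneg _) (abs_ind_le_one _)).trans (h α a b ha hb)
  · simp [mul_assoc]

lemma regPair_mono {c : V → V → κ'} {η η' : ℝ} {i j : ι} (hη : η ≤ η') (h : RegPair q c η i j) :
    RegPair q c η' i j := fun α a b ha hb =>
  (h α a b ha hb).trans (mul_le_mul_of_nonneg_right hη (mul_nonneg (wt_nonneg _ _) (wt_nonneg _ _)))

lemma irregMass_merge_le [Fintype ι] (cl : ι → ι → κ → κ') {η η' : ℝ}
    (h : Fintype.card κ * η ≤ η') :
    irregMass q (fun x y => cl (q x) (q y) (c x y)) η' ≤ irregMass q c η :=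
  sum_le_sum fun _ _ => sum_le_sum fun _ _ => mul_le_mul_of_nonneg_left
    (ind_mono fun hn hr => hn (regPair_mono h (regPair_merge cl hr)))
    (mul_nonneg (wt_nonneg _ _) (wt_nonneg _ _))

end Merge

/-- A 3-graph without large blowups is close to a function of `L` colours of pairs. -/
theorem exists_structured_partition {ℋ : Set ThreeGraph} {L : ℕ} (hL : 1 ≤ L)
    (hub : ∀ K : ℕ, (∃ G : Bigraph, InBH ℋ G ∧ G.left.card = K) → K ≤ L) {η₀ τ₀ : ℝ}
    (hη₀ : 0 < η₀) (hτ₀ : 0 < τ₀) :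
    ∃ M n₀ : ℕ, 1 ≤ n₀ ∧ ∀ H ∈ ℋ, n₀ ≤ H.verts.card →
      ∃ (ι : Type) (_ : Fintype ι) (q : H.verts → ι) (cc : H.verts → H.verts → Fin L)
        (g : CellIx ι (Fin L) → ℝ), Fintype.card ι ≤ M ∧ irregMass q cc η₀ ≤ η₀ ∧
          𝔼 p, |edgeFn H p - g (cell q cc p)| ≤ τ₀ := by
  obtain ⟨M₀, hM₀⟩ := exists_missing_blowup hub
  set K₁ : ℕ := M₀ + (M₀ + 2 ^ (L + 1) * M₀) + 1 with hK₁
  set K : ℕ := K₁ ^ 3 with hK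
  have hK0 : 0 < K := by positivity
  have hKr : (0 : ℝ) < K := by exact_mod_cast hK0
  set τ : ℝ := min τ₀ 1 with hτdef
  have hτ : 0 < τ := lt_min hτ₀ one_pos
  have hτ1 : τ ≤ 1 := min_le_right _ _
  have hττ : τ ≤ τ₀ := min_le_left _ _
  have hLr : (0 : ℝ) < L + 1 := by positivity
  set μ : ℝ := τ / 8 with hμ
  set ζ : ℝ := τ / (48 * (L + 1)) with hζdef
  have hμ0 : 0 < μ := by positivity
  have hζ : 0 < ζ := by positivity
  have hζ1 : ζ ≤ 1 := by
    rw [hζdef, div_le_one (by positivity)]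
    have : (0 : ℝ) ≤ L := by positivity
    linarith
  set B : ℝ := ζ * τ / 48 with hB
  have hB0 : 0 < B := by positivity
  set κ₀ : ℝ := B / 10 with hκ₀
  have hκ0 : 0 < κ₀ := by positivity
  have hκ1 : κ₀ ≤ 1 := by
    have : ζ * τ ≤ 1 := mul_le_one₀ hζ1 hτ.le hτ1
    rw [hκ₀, hB]; linarith
  set ε' : ℝ := μ ^ K / (8 * K) with hε'
  have hε'0 : 0 < ε' := by positivity
  set η : ℕ → ℝ := fun m => min (min κ₀ (τ / (144 * (m + 1) ^ 3)))
    (min (μ ^ K * (κ₀ / (m + 1)) ^ K / (8 * (K * (K + 1)))) (η₀ / (m + 1))) with hηdef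
  have hη : ∀ m, 0 < η m := fun m => by
    simp only [hηdef]
    refine lt_min (lt_min hκ0 ?_) (lt_min ?_ ?_) <;> positivity
  set θ : ℕ → ℕ → ℝ := fun m t =>
    μ ^ K * (κ₀ / (m + 1)) ^ K * (κ₀ / (t + 1)) ^ K / (8 * K) with hθdef
  have hθ : ∀ m t, 0 < θ m t := fun m t => by simp only [hθdef]; positivity
  have hε : 0 < (ε' * κ₀) ^ 2 := by positivity
  obtain ⟨M, hM⟩ := hypergraph_regularity hε η hη θ hθ
  set D : ℝ := μ ^ K * (κ₀ / (M + 1)) ^ K * (κ₀ / (M + 1)) ^ K / 2 with hD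
  have hD0 : 0 < D := by positivity
  obtain ⟨n₁, hn₁⟩ := exists_nat_gt ((K : ℝ) ^ 2 / D)
  refine ⟨M, n₁ + 1, by omega, fun H hH hn => ?_⟩
  have hne : Nonempty H.verts := by
    have : 0 < H.verts.card := by omega
    obtain ⟨x, hx⟩ := card_pos.1 this
    exact ⟨⟨x, hx⟩⟩
  obtain ⟨κ, ι, _, _, c, σ, q, f₁, hm, ht, hσ, hc, hirr, hf0, hf1, hcl, hpu⟩ :=
    hM H.verts (edgeFn H) edgeFn_nonneg edgeFn_le_one
  set m := Fintype.card κ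
  set t := Fintype.card ι
  have hmr : (m : ℝ) ≤ M := by exact_mod_cast hm
  have htr : (t : ℝ) ≤ M := by exact_mod_cast ht
  have hm0 : (0 : ℝ) ≤ m := by positivity
  have ht0 : (0 : ℝ) ≤ t := by positivity
  set δ : ℝ := κ₀ / (m + 1) with hδ
  set ω : ℝ := κ₀ / (t + 1) with hω
  have hδ0 : 0 < δ := by positivity
  have hω0 : 0 < ω := by positivity
  have hη1 : η m ≤ κ₀ := (min_le_left _ _).trans (min_le_left _ _)
  have hη2 : η m ≤ τ / (144 * (m + 1) ^ 3) := (min_le_left _ _).trans (min_le_right _ _)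
  have hη3 : η m ≤ μ ^ K * δ ^ K / (8 * (K * (K + 1))) := (min_le_right _ _).trans (min_le_left _ _)
  have hη4 : η m ≤ η₀ / (m + 1) := (min_le_right _ _).trans (min_le_right _ _)
  have hη5 : m * η m ≤ η₀ := by
    rw [le_div_iff₀ (by positivity)] at hη4
    nlinarith [hη m]
  have hη6 : η m ≤ η₀ := hη4.trans (div_le_self hη₀.le (by linarith))
  have hyp : ClusterHyp L M₀ K₁ H f₁ μ δ ω ε' (η m) (θ m t) :=
    { L_pos := hL
      missing := hM₀ H hH
      params :=
        { μ_pos := hμ0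
          μ_le := by rw [hμ]; linarith
          δ_pos := hδ0
          δ_le := (div_le_self hκ0.le (by linarith)).trans hκ1
          ω_pos := hω0
          ω_le := (div_le_self hκ0.le (by linarith)).trans hκ1
          ε_nonneg := hε'0.le
          η_nonneg := (hη m).le
          θ_nonneg := (hθ m t).le
          ε_small := by rw [hε', div_mul_cancel₀ _ (by positivity)]
          η_small := (le_div_iff₀ (by positivity)).1 hη3
          θ_small := by
            simp only [hθdef]
            rw [div_mul_cancel₀ _ (by positivity)]
          size := by
            have h1 : D ≤ μ ^ K * δ ^ K * ω ^ K / 2 := by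
              rw [hD, hδ, hω]
              gcongr
            have h2 : (K : ℝ) ^ 2 < n₁ * D := (div_lt_iff₀ hD0).1 hn₁
            have h3 : (n₁ : ℝ) ≤ Fintype.card H.verts := by
              rw [Fintype.card_coe]; exact_mod_cast (by omega)
            have h4 : (n₁ : ℝ) * D ≤ μ ^ K * δ ^ K * ω ^ K / 2 * Fintype.card H.verts := by
              rw [mul_comm]
              exact mul_le_mul h1 h3 (by positivity) (by positivity)
            exact h2.trans_le h4 }
      K_large := le_rfl
      μ_half := by rw [hμ]; linarith
      unif := hpu
      f_nonneg := hf0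
      f_le := hf1 }
  have hbad := sum_cellM_bad_le (f := edgeFn H) (q := q) (c := c) hσ hc (f₁ := f₁) (η := η m)
    (δ := δ) (ω := ω)
    (ε' := ε') (κ₀ := κ₀) hω0.le hδ0.le hε'0 (hirr.trans hη1)
    (by show t * ω ≤ κ₀; rw [hω, ← mul_div_assoc, div_le_iff₀ (by positivity)]; nlinarith)
    (by show m * δ ≤ κ₀; rw [hδ, ← mul_div_assoc, div_le_iff₀ (by positivity)]; nlinarith)
    (expect_abs_le_sqrt _ (by positivity) hcl)
  have hTV := sum_abs_cellE_one_sub_le (q := q) (c := c) hσ hc (hη m).le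
  have hTV' : 3 * η m * (m : ℝ) ^ 3 + 6 * irregMass q c (η m) ≤ τ / 16 := by
    have h1 : η m * (m + 1 : ℝ) ^ 3 ≤ τ / 144 := by
      have := (le_div_iff₀ (by positivity)).1 hη2
      linarith
    have h2 : (m : ℝ) ^ 3 ≤ (m + 1 : ℝ) ^ 3 := pow_le_pow_left₀ hm0 (by linarith) 3
    have h3 : (1 : ℝ) ≤ (m + 1 : ℝ) ^ 3 := one_le_pow₀ (by linarith)
    have h4 := mul_le_mul_of_nonneg_left h2 (hη m).le
    have h5 := mul_le_mul_of_nonneg_left h3 (hη m).le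
    linarith
  have hB10 : 10 * κ₀ = B := by rw [hκ₀]; ring
  rw [hB10] at hbad
  obtain ⟨cl, g, hg⟩ := hyp.exists_merged hσ hc hζ hbad (hTV.trans hTV')
  refine ⟨ι, inferInstance, q, fun x y => cl (q x) (q y) (c x y), g, ht, ?_, hg.trans ?_⟩
  · exact ((irregMass_merge_le cl hη5).trans hirr).trans hη6
  · have e1 : (L + 1 : ℝ) * ζ = τ / 48 := by rw [hζdef]; field_simp
    have e2 : B / ζ = τ / 48 := by rw [hB]; field_simp
    have e3 : B ≤ τ / 48 := by
      rw [hB]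
      have := mul_le_mul_of_nonneg_right hζ1 hτ.le
      linarith
    rw [e1, e2, hμ]
    linarith

section Decomposition
variable {W : Finset ℕ} {ι κ : Type}

/-- The decomposition given by a vertex partition and a colouring of pairs. -/
noncomputable def decompOf (q : W → ι) (c : W → W → κ) : Decomp W ι κ where
  part i := (univ.filter fun x : W => q x = i).map (Function.Embedding.subtype _)
  part_sub i := by
    intro u hu
    obtain ⟨x, -, rfl⟩ := mem_map.1 hu
    exact x.2
  part_disj i j hij := by
    rw [disjoint_map]
    exact disjoint_filter.2 fun x _ h h' => hij (h.symm.trans h')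
  part_cover x hx := ⟨q ⟨x, hx⟩, mem_map.2 ⟨⟨x, hx⟩, by simp, rfl⟩⟩
  pairs i j α := (univ.filter fun p : W × W => q p.1 = i ∧ q p.2 = j ∧ c p.1 p.2 = α).map
    ((Function.Embedding.subtype _).prodMap (Function.Embedding.subtype _))
  pairs_sub i j α := by
    intro u hu
    obtain ⟨p, hp, rfl⟩ := mem_map.1 hu
    have hp' := (mem_filter.1 hp).2
    exact mem_product.2 ⟨mem_map.2 ⟨p.1, by simp [hp'.1], rfl⟩,
      mem_map.2 ⟨p.2, by simp [hp'.2.1], rfl⟩⟩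
  pairs_disj i j α β hαβ := by
    rw [disjoint_map]
    exact disjoint_filter.2 fun x _ h h' => hαβ (h.2.2.symm.trans h'.2.2)
  pairs_cover i j p hp := by
    obtain ⟨h1, h2⟩ := mem_product.1 hp
    obtain ⟨x, hx, hxp⟩ := mem_map.1 h1
    obtain ⟨y, hy, hyp⟩ := mem_map.1 h2
    exact ⟨c x y, mem_map.2 ⟨(x, y), by simpa using And.intro (by simpa using hx) (by simpa using hy),
      Prod.ext hxp hyp⟩⟩

variable {q : W → ι} {c : W → W → κ}

lemma mem_pairs_decompOf {i j : ι} {α : κ} {x y : W} :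
    ((x : ℕ), (y : ℕ)) ∈ (decompOf q c).pairs i j α ↔ q x = i ∧ q y = j ∧ c x y = α := by
  refine mem_map.trans ⟨?_, fun h => ⟨(x, y), by simpa using h, rfl⟩⟩
  rintro ⟨⟨x', y'⟩, h, he⟩
  obtain ⟨h1, h2⟩ := Prod.ext_iff.1 he
  obtain rfl : x' = x := Subtype.ext h1
  obtain rfl : y' = y := Subtype.ext h2
  simpa using h

lemma mem_part_decompOf {i : ι} {x : W} : (x : ℕ) ∈ (decompOf q c).part i ↔ q x = i := by
  refine mem_map.trans ⟨?_, fun h => ⟨x, by simpa using h, rfl⟩⟩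
  rintro ⟨x', h, he⟩
  obtain rfl : x' = x := Subtype.ext he
  simpa using h

lemma sum_part_decompOf (i : ι) (F : ℕ → ℝ) :
    ∑ u ∈ (decompOf q c).part i, F u = ∑ x : W, ind (q x = i) * F x := by
  simp only [decompOf, sum_map, sum_filter, ind, ite_mul, one_mul, zero_mul]
  rfl

lemma card_part_decompOf (i : ι) :
    (((decompOf q c).part i).card : ℝ) = W.card * wt q i := by
  have := sum_part_decompOf (q := q) (c := c) i fun _ => 1
  simp only [sum_const, nsmul_eq_mul, mul_one] at this
  rw [this, wt, ← Fintype.card_coe, Fintype.card_mul_expect]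

lemma card_pairs_decompOf (i j : ι) (α : κ) :
    (((decompOf q c).pairs i j α).card : ℝ) =
      (W.card : ℝ) ^ 2 * (wt q i * wt q j * dens q c i j α) := by
  rw [dens_mul, ← Fintype.card_coe W, sq, mul_assoc, mul_expect, Fintype.card_mul_expect]
  simp only [Fintype.card_mul_expect, decompOf, card_map]
  rw [card_filter, Fintype.sum_prod_type]
  push_cast
  refine sum_congr rfl fun x _ => sum_congr rfl fun y _ => ?_
  rw [← ind_and, ← ind_and, ind, and_assoc]
  split_ifs <;> rfl

lemma density_decompOf [Nonempty W] (i j : ι) (α : κ) :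
    ((decompOf q c).pairBG i j α).density = dens q c i j α := by
  have hn : (W.card : ℝ) ≠ 0 := by
    rw [← Fintype.card_coe]; exact_mod_cast Fintype.card_ne_zero
  unfold Bigraph.density Decomp.pairBG
  simp only [card_pairs_decompOf, card_part_decompOf]
  by_cases h : wt q i * wt q j = 0
  · have h' : (W.card : ℝ) * wt q i * (W.card * wt q j) = 0 := by
      rw [mul_mul_mul_comm, h, mul_zero]
    rw [h', div_zero, dens, h, div_zero]
  · have h1 := left_ne_zero_of_mul h
    have h2 := right_ne_zero_of_mul h
    field_simp

lemma gfun_decompOf [Nonempty W] {i j : ι} (α : κ) {x y : W} (hx : q x = i) (hy : q y = j) :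
    ((decompOf q c).pairBG i j α).gfun x y = ind (c x y = α) - dens q c i j α := by
  unfold Bigraph.gfun
  rw [density_decompOf]
  have : ((x : ℕ), (y : ℕ)) ∈ ((decompOf q c).pairBG i j α).edges ↔ c x y = α := by
    refine mem_pairs_decompOf.trans ?_
    simp [hx, hy]
  by_cases h : c x y = α
  · rw [if_pos (this.2 h), ind_true h]
  · rw [if_neg (mt this.1 h), ind_false h, zero_sub]

lemma devSum_decompOf_le [Nonempty W] {i j : ι} {η : ℝ} (h : RegPair q c η i j) (α : κ) :
    ((decompOf q c).pairBG i j α).devSum ≤ η * (((decompOf q c).part i).card : ℝ) ^ 2 *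
      (((decompOf q c).part j).card : ℝ) ^ 2 := by
  set g : W → W → ℝ := fun x y => ind (c x y = α) - dens q c i j α with hg
  have hg1 : ∀ x y, |g x y| ≤ 1 := fun x y => abs_sub_le_of_nonneg_of_le (ind_nonneg _)
    (ind_le_one _) (dens_nonneg _ _ _ _ _) (dens_le_one _ _ _ _ _)
  have e : ((decompOf q c).pairBG i j α).devSum = ∑ x₁ : W, ∑ y₁ : W,
      ind (q x₁ = i) * ind (q y₁ = j) * (g x₁ y₁ * ∑ x₀ : W, ∑ y₀ : W,
        ind (q x₀ = i) * ind (q y₀ = j) * g x₀ y₀ * (g x₀ y₁ * g x₁ y₀)) := by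
    unfold Bigraph.devSum
    change ∑ u₀ ∈ (decompOf q c).part i, ∑ u₁ ∈ (decompOf q c).part i,
      ∑ w₀ ∈ (decompOf q c).part j, ∑ w₁ ∈ (decompOf q c).part j, _ = _
    simp only [sum_part_decompOf]
    simp only [mul_sum]
    rw [sum_comm]
    refine sum_congr rfl fun x₁ _ => ?_
    rw [sum_congr rfl fun x₀ _ => sum_comm, sum_comm]
    refine sum_congr rfl fun y₁ _ => sum_congr rfl fun x₀ _ => sum_congr rfl fun y₀ _ => ?_
    by_cases h1 : q x₁ = i
    · by_cases h2 : q x₀ = i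
      · by_cases h3 : q y₁ = j
        · by_cases h4 : q y₀ = j
          · rw [gfun_decompOf α h1 h3, gfun_decompOf α h1 h4, gfun_decompOf α h2 h3,
              gfun_decompOf α h2 h4]
            simp only [hg]
            ring
          · simp [h4]
        · simp [h3]
      · simp [h2]
    · simp [h1]
  have hb : ∀ x₁ y₁, |g x₁ y₁ * ∑ x₀ : W, ∑ y₀ : W,
      ind (q x₀ = i) * ind (q y₀ = j) * g x₀ y₀ * (g x₀ y₁ * g x₁ y₀)| ≤
        (W.card : ℝ) ^ 2 * (η * (wt q i * wt q j)) := by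
    intro x₁ y₁
    rw [abs_mul]
    refine (mul_le_of_le_one_left (abs_nonneg _) (hg1 _ _)).trans ?_
    have := h α (fun x => g x y₁) (fun y => g x₁ y) (fun x => hg1 _ _) fun y => hg1 _ _
    simp only [← Fintype.card_mul_expect, ← mul_expect]
    rw [← mul_assoc, ← sq, abs_mul, Fintype.card_coe, abs_of_nonneg (by positivity)]
    exact mul_le_mul_of_nonneg_left this (by positivity)
  rw [e, card_part_decompOf, card_part_decompOf]
  have hsum : ∑ x₁ : W, ∑ y₁ : W, ind (q x₁ = i) * ind (q y₁ = j) =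
      (W.card : ℝ) ^ 2 * (wt q i * wt q j) := by
    rw [← wt_mul_wt, sq, mul_assoc, ← Fintype.card_coe W, mul_expect, Fintype.card_mul_expect]
    exact sum_congr rfl fun x _ => (Fintype.card_mul_expect _).symm
  calc _ ≤ ∑ x₁ : W, ∑ y₁ : W, ind (q x₁ = i) * ind (q y₁ = j) *
        ((W.card : ℝ) ^ 2 * (η * (wt q i * wt q j))) :=
        sum_le_sum fun x _ => sum_le_sum fun y _ => mul_le_mul_of_nonneg_left
          ((le_abs_self _).trans (hb x y)) (mul_nonneg (ind_nonneg _) (ind_nonneg _))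
    _ = (W.card : ℝ) ^ 2 * (wt q i * wt q j) * ((W.card : ℝ) ^ 2 * (η * (wt q i * wt q j))) := by
        rw [← hsum, sum_mul]
        exact sum_congr rfl fun x _ => by rw [sum_mul]
    _ = _ := by ring

lemma dev2_decompOf [Nonempty W] {i j : ι} {η η' : ℝ} (hη : 0 ≤ η') (h : RegPair q c η i j)
    (hle : η ≤ η') (α : κ) :
    ((decompOf q c).pairBG i j α).dev2 η' (dens q c i j α) := by
  refine ⟨by rw [density_decompOf, sub_self, abs_zero]; exact hη, ?_⟩
  exact devSum_decompOf_le (regPair_mono hle h) α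

lemma expect_part [Fintype ι] (g : ι → ι → ℝ) :
    𝔼 x, 𝔼 y, g (q x) (q y) = ∑ i, ∑ j, wt q i * wt q j * g i j := by
  simp only [← wt_mul_wt, expect_mul, ← expect_sum]
  refine expect_congr rfl fun x _ => expect_congr rfl fun y _ => ?_
  rw [← sum_ind_eq (q x) fun i => g i (q y)]
  refine sum_congr rfl fun i _ => ?_
  rw [← sum_ind_eq (q y) (g i), mul_sum]
  exact sum_congr rfl fun j _ => by ring

lemma isReg_decompOf_of_le [Nonempty W] {η ε₁ η' : ℝ} (hη' : 0 ≤ η') (hle : η ≤ η')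
    (h : (1 - ε₁) * (W.card : ℝ) ^ 2 ≤
      #((univ : Finset (W × W)).filter fun p => RegPair q c η (q p.1) (q p.2))) :
    (decompOf q c).isReg ε₁ η' := by
  refine h.trans ?_
  rw [← card_map ((Function.Embedding.subtype _).prodMap (Function.Embedding.subtype _))]
  exact_mod_cast card_le_card fun p hp => by
    obtain ⟨⟨x, y⟩, hxy, rfl⟩ := mem_map.1 hp
    refine mem_filter.2 ⟨mem_product.2 ⟨x.2, y.2⟩, q x, q y, c x y,
      mem_pairs_decompOf.2 ⟨rfl, rfl, rfl⟩, ?_⟩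
    have := dev2_decompOf hη' (mem_filter.1 hxy).2 hle (c x y)
    rwa [← density_decompOf] at this

lemma isReg_decompOf [Nonempty W] [Fintype ι] {η ε₁ η' : ℝ} (hη' : 0 ≤ η') (hle : η ≤ η')
    (hirr : irregMass q c η ≤ ε₁) : (decompOf q c).isReg ε₁ η' := by
  refine isReg_decompOf_of_le hη' hle ?_
  have h2 : (#((univ : Finset (W × W)).filter fun p => RegPair q c η (q p.1) (q p.2)) : ℝ) =
      (W.card : ℝ) ^ 2 * (1 - irregMass q c η) := by
    rw [irregMass, ← expect_part fun i j => ind (¬ RegPair q c η i j), card_filter]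
    push_cast
    rw [← Fintype.card_mul_expect, expect_prod, Fintype.card_prod, Fintype.card_coe]
    push_cast
    rw [← sq]
    congr 1
    simp only [ind_not, expect_sub_distrib, Fintype.expect_const, sub_sub_cancel]
    rfl
  rw [h2, mul_comm]
  exact mul_le_mul_of_nonneg_left (by linarith) (by positivity)

end Decomposition

lemma sum_abs_sub_mean_le {Ω : Type*} [Fintype Ω] {w f : Ω → ℝ} {r g : ℝ} (hw : ∀ p, 0 ≤ w p)
    (hr : ∑ p, w p * f p = r * ∑ p, w p) :
    ∑ p, w p * |f p - r| ≤ 2 * ∑ p, w p * |f p - g| := by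
  have h1 : (∑ p, w p) * |g - r| ≤ ∑ p, w p * |f p - g| := by
    have e : (∑ p, w p) * (g - r) = ∑ p, w p * (g - f p) := by
      simp only [mul_sub, sum_sub_distrib, hr, ← sum_mul]
      ring
    rw [← abs_of_nonneg (sum_nonneg fun p (_ : p ∈ univ) => hw p), ← abs_mul, e]
    refine (abs_sum_le_sum_abs _ _).trans (le_of_eq (sum_congr rfl fun p _ => ?_))
    rw [abs_mul, abs_of_nonneg (hw p), abs_sub_comm]
  have h2 : ∑ p, w p * |f p - r| ≤ ∑ p, (w p * |f p - g| + w p * |g - r|) :=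
    sum_le_sum fun p _ => by
      rw [← mul_add]
      exact mul_le_mul_of_nonneg_left (abs_sub_le _ _ _) (hw p)
  rw [sum_add_distrib, ← sum_mul] at h2
  linarith

lemma abs_prod_eight_le {a b c d e f g h : ℝ} (hb : |b| ≤ 1) (hc : |c| ≤ 1) (hd : |d| ≤ 1)
    (he : |e| ≤ 1) (hf : |f| ≤ 1) (hg : |g| ≤ 1) (hh : |h| ≤ 1) :
    a * b * c * d * e * f * g * h ≤ |a| := by
  have step : ∀ {x y : ℝ}, |x| ≤ |a| → |y| ≤ 1 → |x * y| ≤ |a| := fun hx hy => by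
    rw [abs_mul]
    exact (mul_le_of_le_one_right (abs_nonneg _) hy).trans hx
  exact (le_abs_self _).trans (step (step (step (step (step (step (step le_rfl hb) hc) hd) he)
    hf) hg) hh)

lemma abs_hFun_le_one (R : Finset (ℕ × ℕ × ℕ)) (G : Triad) (x y z : ℕ) : |hFun R G x y z| ≤ 1 := by
  have h0 : 0 ≤ relDensity R G := by unfold relDensity; positivity
  have h1 : relDensity R G ≤ 1 := by
    unfold relDensity
    refine div_le_one_of_le₀ ?_ (by positivity)
    exact_mod_cast card_le_card inter_subset_right
  unfold hFun
  split_ifs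
  · rw [abs_le]; constructor <;> linarith
  · rw [abs_le]; constructor <;> linarith
  · simp

lemma devSum3_le (R : Finset (ℕ × ℕ × ℕ)) (G : Triad) :
    devSum3 R G ≤ (#G.X : ℝ) * #G.Y * #G.Z * ∑ x ∈ G.X, ∑ y ∈ G.Y, ∑ z ∈ G.Z, |hFun R G x y z| := by
  unfold devSum3
  calc _ ≤ ∑ u₀ ∈ G.X, ∑ _u₁ ∈ G.X, ∑ w₀ ∈ G.Y, ∑ _w₁ ∈ G.Y, ∑ z₀ ∈ G.Z, ∑ _z₁ ∈ G.Z,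
        |hFun R G u₀ w₀ z₀| := by
        refine sum_le_sum fun _ _ => sum_le_sum fun _ _ => sum_le_sum fun _ _ =>
          sum_le_sum fun _ _ => sum_le_sum fun _ _ => sum_le_sum fun _ _ => ?_
        apply abs_prod_eight_le <;> exact abs_hFun_le_one _ _ _ _ _
    _ = _ := by
        simp only [sum_const, nsmul_eq_mul, ← mul_sum]
        ring

section Decomposition
variable {H : ThreeGraph} {ι κ : Type} {q : H.verts → ι} {c : H.verts → H.verts → κ}

/-- The triad of a cell. -/
noncomputable def triadAt (q : H.verts → ι) (c : H.verts → H.verts → κ) (X : CellIx ι κ) : Triad :=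
  (decompOf q c).triadOf X.1.1 X.1.2.1 X.1.2.2 X.2.1 X.2.2.1 X.2.2.2

lemma mem_K3_triadAt {X : CellIx ι κ} {x y z : H.verts} :
    ((x : ℕ), (y : ℕ), (z : ℕ)) ∈ (triadAt q c X).K3 ↔ cell q c (x, y, z) = X := by
  obtain ⟨⟨i, j, k⟩, ⟨α, β, γ⟩⟩ := X
  unfold Triad.K3 triadAt Decomp.triadOf
  simp only [mem_filter, mem_product, mem_part_decompOf, mem_pairs_decompOf, cell, tri,
    Prod.mk.injEq]
  tauto

/-- The inclusion of triples of vertices in triples of naturals. -/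
def emb₃ (H : ThreeGraph) : H.verts × H.verts × H.verts ↪ ℕ × ℕ × ℕ :=
  (Function.Embedding.subtype _).prodMap
    ((Function.Embedding.subtype _).prodMap (Function.Embedding.subtype _))

lemma exists_of_mem_K3 {X : CellIx ι κ} {u : ℕ × ℕ × ℕ} (hu : u ∈ (triadAt q c X).K3) :
    ∃ p : H.verts × H.verts × H.verts, emb₃ H p = u := by
  obtain ⟨x, y, z⟩ := u
  have h := mem_product.1 (mem_filter.1 hu).1
  have h' := mem_product.1 h.2
  exact ⟨(⟨x, (decompOf q c).part_sub _ h.1⟩, ⟨y, (decompOf q c).part_sub _ h'.1⟩,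
    ⟨z, (decompOf q c).part_sub _ h'.2⟩), rfl⟩

lemma mem_obar_iff {p : H.verts × H.verts × H.verts} : emb₃ H p ∈ H.obar ↔ edgeRel H p := by
  unfold ThreeGraph.obar
  rw [mem_filter]
  refine ⟨fun h => h.2, fun h => ⟨?_, h⟩⟩
  exact mem_product.2 ⟨p.1.2, mem_product.2 ⟨p.2.1.2, p.2.2.2⟩⟩

lemma mem_K3_iff {X : CellIx ι κ} {p : H.verts × H.verts × H.verts} :
    emb₃ H p ∈ (triadAt q c X).K3 ↔ cell q c p = X := mem_K3_triadAt

lemma card_K3 (X : CellIx ι κ) :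
    ((triadAt q c X).K3.card : ℝ) = ∑ p, ind (cell q c p = X) := by
  have : (triadAt q c X).K3 = (univ.filter fun p => cell q c p = X).map (emb₃ H) := by
    ext u
    rw [mem_map]
    constructor
    · intro hu
      obtain ⟨p, rfl⟩ := exists_of_mem_K3 hu
      exact ⟨p, mem_filter.2 ⟨mem_univ _, mem_K3_iff.1 hu⟩, rfl⟩
    · rintro ⟨p, hp, rfl⟩
      exact mem_K3_iff.2 (mem_filter.1 hp).2
  rw [this, card_map, card_filter]
  push_cast
  refine sum_congr rfl fun p _ => ?_
  rw [ind]
  split_ifs <;> rfl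

lemma card_obar_inter_K3 (X : CellIx ι κ) :
    ((H.obar ∩ (triadAt q c X).K3).card : ℝ) = ∑ p, ind (cell q c p = X) * edgeFn H p := by
  have : H.obar ∩ (triadAt q c X).K3 =
      (univ.filter fun p => cell q c p = X ∧ edgeRel H p).map (emb₃ H) := by
    ext u
    rw [mem_map, mem_inter]
    constructor
    · rintro ⟨hu', hu⟩
      obtain ⟨p, rfl⟩ := exists_of_mem_K3 hu
      exact ⟨p, mem_filter.2 ⟨mem_univ _, mem_K3_iff.1 hu, mem_obar_iff.1 hu'⟩, rfl⟩
    · rintro ⟨p, hp, rfl⟩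
      exact ⟨mem_obar_iff.2 (mem_filter.1 hp).2.2, mem_K3_iff.2 (mem_filter.1 hp).2.1⟩
  rw [this, card_map, card_filter]
  push_cast
  refine sum_congr rfl fun p _ => ?_
  rw [edgeFn, ← ind_and, ind]
  split_ifs <;> rfl

lemma sum_ind_mul_edgeFn (X : CellIx ι κ) : ∑ p, ind (cell q c p = X) * edgeFn H p =
    relDensity H.obar (triadAt q c X) * ∑ p, ind (cell q c p = X) := by
  rw [← card_obar_inter_K3, ← card_K3, relDensity]
  by_cases h : ((triadAt q c X).K3.card : ℝ) = 0
  · have h' : (H.obar ∩ (triadAt q c X).K3).card ≤ (triadAt q c X).K3.card :=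
      card_le_card inter_subset_right
    have h0 : (triadAt q c X).K3.card = 0 := by exact_mod_cast h
    rw [h, mul_zero]
    have : (H.obar ∩ (triadAt q c X).K3).card = 0 := by omega
    exact_mod_cast this
  · rw [div_mul_cancel₀ _ h]

lemma hFun_triadAt (X : CellIx ι κ) (x y z : H.verts) :
    |hFun H.obar (triadAt q c X) x y z| = ind (cell q c (x, y, z) = X) *
      |edgeFn H (x, y, z) - relDensity H.obar (triadAt q c X)| := by
  have h1 : ((x : ℕ), (y : ℕ), (z : ℕ)) ∈ H.obar ↔ edgeRel H (x, y, z) :=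
    mem_obar_iff (p := (x, y, z))
  unfold hFun
  by_cases hX : cell q c (x, y, z) = X
  · rw [if_pos (mem_K3_triadAt.2 hX), ind_true hX, one_mul, edgeFn]
    by_cases he : edgeRel H (x, y, z)
    · rw [if_pos (h1.2 he), ind_true he]
    · rw [if_neg (mt h1.1 he), ind_false he, zero_sub]
  · rw [if_neg (mt mem_K3_triadAt.1 hX), ind_false hX, zero_mul, abs_zero]

lemma sum_abs_hFun (X : CellIx ι κ) :
    ∑ x ∈ (triadAt q c X).X, ∑ y ∈ (triadAt q c X).Y, ∑ z ∈ (triadAt q c X).Z,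
      |hFun H.obar (triadAt q c X) x y z| = ∑ p, ind (cell q c p = X) *
        |edgeFn H p - relDensity H.obar (triadAt q c X)| := by
  change ∑ x ∈ (decompOf q c).part _, ∑ y ∈ (decompOf q c).part _, ∑ z ∈ (decompOf q c).part _, _ = _
  simp only [sum_part_decompOf, hFun_triadAt, Fintype.sum_prod_type]
  refine sum_congr rfl fun x _ => ?_
  rw [mul_sum]
  refine sum_congr rfl fun y _ => ?_
  rw [mul_sum, mul_sum]
  refine sum_congr rfl fun z _ => ?_
  by_cases hX : cell q c (x, y, z) = X
  · subst hX
    simp [cell]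
  · simp [hX]

variable [Nonempty H.verts]

lemma devSum3_triadAt_le (X : CellIx ι κ) (g : ℝ) : devSum3 H.obar (triadAt q c X) ≤
    (H.verts.card : ℝ) ^ 6 * (cellW q X * (2 * cellE q c (fun p => |edgeFn H p - g|) X)) := by
  refine (devSum3_le _ _).trans ?_
  rw [sum_abs_hFun]
  have h := sum_abs_sub_mean_le (g := g) (fun p => ind_nonneg (cell q c p = X)) (sum_ind_mul_edgeFn X)
  have hX : (#(triadAt q c X).X : ℝ) = H.verts.card * wt q X.1.1 := card_part_decompOf (c := c) _
  have hY : (#(triadAt q c X).Y : ℝ) = H.verts.card * wt q X.1.2.1 := card_part_decompOf (c := c) _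
  have hZ : (#(triadAt q c X).Z : ℝ) = H.verts.card * wt q X.1.2.2 := card_part_decompOf (c := c) _
  have hE : ∑ p, ind (cell q c p = X) * |edgeFn H p - g| =
      (H.verts.card : ℝ) ^ 3 * cellE q c (fun p => |edgeFn H p - g|) X := by
    rw [cellE, ← Fintype.card_mul_expect]
    simp only [Fintype.card_prod, Fintype.card_coe]
    push_cast
    ring
  rw [hE] at h
  rw [hX, hY, hZ]
  refine (mul_le_mul_of_nonneg_left h ?_).trans (le_of_eq ?_)
  · rw [← hX, ← hY, ← hZ]; positivity
  · unfold cellW; ring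

lemma dev23_triadAt {η ε₁ η' d₀ : ℝ} {X : CellIx ι κ} (g : ℝ) (hd₀ : 0 < d₀) (hε₁ : 0 ≤ ε₁)
    (hη' : 0 ≤ η')
    (hle : η ≤ η') (hreg : RegCell q c η X) (h₁ : d₀ ≤ dens q c X.1.1 X.1.2.1 X.2.1)
    (h₂ : d₀ ≤ dens q c X.1.1 X.1.2.2 X.2.2.1) (h₃ : d₀ ≤ dens q c X.1.2.1 X.1.2.2 X.2.2.2)
    (hcl : 2 * cellE q c (fun p => |edgeFn H p - g|) X ≤ ε₁ * d₀ ^ 12 * cellW q X) :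
    dev23 H.obar (triadAt q c X) ε₁ η' := by
  refine ⟨_, _, _, hd₀.trans_le h₁, hd₀.trans_le h₃, hd₀.trans_le h₂,
    dev2_decompOf hη' hreg.1 hle _, dev2_decompOf hη' hreg.2.1 hle _,
    dev2_decompOf hη' hreg.2.2 hle _, (devSum3_triadAt_le X g).trans ?_⟩
  have hX : (#(triadAt q c X).X : ℝ) = H.verts.card * wt q X.1.1 := card_part_decompOf (c := c) _
  have hY : (#(triadAt q c X).Y : ℝ) = H.verts.card * wt q X.1.2.1 := card_part_decompOf (c := c) _
  have hZ : (#(triadAt q c X).Z : ℝ) = H.verts.card * wt q X.1.2.2 := card_part_decompOf (c := c) _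
  rw [hX, hY, hZ]
  have hd : d₀ ^ 12 ≤ dens q c X.1.1 X.1.2.1 X.2.1 ^ 4 * dens q c X.1.2.1 X.1.2.2 X.2.2.2 ^ 4 *
      dens q c X.1.1 X.1.2.2 X.2.2.1 ^ 4 := by
    calc d₀ ^ 12 = d₀ ^ 4 * d₀ ^ 4 * d₀ ^ 4 := by ring
      _ ≤ _ := by gcongr
  have hW := cellW_nonneg (q := q) X
  calc _ ≤ (H.verts.card : ℝ) ^ 6 * (cellW q X * (ε₁ * d₀ ^ 12 * cellW q X)) := by gcongr
    _ ≤ (H.verts.card : ℝ) ^ 6 * (cellW q X * (ε₁ * (dens q c X.1.1 X.1.2.1 X.2.1 ^ 4 *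
          dens q c X.1.2.1 X.1.2.2 X.2.2.2 ^ 4 * dens q c X.1.1 X.1.2.2 X.2.2.1 ^ 4) *
            cellW q X)) := by gcongr
    _ = _ := by unfold cellW; ring

end Decomposition

section Sparse
variable {V ι κ : Type} [Fintype V] {q : V → ι} {c : V → V → κ}

lemma expect_pair [Fintype ι] [Fintype κ] (F : ι → ι → κ → ℝ) :
    𝔼 x, 𝔼 y, F (q x) (q y) (c x y) =
      ∑ i, ∑ j, ∑ α, wt q i * wt q j * dens q c i j α * F i j α := by
  simp only [dens_mul, expect_mul, ← expect_sum]
  refine expect_congr rfl fun x _ => expect_congr rfl fun y _ => ?_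
  rw [← sum_ind_eq (q x) fun i => F i (q y) (c x y)]
  refine sum_congr rfl fun i _ => ?_
  rw [← sum_ind_eq (q y) fun j => F i j (c x y), mul_sum]
  refine sum_congr rfl fun j _ => ?_
  rw [← sum_ind_eq (c x y) fun α => F i j α, mul_sum, mul_sum]
  exact sum_congr rfl fun α _ => by ring

lemma expect_sparse_le [Nonempty V] [Fintype ι] [Fintype κ] {d : ℝ} (hd : 0 ≤ d) :
    𝔼 x, 𝔼 y, ind (dens q c (q x) (q y) (c x y) < d) ≤ Fintype.card κ * d := by
  rw [expect_pair fun i j α => ind (dens q c i j α < d)]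
  have h : ∀ i j, ∑ α, wt q i * wt q j * dens q c i j α * ind (dens q c i j α < d) ≤
      wt q i * wt q j * (Fintype.card κ * d) := by
    intro i j
    have : (Fintype.card κ : ℝ) * d = ∑ _α : κ, d := by simp
    rw [this, mul_sum]
    refine sum_le_sum fun α _ => ?_
    rw [mul_assoc]
    refine mul_le_mul_of_nonneg_left ?_ (mul_nonneg (wt_nonneg _ _) (wt_nonneg _ _))
    by_cases hα : dens q c i j α < d
    · rw [ind_true hα, mul_one]; exact hα.le
    · rw [ind_false hα, mul_zero]; exact hd
  refine (sum_le_sum fun i _ => sum_le_sum fun j _ => h i j).trans (le_of_eq ?_)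
  simp only [← sum_mul, ← mul_sum, sum_wt, mul_one, one_mul]

lemma cellE_one_le_cellW [Nonempty V] (X : CellIx ι κ) : cellE q c (fun _ => 1) X ≤ cellW q X := by
  obtain ⟨⟨i, j, k⟩, ⟨α, β, γ⟩⟩ := X
  have e : cellW q ((i, j, k), (α, β, γ)) =
      𝔼 x, 𝔼 y, 𝔼 z, ind (q x = i) * ind (q y = j) * ind (q z = k) := by
    simp only [cellW, wt, ← mul_expect, ← expect_mul]
  rw [e, cellE, expect_triple]
  refine expect_mono fun x => expect_mono fun y => expect_mono fun z => ?_
  rw [ind_cell, mul_one]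
  refine mul_le_of_le_one_right (mul_nonneg (mul_nonneg (ind_nonneg _) (ind_nonneg _)) (ind_nonneg _)) ?_
  exact mul_le_one₀ (mul_le_one₀ (ind_le_one _) (ind_nonneg _) (ind_le_one _)) (ind_nonneg _)
    (ind_le_one _)

/-- Markov's inequality for cells. -/
lemma expect_rough_le [Nonempty V] [Fintype ι] [Fintype κ] {f : V × V × V → ℝ} (hf : ∀ p, 0 ≤ f p) {s : ℝ}
    (hs : 0 < s) :
    𝔼 p, ind (s * cellW q (cell q c p) < cellE q c f (cell q c p)) ≤ (𝔼 p, f p) / s := by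
  have h := sum_cellE_mul (q := q) (c := c) (fun _ => 1)
    fun X => ind (s * cellW q X < cellE q c f X)
  simp only [one_mul] at h
  rw [← h, le_div_iff₀ hs, sum_mul]
  have h' := sum_cellE_mul (q := q) (c := c) f fun _ => 1
  simp only [mul_one] at h'
  rw [← h']
  refine sum_le_sum fun X _ => ?_
  by_cases hX : s * cellW q X < cellE q c f X
  · rw [ind_true hX, mul_one, mul_comm]
    exact (mul_le_mul_of_nonneg_left (cellE_one_le_cellW X) hs.le).trans hX.le
  · rw [ind_false hX, mul_zero, zero_mul]
    exact cellE_nonneg hf X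

end Sparse

section Decomposition
variable {H : ThreeGraph} {ι κ : Type} {q : H.verts → ι} {c : H.verts → H.verts → κ}

lemma regWrt_decompOf_of_le {ε₁ η' : ℝ} (h : (1 - ε₁) * (H.verts.card : ℝ) ^ 3 ≤
    #((univ : Finset (H.verts × H.verts × H.verts)).filter fun p =>
      dev23 H.obar (triadAt q c (cell q c p)) ε₁ η')) :
    (decompOf q c).regWrt H.obar ε₁ η' := by
  refine h.trans ?_
  rw [← card_map (emb₃ H)]
  exact_mod_cast card_le_card fun p hp => by
    obtain ⟨u, hu, rfl⟩ := mem_map.1 hp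
    exact mem_filter.2 ⟨mem_product.2 ⟨u.1.2, mem_product.2 ⟨u.2.1.2, u.2.2.2⟩⟩, _, _, _, _, _, _,
      (mem_K3_iff (q := q) (c := c)).2 rfl, (mem_filter.1 hu).2⟩

lemma regWrt_decompOf_of_expect_le [Nonempty H.verts] {ε₁ η' : ℝ}
    (h : 𝔼 p, ind (¬ dev23 H.obar (triadAt q c (cell q c p)) ε₁ η') ≤ ε₁) :
    (decompOf q c).regWrt H.obar ε₁ η' := by
  refine regWrt_decompOf_of_le ?_
  have e : (#((univ : Finset (H.verts × H.verts × H.verts)).filter fun p =>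
      dev23 H.obar (triadAt q c (cell q c p)) ε₁ η') : ℝ) = (H.verts.card : ℝ) ^ 3 *
        (1 - 𝔼 p, ind (¬ dev23 H.obar (triadAt q c (cell q c p)) ε₁ η')) := by
    simp only [ind_not, expect_sub_distrib, Fintype.expect_const, sub_sub_cancel]
    have hc : (H.verts.card : ℝ) ^ 3 = Fintype.card (H.verts × H.verts × H.verts) := by
      simp only [Fintype.card_prod, Fintype.card_coe]
      push_cast
      ring
    rw [hc, Fintype.card_mul_expect, card_filter]
    push_cast
    refine sum_congr rfl fun p _ => ?_
    rw [ind]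
  rw [e, mul_comm]
  exact mul_le_mul_of_nonneg_left (by linarith) (by positivity)

lemma regWrt_decompOf [Nonempty H.verts] [Fintype ι] [Fintype κ] {g : CellIx ι κ → ℝ}
    {η ε₁ η' d₀ τ : ℝ} (hd₀ : 0 < d₀) (hε₁ : 0 < ε₁) (hη' : 0 ≤ η') (hle : η ≤ η')
    (hirr : irregMass q c η ≤ η) (hg : 𝔼 p, |edgeFn H p - g (cell q c p)| ≤ τ)
    (hsum : 3 * η + 3 * (Fintype.card κ * d₀) + τ / (ε₁ * d₀ ^ 12 / 2) ≤ ε₁) :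
    (decompOf q c).regWrt H.obar ε₁ η' := by
  refine regWrt_decompOf_of_expect_le (le_trans ?_ hsum)
  set f : H.verts × H.verts × H.verts → ℝ := fun p => |edgeFn H p - g (cell q c p)| with hf
  set s : ℝ := ε₁ * d₀ ^ 12 / 2 with hs
  have hs0 : 0 < s := by positivity
  have hfX : ∀ X, cellE q c (fun p => |edgeFn H p - g X|) X = cellE q c f X := fun X => by
    refine expect_congr rfl fun p _ => ?_
    by_cases hp : cell q c p = X
    · simp only [hf, hp]
    · rw [ind_false hp, zero_mul, zero_mul]
  set D : ι → ι → κ → Prop := fun i j α => dens q c i j α < d₀ with hD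
  have hbad : ∀ X : CellIx ι κ, ind (¬ dev23 H.obar (triadAt q c X) ε₁ η') ≤
      ind (¬ RegCell q c η X) + ind (D X.1.1 X.1.2.1 X.2.1) + ind (D X.1.1 X.1.2.2 X.2.2.1) +
        ind (D X.1.2.1 X.1.2.2 X.2.2.2) + ind (s * cellW q X < cellE q c f X) := by
    intro X
    refine (ind_mono (q := (((¬ RegCell q c η X ∨ D X.1.1 X.1.2.1 X.2.1) ∨
      D X.1.1 X.1.2.2 X.2.2.1) ∨ D X.1.2.1 X.1.2.2 X.2.2.2) ∨ s * cellW q X < cellE q c f X)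
        fun h => ?_).trans ?_
    · contrapose! h
      obtain ⟨⟨⟨⟨h1, h2⟩, h3⟩, h4⟩, h5⟩ := h
      refine dev23_triadAt (g X) hd₀ hε₁.le hη' hle h1 (not_lt.1 h2) (not_lt.1 h3) (not_lt.1 h4) ?_
      rw [hfX]
      calc 2 * cellE q c f X ≤ 2 * (s * cellW q X) := by linarith
        _ = _ := by rw [hs]; ring
    · have h1 := ind_or_le (((¬ RegCell q c η X ∨ D X.1.1 X.1.2.1 X.2.1) ∨
        D X.1.1 X.1.2.2 X.2.2.1) ∨ D X.1.2.1 X.1.2.2 X.2.2.2) (s * cellW q X < cellE q c f X)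
      have h2 := ind_or_le ((¬ RegCell q c η X ∨ D X.1.1 X.1.2.1 X.2.1) ∨
        D X.1.1 X.1.2.2 X.2.2.1) (D X.1.2.1 X.1.2.2 X.2.2.2)
      have h3 := ind_or_le (¬ RegCell q c η X ∨ D X.1.1 X.1.2.1 X.2.1) (D X.1.1 X.1.2.2 X.2.2.1)
      have h4 := ind_or_le (¬ RegCell q c η X) (D X.1.1 X.1.2.1 X.2.1)
      linarith
  refine (expect_mono fun p => hbad (cell q c p)).trans ?_
  simp only [expect_add_distrib]
  have h1 := sum_cellE_irreg_le (q := q) (c := c) η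
  rw [sum_cellE_mul] at h1
  simp only [one_mul] at h1
  have hsp := expect_sparse_le (q := q) (c := c) hd₀.le
  have h2 : 𝔼 p : H.verts × H.verts × H.verts, ind (D (cell q c p).1.1 (cell q c p).1.2.1
      (cell q c p).2.1) ≤ Fintype.card κ * d₀ := by
    rw [expect_triple]
    simp only [cell, tri, Fintype.expect_const]
    exact hsp
  have h3 : 𝔼 p : H.verts × H.verts × H.verts, ind (D (cell q c p).1.1 (cell q c p).1.2.2
      (cell q c p).2.2.1) ≤ Fintype.card κ * d₀ := by
    rw [expect_triple]
    simp only [cell, tri, Fintype.expect_const]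
    exact hsp
  have h4 : 𝔼 p : H.verts × H.verts × H.verts, ind (D (cell q c p).1.2.1 (cell q c p).1.2.2
      (cell q c p).2.2.2) ≤ Fintype.card κ * d₀ := by
    rw [expect_triple]
    simp only [cell, tri, Fintype.expect_const]
    exact hsp
  have h5 := (expect_rough_le (q := q) (c := c) (f := f) (fun _ => abs_nonneg _) hs0).trans
    (div_le_div_of_nonneg_right hg hs0.le)
  linarith

end Decomposition

section Reindex
variable {V : Finset ℕ} {ι ι' κ : Type}

/-- Renaming the parts of a decomposition. -/
def reindex (e : ι' ≃ ι) (P : Decomp V ι κ) : Decomp V ι' κ where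
  part i := P.part (e i)
  part_sub i := P.part_sub _
  part_disj _ _ hij := P.part_disj _ _ (e.injective.ne hij)
  part_cover x hx := by
    obtain ⟨i, hi⟩ := P.part_cover x hx
    exact ⟨e.symm i, by rwa [e.apply_symm_apply]⟩
  pairs i j α := P.pairs (e i) (e j) α
  pairs_sub i j α := P.pairs_sub _ _ _
  pairs_disj i j α β h := P.pairs_disj _ _ _ _ h
  pairs_cover i j p hp := P.pairs_cover _ _ p hp

lemma isReg_reindex (e : ι' ≃ ι) {P : Decomp V ι κ} {ε₁ η' : ℝ} (h : P.isReg ε₁ η') :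
    (reindex e P).isReg ε₁ η' := by
  refine h.trans ?_
  exact_mod_cast card_le_card fun p hp => by
    obtain ⟨hp, i, j, α, h1, h2⟩ := mem_filter.1 hp
    obtain ⟨i, rfl⟩ := e.surjective i
    obtain ⟨j, rfl⟩ := e.surjective j
    exact mem_filter.2 ⟨hp, i, j, α, h1, h2⟩

lemma regWrt_reindex (e : ι' ≃ ι) {P : Decomp V ι κ} {R : Finset (ℕ × ℕ × ℕ)} {ε₁ η' : ℝ}
    (h : P.regWrt R ε₁ η') : (reindex e P).regWrt R ε₁ η' := by
  refine h.trans ?_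
  exact_mod_cast card_le_card fun p hp => by
    obtain ⟨hp, i, j, k, α, β, γ, h1, h2⟩ := mem_filter.1 hp
    obtain ⟨i, rfl⟩ := e.surjective i
    obtain ⟨j, rfl⟩ := e.surjective j
    obtain ⟨k, rfl⟩ := e.surjective k
    exact mem_filter.2 ⟨hp, i, j, k, α, β, γ, h1, h2⟩

lemma goodDecomp_of_decomp {H : ThreeGraph} {t L : ℕ} (e : Fin t ≃ ι)
    {P : Decomp H.verts ι (Fin L)} {ε₁ η' : ℝ} (h : P.isReg ε₁ η')
    (h' : P.regWrt H.obar ε₁ η') : GoodDecomp H t L ε₁ η' :=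
  ⟨reindex e P, isReg_reindex e h, regWrt_reindex e h'⟩

end Reindex

theorem exists_goodDecomp {ℋ : Set ThreeGraph} {L : ℕ} (hL : 1 ≤ L)
    (hub : ∀ K : ℕ, (∃ G : Bigraph, InBH ℋ G ∧ G.left.card = K) → K ≤ L) {ε₁ η' : ℝ}
    (hε₁ : 0 < ε₁) (hη' : 0 < η') :
    ∃ T n₀ : ℕ, 1 ≤ T ∧ ∀ H ∈ ℋ, n₀ ≤ H.verts.card →
      ∃ t, 1 ≤ t ∧ t ≤ T ∧ GoodDecomp H t L ε₁ η' := by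
  have hLr : (0 : ℝ) < L := by exact_mod_cast hL
  set d₀ : ℝ := ε₁ / (12 * L) with hd
  have hd₀ : 0 < d₀ := by positivity
  set τ : ℝ := ε₁ / 4 * (ε₁ * d₀ ^ 12 / 2) with hτ
  have hτ₀ : 0 < τ := by positivity
  obtain ⟨M, n₀, hn₀, hM⟩ := exists_structured_partition hL hub
    (lt_min (show 0 < ε₁ / 12 by positivity) hη') hτ₀
  refine ⟨max M 1, n₀, le_max_right _ _, fun H hH hn => ?_⟩
  obtain ⟨ι, _, q, c, g, hcard, hirr, hg⟩ := hM H hH hn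
  have : Nonempty H.verts := (card_pos.1 (by omega : 0 < H.verts.card)).to_subtype
  have : Nonempty ι := ⟨q (Classical.arbitrary _)⟩
  have hmin := min_le_left (ε₁ / 12) η'
  refine ⟨Fintype.card ι, Fintype.card_pos, hcard.trans (le_max_left _ _),
    goodDecomp_of_decomp (Fintype.equivFin ι).symm
      (isReg_decompOf hη'.le (min_le_right _ _) (hirr.trans (hmin.trans (by linarith))))
      (regWrt_decompOf hd₀ hε₁ hη'.le (min_le_right _ _) hirr hg ?_)⟩
  have e1 : (Fintype.card (Fin L) : ℝ) * d₀ = ε₁ / 12 := by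
    rw [Fintype.card_fin, hd]
    field_simp
  have e2 : τ / (ε₁ * d₀ ^ 12 / 2) = ε₁ / 4 := by
    rw [hτ, mul_div_cancel_right₀]
    positivity
  rw [e1, e2]
  linarith

end HypReg

/-- Corollary 5.5: constant upper bound for `L_ℋ`. -/
theorem stmt_12 (ℋ : Set ThreeGraph) (hH : Hereditary ℋ) (L : ℕ) (hL : 1 ≤ L)
    (hmax : ∃ G : Bigraph, InBH ℋ G ∧ G.left.card = L)
    (hub : ∀ K : ℕ, (∃ G : Bigraph, InBH ℋ G ∧ G.left.card = K) → K ≤ L) :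
    SmallEps fun ε₁ ε₂ => Lfun ℋ ε₁ ε₂ ≤ L := by
  refine ⟨1, one_pos, fun ε₁ hε₁ _ => ⟨fun _ => 1, fun _ => ⟨one_pos, le_rfl⟩, fun ε₂ hε₂ _ => ?_⟩⟩
  obtain ⟨T, n₀, hT, h⟩ := HypReg.exists_goodDecomp hL hub hε₁ (hε₂ L).1
  refine Nat.sInf_le ⟨T, hT, n₀, fun H hHℋ hn => ?_⟩
  obtain ⟨t, ht1, ht, hgood⟩ := h H hHℋ hn
  exact ⟨t, L, ht1, ht, hL, le_rfl, hgood⟩
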